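/- Let n ≥ 1 and let Ω ⊊ ℝⁿ be a nonempty open convex proper subset of ℝⁿ. Suppose u ∈ C²(Ω) ∩ C⁰(cl Ω) satisfies the minimal surface equation ∑_{i=1}^n D_i( D_i u / √(1+|Du|²) ) = 0 at every point of Ω, and u = l on the topological frontier ∂Ω, where l : ℝⁿ → ℝ is an affine function. Then u is the restriction to cl Ω of an affine function, i.e. there exist a ∈ ℝⁿ and b ∈ ℝ with u(x) = a·x + b for all x ∈ cl Ω. -/

import Mathlib

open Set Metric

/-- The `i`-th partial derivative of `u` at `x`. -/
noncomputable def pderiv' {n : ℕ} (u : EuclideanSpace ℝ (Fin n) → ℝ) (i : Fin n)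
    (x : EuclideanSpace ℝ (Fin n)) : ℝ :=
  fderiv ℝ u x (EuclideanSpace.single i 1)

/-- The squared norm of the gradient of `u` at `x`: `|Du|² = ∑ᵢ (Dᵢu)²`. -/
noncomputable def gradSq {n : ℕ} (u : EuclideanSpace ℝ (Fin n) → ℝ)
    (x : EuclideanSpace ℝ (Fin n)) : ℝ :=
  ∑ i, (pderiv' u i x) ^ 2

/-- `u` satisfies the minimal surface equation
`∑ᵢ Dᵢ( Dᵢu / √(1+|Du|²) ) = 0` at every point of `Ω`. -/
def MinimalSurfaceEq {n : ℕ} (u : EuclideanSpace ℝ (Fin n) → ℝ)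
    (Ω : Set (EuclideanSpace ℝ (Fin n))) : Prop :=
  ∀ x ∈ Ω,
    ∑ i, pderiv' (fun y => pderiv' u i y / Real.sqrt (1 + gradSq u y)) i x = 0

set_option linter.unusedSectionVars false
set_option linter.deprecated false
set_option linter.unusedVariables false
namespace Bern
open MeasureTheory Filter Topology InnerProductSpace

variable {E : Type*} [NormedAddCommGroup E] [InnerProductSpace ℝ E] [FiniteDimensional ℝ E]
  [MeasurableSpace E] [BorelSpace E]

/-- weakly divergence free vector fields on `Ω` -/
def WeakDF (Ω : Set E) (Y : E → E) : Prop :=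
  ∀ ψ : E → ℝ, ContDiff ℝ 1 ψ → HasCompactSupport ψ → tsupport ψ ⊆ Ω →
    ∫ x, fderiv ℝ ψ x (Y x) = 0

theorem WeakDF.mono {Ω Ω' : Set E} {Y : E → E} (h : WeakDF Ω Y) (hs : Ω' ⊆ Ω) : WeakDF Ω' Y :=
  fun ψ h1 h2 h3 => h ψ h1 h2 (h3.trans hs)

theorem weakDF_const (Ω : Set E) (v : E) : WeakDF Ω (fun _ => v) := by
  intro ψ h1 h2 _
  have hc : Continuous (fun x => fderiv ℝ ψ x v) :=
    (h1.continuous_fderiv (by norm_num)).clm_apply continuous_const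
  have hs : HasCompactSupport (fun x => fderiv ℝ ψ x v) := by
    exact h2.fderiv_apply ℝ v
  have := integral_mul_fderiv_eq_neg_fderiv_mul_of_integrable (μ := (volume : Measure E))
    (f := fun _ : E => (1:ℝ)) (g := ψ) (v := v) (by simp)
    (by simpa using hc.integrable_of_hasCompactSupport hs)
    (by simpa using h1.continuous.integrable_of_hasCompactSupport h2)
    (by intros; fun_prop) (by intro x _; exact h1.differentiable (by norm_num) x)
  simpa using this

theorem contDiff_indicator {Ω K : Set E} (hΩ : IsOpen Ω) (hK : IsCompact K) (hKΩ : K ⊆ Ω)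
    {g : E → ℝ} (hg : ContDiffOn ℝ 1 g Ω) (h0 : ∀ x ∈ Ω, x ∉ K → g x = 0) :
    ContDiff ℝ 1 (Ω.indicator g) := by
  rw [contDiff_iff_contDiffAt]
  intro x
  by_cases hx : x ∈ Ω
  · have : ContDiffAt ℝ 1 g x := hg.contDiffAt (hΩ.mem_nhds hx)
    apply this.congr_of_eventuallyEq
    filter_upwards [hΩ.mem_nhds hx] with y hy
    simp [hy]
  · have hxK : x ∉ K := fun h => hx (hKΩ h)
    have : ContDiffAt ℝ 1 (fun _ : E => (0:ℝ)) x := contDiffAt_const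
    apply this.congr_of_eventuallyEq
    filter_upwards [hK.isClosed.isOpen_compl.mem_nhds hxK] with y hy
    by_cases hyΩ : y ∈ Ω
    · simp [hyΩ, h0 y hyΩ hy]
    · simp [hyΩ]

theorem tsupport_indicator {Ω K : Set E} (hK : IsCompact K)
    {g : E → ℝ} (h0 : ∀ x ∈ Ω, x ∉ K → g x = 0) :
    tsupport (Ω.indicator g) ⊆ K := by
  apply closure_minimal _ hK.isClosed
  intro x hx
  by_contra hxK
  apply hx
  by_cases hyΩ : x ∈ Ω
  · simp [hyΩ, h0 x hyΩ hxK]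
  · simp [hyΩ]

theorem fderiv_zero_off {Ω K : Set E} (hΩ : IsOpen Ω) (hK : IsCompact K)
    {g : E → ℝ} (h0 : ∀ x ∈ Ω, x ∉ K → g x = 0) {x : E} (hx : x ∈ Ω) (hxK : x ∉ K) :
    fderiv ℝ g x = 0 := by
  have : g =ᶠ[𝓝 x] fun _ => 0 := by
    filter_upwards [hΩ.mem_nhds hx, hK.isClosed.isOpen_compl.mem_nhds hxK] with y hy hy2
    exact h0 y hy hy2
  rw [this.fderiv_eq]; simp

theorem weak_test {Ω K : Set E} (hΩ : IsOpen Ω) (hK : IsCompact K) (hKΩ : K ⊆ Ω)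
    {Y : E → E} (hY : WeakDF Ω Y)
    {g : E → ℝ} (hg : ContDiffOn ℝ 1 g Ω) (h0 : ∀ x ∈ Ω, x ∉ K → g x = 0) :
    ∫ x in Ω, fderiv ℝ g x (Y x) = 0 := by
  have hts := tsupport_indicator hK h0
  have := hY _ (contDiff_indicator hΩ hK hKΩ hg h0) (HasCompactSupport.of_support_subset_isCompact hK
    ((subset_tsupport _).trans hts)) (hts.trans hKΩ)
  rw [← this, ← integral_indicator hΩ.measurableSet]
  congr 1
  ext x
  by_cases hx : x ∈ Ω
  · simp only [hx, indicator_of_mem]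
    have : Ω.indicator g =ᶠ[𝓝 x] g := by
      filter_upwards [hΩ.mem_nhds hx] with y hy
      simp [hy]
    rw [this.fderiv_eq]
  · simp only [hx, not_false_eq_true, indicator_of_notMem]
    have hxK : x ∉ tsupport (Ω.indicator g) := fun h => hx (hKΩ (hts h))
    have : fderiv ℝ (Ω.indicator g) x = 0 := by
      by_contra h
      exact hxK (support_fderiv_subset ℝ h)
    simp [this]

/-- at a.e. zero of `w`, the derivative vanishes -/
theorem ae_zero_fderiv {Ω : Set E} (hΩ : IsOpen Ω) {w : E → ℝ} (hw : ContinuousOn w Ω)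
    (hd : ∀ x ∈ Ω, DifferentiableAt ℝ w x) :
    ∀ᵐ x ∂(volume.restrict Ω), w x = 0 → fderiv ℝ w x = 0 := by
  rcases subsingleton_or_nontrivial E with hE | hE
  · refine Eventually.of_forall fun x _ => ?_
    ext v
    rw [Subsingleton.elim v 0]; simp
  obtain ⟨e, he⟩ := exists_ne (0 : E)
  set s : Set E := {x | x ∈ Ω ∧ w x = 0} with hs
  have hsm : MeasurableSet s := by
    have : s = Ω ∩ (Ω.indicator w) ⁻¹' {0} := by
      ext x; simp only [hs, mem_setOf_eq, mem_inter_iff, mem_preimage, mem_singleton_iff]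
      constructor
      · rintro ⟨h1, h2⟩; simp [h1, h2]
      · rintro ⟨h1, h2⟩; simpa [h1] using h2
    rw [this]
    have hm : Measurable (Ω.indicator w) := by
      classical
      have := hw.measurable_piecewise (g := fun _ => (0:ℝ)) continuousOn_const hΩ.measurableSet
      rw [← piecewise_eq_indicator]; exact this
    exact hΩ.measurableSet.inter (hm (measurableSet_singleton 0))
  have key := ApproximatesLinearOn.norm_fderiv_sub_le (μ := (volume : Measure E))
    (f := fun x => w x • e) (s := s)
    (A := 0) (δ := 0) (by
      intro x hx y hy
      simp [hx.2, hy.2]) hsm (fun x => (fderiv ℝ w x).smulRight e) (by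
      intro x hx
      exact ((hd x hx.1).hasFDerivAt.smul_const e).hasFDerivWithinAt)
  rw [ae_restrict_iff' hsm] at key
  rw [ae_restrict_iff' hΩ.measurableSet]
  filter_upwards [key] with x hx hxΩ h0
  have h := hx ⟨hxΩ, h0⟩
  simp only [sub_zero, nonpos_iff_eq_zero, nnnorm_eq_zero] at h
  ext v
  have := congrArg (fun L => L v) h
  simpa [he] using this

theorem contOn_interval {F : Type*} [NormedAddCommGroup F] [NormedSpace ℝ F]
    {Ω : Set E} {f : E → ℝ → F} {a b : E → ℝ}
    (hf : ContinuousOn (fun p : E × ℝ => f p.1 p.2) (Ω ×ˢ univ))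
    (ha : ContinuousOn a Ω) (hb : ContinuousOn b Ω) :
    ContinuousOn (fun x => ∫ t in a x..b x, f x t) Ω := by
  rw [continuousOn_iff_continuous_restrict] at *
  have hf' : Continuous (Function.uncurry fun (x : Ω) (t : ℝ) => f x t) := by
    have : Continuous (fun p : Ω × ℝ => (⟨(p.1.1, p.2), ⟨p.1.2, mem_univ _⟩⟩ : ↥(Ω ×ˢ (univ : Set ℝ)))) := by
      fun_prop
    exact hf.comp this
  have h1 := intervalIntegral.continuous_parametric_intervalIntegral_of_continuous (μ := volume) (a₀ := 0) hf' ha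
  have h2 := intervalIntegral.continuous_parametric_intervalIntegral_of_continuous (μ := volume) (a₀ := 0) hf' hb
  refine (h2.sub h1).congr ?_
  intro x
  simp only [restrict_apply]
  have hi : ∀ c d : ℝ, IntervalIntegrable (fun t => f x t) volume c d := fun c d =>
    (hf'.comp (Continuous.prodMk_right x)).intervalIntegrable _ _
  simp only [Pi.sub_apply]
  rw [← intervalIntegral.integral_add_adjacent_intervals (hi 0 (a x)) (hi (a x) (b x))]
  simp

/-! cutoff near the zero set -/
noncomputable def chi (τ : ℝ) : ℝ := Real.smoothTransition (τ ^ 2 - 1)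

theorem chi_contDiff : ContDiff ℝ 1 chi := by
  unfold chi; exact Real.smoothTransition.contDiff.comp (by fun_prop)
theorem chi_nonneg (τ : ℝ) : 0 ≤ chi τ := Real.smoothTransition.nonneg _
theorem chi_le_one (τ : ℝ) : chi τ ≤ 1 := Real.smoothTransition.le_one _
theorem chi_zero {τ : ℝ} (h : |τ| ≤ 1) : chi τ = 0 := by
  apply Real.smoothTransition.zero_of_nonpos
  have := abs_le.1 h
  nlinarith
theorem chi_one {τ : ℝ} (h : 2 ≤ |τ|) : chi τ = 1 := by
  apply Real.smoothTransition.one_of_one_le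
  have := sq_abs τ
  nlinarith
theorem chi_deriv_zero {τ : ℝ} (h : 2 < |τ|) : deriv chi τ = 0 := by
  have : chi =ᶠ[𝓝 τ] fun _ => 1 := by
    have : {y : ℝ | 2 < |y|} ∈ 𝓝 τ := (isOpen_lt continuous_const continuous_abs).mem_nhds h
    filter_upwards [this] with y hy
    exact chi_one (le_of_lt hy)
  rw [this.deriv_eq]; simp
theorem chi_deriv_zero' {τ : ℝ} (h : |τ| < 1) : deriv chi τ = 0 := by
  have : chi =ᶠ[𝓝 τ] fun _ => 0 := by
    have : {y : ℝ | |y| < 1} ∈ 𝓝 τ := (isOpen_lt continuous_abs continuous_const).mem_nhds h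
    filter_upwards [this] with y hy
    exact chi_zero (le_of_lt hy)
  rw [this.deriv_eq]; simp
theorem chi_deriv_cont : Continuous (deriv chi) := chi_contDiff.continuous_deriv (by norm_num)
theorem chi_bound : ∃ C : ℝ, 0 ≤ C ∧ ∀ τ, |deriv chi τ * τ| ≤ C := by
  have hc : Continuous fun τ => |deriv chi τ * τ| := (chi_deriv_cont.mul continuous_id).abs
  obtain ⟨C, hC⟩ := (isCompact_Icc (a := (-2:ℝ)) (b := 2)).bddAbove_image hc.continuousOn
  refine ⟨max C 0, le_max_right _ _, fun τ => ?_⟩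
  by_cases h : |τ| ≤ 2
  · exact le_max_of_le_left (hC ⟨τ, abs_le.1 h, rfl⟩)
  · rw [chi_deriv_zero (not_le.1 h)]; simp
theorem chi_deriv_sign (τ : ℝ) : 0 ≤ deriv chi τ * τ := by
  have hd : HasDerivAt chi (deriv Real.smoothTransition (τ ^ 2 - 1) * (2 * τ)) τ := by
    have h1 : HasDerivAt (fun τ : ℝ => τ ^ 2 - 1) (2 * τ) τ := by
      simpa using (hasDerivAt_pow 2 τ).sub_const 1
    have h2 : DifferentiableAt ℝ Real.smoothTransition (τ ^ 2 - 1) :=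
      (Real.smoothTransition.contDiff (n := 1)).differentiable (by norm_num) _
    exact h2.hasDerivAt.comp τ h1
  rw [hd.deriv]
  have : 0 ≤ deriv Real.smoothTransition (τ ^ 2 - 1) := Real.smoothTransition.monotone.deriv_nonneg
  nlinarith [mul_nonneg this (sq_nonneg τ)]
theorem hasFDerivAt_chi {G : Type*} [NormedAddCommGroup G] [NormedSpace ℝ G] {g : G → ℝ}
    {g' : G →L[ℝ] ℝ} {x : G} (h : HasFDerivAt g g' x) :
    HasFDerivAt (fun y => chi (g y)) (deriv chi (g x) • g') x := by
  have hchi : HasDerivAt chi (deriv chi (g x)) (g x) :=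
    (chi_contDiff.differentiable (by norm_num) _).hasDerivAt
  exact HasDerivAt.comp_hasFDerivAt (h₂ := chi) x hchi h
attribute [irreducible] chi
theorem contDiff_inner_left (q : E) : ContDiff ℝ 2 (fun x : E => (inner ℝ q x : ℝ)) :=
  contDiff_const.inner ℝ contDiff_id
end Bern

namespace Bern
open MeasureTheory Filter Topology InnerProductSpace

variable {E : Type*} [NormedAddCommGroup E] [InnerProductSpace ℝ E] [FiniteDimensional ℝ E]
  [MeasurableSpace E] [BorelSpace E]

theorem compactK {Ω : Set E} (hΩ : IsOpen Ω) {w : E → ℝ} (hw : ContinuousOn w (closure Ω))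
    (h0 : ∀ x ∈ frontier Ω, w x = 0) {δ R : ℝ} (hδ : 0 < δ) :
    IsCompact ({x | x ∈ closure Ω ∧ δ ≤ |w x|} ∩ closedBall 0 R) ∧
    ({x | x ∈ closure Ω ∧ δ ≤ |w x|} ∩ closedBall 0 R) ⊆ Ω := by
  constructor
  · apply (isCompact_closedBall (0:E) R).inter_left
    exact ContinuousOn.preimage_isClosed_of_isClosed hw.abs isClosed_closure (isClosed_Ici (a := δ))
  · rintro x ⟨⟨h1, h2⟩, -⟩
    by_contra hx
    have : x ∈ frontier Ω := by
      rw [hΩ.frontier_eq]; exact ⟨h1, hx⟩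
    rw [h0 x this] at h2
    simp at h2; linarith

theorem setInt_eq {Ω K : Set E} (hΩ : IsOpen Ω) (hK : IsCompact K) (hKΩ : K ⊆ Ω) {f : E → ℝ}
    (h : ∀ x ∈ Ω, x ∉ K → f x = 0) : ∫ x in Ω, f x = ∫ x in K, f x :=
  setIntegral_eq_of_subset_of_forall_diff_eq_zero hΩ.measurableSet hKΩ
    (fun x hx => h x hx.1 hx.2)

theorem integrableOn_of_K {Ω K : Set E} (hΩ : IsOpen Ω) (hK : IsCompact K) (hKΩ : K ⊆ Ω) {f : E → ℝ}
    (hf : ContinuousOn f Ω) (h : ∀ x ∈ Ω, x ∉ K → f x = 0) : IntegrableOn f Ω :=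
  ((hf.mono hKΩ).integrableOn_compact hK).of_forall_diff_eq_zero hΩ.measurableSet
    (fun x hx => h x hx.1 hx.2)

theorem flux_piece {Ω : Set E} (hΩ : IsOpen Ω) {q : E} {v : E → ℝ} (hv : ContDiffOn ℝ 1 v Ω)
    (hvc : ContinuousOn v (closure Ω)) (hb : ∀ x ∈ frontier Ω, v x = inner ℝ q x) {R : ℝ}
    (hIg : IntegrableOn (fun x => ‖fderiv ℝ v x‖) (Ω ∩ ball 0 R))
    {Y : E → E} (hYc : ContinuousOn Y Ω) {B : ℝ} (hYb : ∀ x ∈ Ω, ‖Y x‖ ≤ B) (hY : WeakDF Ω Y)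
    {c : E × ℝ → ℝ} (hc : ContDiffOn ℝ 1 c (Ω ×ˢ univ)) {M : ℝ}
    (hM : ∀ x ∈ Ω, ∀ ζ, |c (x, ζ)| ≤ M) (hR : ∀ x ∈ Ω, ∀ ζ, R ≤ ‖x‖ → c (x, ζ) = 0) :
    (∀ k : ℕ, IntegrableOn (fun x => chi (((k:ℝ) + 1) * (v x - inner ℝ q x)) *
      (c (x, v x) * fderiv ℝ v x (Y x) - c (x, inner ℝ q x) * inner ℝ q (Y x)
        + ∫ ζ in (inner ℝ q x)..(v x), fderiv ℝ c (x, ζ) (Y x, 0))) Ω) ∧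
    Tendsto (fun k : ℕ => ∫ x in Ω, chi (((k:ℝ) + 1) * (v x - inner ℝ q x)) *
      (c (x, v x) * fderiv ℝ v x (Y x) - c (x, inner ℝ q x) * inner ℝ q (Y x)
        + ∫ ζ in (inner ℝ q x)..(v x), fderiv ℝ c (x, ζ) (Y x, 0))) atTop (𝓝 0) := by
  set w : E → ℝ := fun x => v x - inner ℝ q x with hwdef
  have hwc : ContinuousOn w (closure Ω) := hvc.sub (by fun_prop)
  have hw0 : ∀ x ∈ frontier Ω, w x = 0 := fun x hx => by simp [hwdef, hb x hx]
  have hwΩ : ContinuousOn w Ω := hwc.mono subset_closure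
  have hvΩ : ContinuousOn v Ω := hvc.mono subset_closure
  have hqc : ContinuousOn (fun x : E => inner ℝ q x) Ω := by fun_prop
  have hΩ2 : IsOpen (Ω ×ˢ (univ : Set ℝ)) := hΩ.prod isOpen_univ
  have hdv : ContinuousOn (fun x => fderiv ℝ v x) Ω := hv.continuousOn_fderiv_of_isOpen hΩ (by norm_num)
  have hvY : ContinuousOn (fun x => fderiv ℝ v x (Y x)) Ω := hdv.clm_apply hYc
  have hqY : ContinuousOn (fun x => inner ℝ q (Y x)) Ω := continuousOn_const.inner hYc
  have hdc : ContinuousOn (fun p => fderiv ℝ c p) (Ω ×ˢ univ) :=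
    hc.continuousOn_fderiv_of_isOpen hΩ2 (by norm_num)
  have hcc := hc.continuousOn
  -- the path
  set P : E → ℝ → E × ℝ := fun x s => (x, inner ℝ q x + s * w x) with hP
  have hPc : ContinuousOn (fun p : E × ℝ => P p.1 p.2) (Ω ×ˢ univ) := by
    have : ContinuousOn (fun p : E × ℝ => w p.1) (Ω ×ˢ univ) :=
      hwΩ.comp continuousOn_fst (fun p hp => hp.1)
    apply ContinuousOn.prodMk continuousOn_fst
    exact ContinuousOn.add (by fun_prop) (continuousOn_snd.mul this)
  have hPm : ∀ x ∈ Ω, ∀ s, P x s ∈ Ω ×ˢ (univ : Set ℝ) := fun x hx s => ⟨hx, mem_univ _⟩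
  have hcP : ContinuousOn (fun p : E × ℝ => c (P p.1 p.2)) (Ω ×ˢ univ) :=
    hcc.comp hPc (fun p hp => hPm _ hp.1 _)
  have hdcP : ContinuousOn (fun p : E × ℝ => fderiv ℝ c (P p.1 p.2)) (Ω ×ˢ univ) :=
    hdc.comp hPc (fun p hp => hPm _ hp.1 _)
  set wY : E → ℝ := fun x => fderiv ℝ v x (Y x) - inner ℝ q (Y x) with hwY
  have hwYc : ContinuousOn wY Ω := hvY.sub hqY
  set Br : E → ℝ := fun x => (c (x, v x) * fderiv ℝ v x (Y x) - c (x, inner ℝ q x) * inner ℝ q (Y x)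
        + ∫ ζ in (inner ℝ q x)..(v x), fderiv ℝ c (x, ζ) (Y x, 0)) with hBr
  have hBrc : ContinuousOn Br Ω := by
    have e1 : ContinuousOn (fun x => c (x, v x)) Ω :=
      hcc.comp (continuousOn_id.prodMk hvΩ) (fun x hx => ⟨hx, mem_univ _⟩)
    have e2 : ContinuousOn (fun x => c (x, inner ℝ q x)) Ω :=
      hcc.comp (continuousOn_id.prodMk hqc) (fun x hx => ⟨hx, mem_univ _⟩)
    have e3 : ContinuousOn (fun p : E × ℝ => fderiv ℝ c (p.1, p.2) (Y p.1, 0)) (Ω ×ˢ univ) := by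
      refine hdc.clm_apply ?_
      exact (hYc.comp continuousOn_fst (fun p hp => hp.1)).prodMk continuousOn_const
    exact ((e1.mul hvY).sub (e2.mul hqY)).add (contOn_interval (f := fun x ζ => fderiv ℝ c (x, ζ) (Y x, 0)) e3 hqc hvΩ)
  set I : E → ℝ := fun x => ∫ s in (0:ℝ)..1, c (P x s) with hI
  have hIc : ContinuousOn I Ω :=
    contOn_interval (f := fun x s => c (P x s)) hcP continuousOn_const continuousOn_const
  set rem : ℕ → E → ℝ := fun k x => deriv chi (((k:ℝ)+1) * w x) * (((k:ℝ)+1) * w x) * (wY x * I x) with hrem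
  have hremc : ∀ k, ContinuousOn (rem k) Ω := by
    intro k
    have e1 : ContinuousOn (fun x => ((k:ℝ)+1) * w x) Ω := continuousOn_const.mul hwΩ
    exact ((chi_deriv_cont.comp_continuousOn e1).mul e1).mul (hwYc.mul hIc)
  -- the main identity
  have main : ∀ k : ℕ, IntegrableOn (fun x => chi (((k:ℝ)+1) * w x) * Br x) Ω ∧
      ∫ x in Ω, chi (((k:ℝ)+1) * w x) * Br x = - ∫ x in Ω, rem k x := by
    intro k
    set a : ℝ := (k:ℝ)+1 with ha
    have hapos : 0 < a := by positivity
    obtain ⟨hK, hKΩ⟩ := compactK hΩ hwc hw0 (R := R) (inv_pos.2 hapos)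
    set K := ({x | x ∈ closure Ω ∧ a⁻¹ ≤ |w x|} ∩ closedBall (0:E) R) with hKdef
    have hoff : ∀ x ∈ Ω, x ∉ K → |a * w x| < 1 ∨ R ≤ ‖x‖ := by
      intro x hx hxK
      by_contra hcon
      push Not at hcon
      apply hxK
      refine ⟨⟨subset_closure hx, ?_⟩, by simpa using hcon.2.le⟩
      have := hcon.1
      rw [abs_mul, abs_of_pos hapos] at this
      rw [inv_le_iff_one_le_mul₀ hapos]; linarith
    set g : ℝ → E → ℝ := fun s x => chi (a * w x) * w x * c (P x s) with hg
    set A : E → ℝ → ℝ := fun x s => deriv chi (a * w x) * (a * w x) * (wY x * c (P x s))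
      + chi (a * w x) * (wY x * c (P x s) + w x * fderiv ℝ c (P x s) (Y x, inner ℝ q (Y x) + s * wY x)) with hA
    have hwd : ∀ x ∈ Ω, HasFDerivAt w (fderiv ℝ v x - innerSL ℝ q) x := by
      intro x hx
      have h1 : HasFDerivAt v (fderiv ℝ v x) x :=
        ((hv.differentiableOn (by norm_num)).differentiableAt (hΩ.mem_nhds hx)).hasFDerivAt
      exact h1.sub (innerSL ℝ q).hasFDerivAt
    have hgd : ∀ s, ∀ x ∈ Ω, fderiv ℝ (g s) x (Y x) = A x s := by
      intro s x hx
      have h1 : HasFDerivAt (fun x => chi (a * w x)) ((deriv chi (a * w x)) • (a • (fderiv ℝ v x - innerSL ℝ q))) x := by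
        exact hasFDerivAt_chi ((hwd x hx).const_mul a)
      have h2 : HasFDerivAt (fun x => P x s) ((ContinuousLinearMap.id ℝ E).prod
          (innerSL ℝ q + s • (fderiv ℝ v x - innerSL ℝ q))) x :=
        (hasFDerivAt_id x).prodMk ((innerSL ℝ q).hasFDerivAt.add ((hwd x hx).const_mul s))
      have h3 : HasFDerivAt c (fderiv ℝ c (P x s)) (P x s) :=
        ((hc.differentiableOn (by norm_num)).differentiableAt (hΩ2.mem_nhds (hPm x hx s))).hasFDerivAt
      have h4 := (h1.mul (hwd x hx)).mul (h3.comp x h2)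
      have h5 : fderiv ℝ (g s) x = _ := h4.fderiv
      rw [h5]
      simp only [hA, hwY]
      simp
      ring
    have hgC : ∀ s, ContDiffOn ℝ 1 (g s) Ω := by
      intro s
      have hwC : ContDiffOn ℝ 1 w Ω := hv.sub ((contDiff_inner_left q).of_le (by norm_num)).contDiffOn
      have e1 : ContDiffOn ℝ 1 (fun x => chi (a * w x)) Ω :=
        chi_contDiff.comp_contDiffOn (contDiffOn_const.mul hwC)
      have e2 : ContDiffOn ℝ 1 (fun x => P x s) Ω := by
        apply ContDiffOn.prodMk contDiffOn_id
        exact ContDiffOn.add ((contDiff_inner_left q).of_le (by norm_num)).contDiffOn (contDiffOn_const.mul hwC)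
      exact (e1.mul hwC).mul (hc.comp e2 (fun x hx => hPm x hx s))
    have hg0 : ∀ s, ∀ x ∈ Ω, x ∉ K → g s x = 0 := by
      intro s x hx hxK
      rcases hoff x hx hxK with h | h
      · simp [hg, chi_zero h.le]
      · simp [hg, hP, hR x hx _ h]
    have hA0 : ∀ s, ∀ x ∈ Ω, x ∉ K → A x s = 0 := by
      intro s x hx hxK
      rw [← hgd s x hx, fderiv_zero_off hΩ hK (hg0 s) hx hxK]; simp
    have hAint : ∀ s, ∫ x in K, A x s = 0 := by
      intro s
      rw [← setInt_eq hΩ hK hKΩ (hA0 s), ← weak_test hΩ hK hKΩ hY (hgC s) (hg0 s)]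
      exact setIntegral_congr_fun hΩ.measurableSet (fun x hx => (hgd s x hx).symm)
    have hAc : ContinuousOn (fun p : E × ℝ => A p.1 p.2) (Ω ×ˢ univ) := by
      have m : MapsTo (fun p : E × ℝ => p.1) (Ω ×ˢ (univ : Set ℝ)) Ω := fun p hp => hp.1
      have f1 : ContinuousOn (fun p : E × ℝ => a * w p.1) (Ω ×ˢ univ) :=
        continuousOn_const.mul (hwΩ.comp continuousOn_fst m)
      have f2 : ContinuousOn (fun p : E × ℝ => wY p.1) (Ω ×ˢ univ) := hwYc.comp continuousOn_fst m
      have f3 : ContinuousOn (fun p : E × ℝ => w p.1) (Ω ×ˢ univ) := hwΩ.comp continuousOn_fst m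
      have f4 : ContinuousOn (fun p : E × ℝ => inner ℝ q (Y p.1)) (Ω ×ˢ univ) := hqY.comp continuousOn_fst m
      have f5 : ContinuousOn (fun p : E × ℝ => Y p.1) (Ω ×ˢ univ) := hYc.comp continuousOn_fst m
      exact (((chi_deriv_cont.comp_continuousOn f1).mul f1).mul (f2.mul hcP)).add
        ((chi_contDiff.continuous.comp_continuousOn f1).mul ((f2.mul hcP).add
          (f3.mul (hdcP.clm_apply (f5.prodMk (f4.add (continuousOn_snd.mul f2)))))))
    have hfub : ∫ x in K, ∫ s in (0:ℝ)..1, A x s = 0 := by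
      have hi : IntegrableOn (fun p : E × ℝ => A p.1 p.2) (K ×ˢ Icc (0:ℝ) 1) :=
        (hAc.mono (prod_mono hKΩ (subset_univ _))).integrableOn_compact (hK.prod isCompact_Icc)
      have hi2 : Integrable (Function.uncurry A) ((volume.restrict K).prod (volume.restrict (Ioc (0:ℝ) 1))) := by
        rw [Measure.prod_restrict]
        exact hi.mono_set (prod_mono le_rfl Ioc_subset_Icc_self)
      have := integral_integral_swap hi2
      simp only [hAint] at this
      simpa [intervalIntegral.integral_of_le] using this
    have hinner : ∀ x ∈ Ω, ∫ s in (0:ℝ)..1, A x s = rem k x + chi (a * w x) * Br x := by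
      intro x hx
      have c1 : Continuous (fun s => c (P x s)) := by
        have : ContinuousOn (fun s : ℝ => c (P x s)) univ :=
          hcP.comp (f := fun s : ℝ => ((x, s) : E × ℝ)) (by fun_prop) (fun s _ => ⟨hx, mem_univ _⟩)
        exact continuousOn_univ.1 this
      have c2 : Continuous (fun s => fderiv ℝ c (P x s)) := by
        have : ContinuousOn (fun s : ℝ => fderiv ℝ c (P x s)) univ :=
          hdcP.comp (f := fun s : ℝ => ((x, s) : E × ℝ)) (by fun_prop) (fun s _ => ⟨hx, mem_univ _⟩)
        exact continuousOn_univ.1 this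
      have hder : ∀ s : ℝ, HasDerivAt (fun s => c (P x s) * (inner ℝ q (Y x) + s * wY x))
          (fderiv ℝ c (P x s) (0, w x) * (inner ℝ q (Y x) + s * wY x) + c (P x s) * wY x) s := by
        intro s
        have h3 : HasFDerivAt c (fderiv ℝ c (P x s)) (P x s) :=
          ((hc.differentiableOn (by norm_num)).differentiableAt (hΩ2.mem_nhds (hPm x hx s))).hasFDerivAt
        have h2 : HasDerivAt (fun s => P x s) ((0:E), w x) s := by
          apply (hasDerivAt_const s x).prodMk
          simpa using ((hasDerivAt_id s).mul_const (w x)).const_add (inner ℝ q x)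
        have h4 := h3.comp_hasDerivAt s h2
        have h5 : HasDerivAt (fun s : ℝ => inner ℝ q (Y x) + s * wY x) (wY x) s := by
          simpa using ((hasDerivAt_id s).mul_const (wY x)).const_add (inner ℝ q (Y x))
        exact h4.mul h5
      have hftc := intervalIntegral.integral_eq_sub_of_hasDerivAt (a := 0) (b := 1) (fun s _ => hder s)
        (Continuous.intervalIntegrable (((c2.clm_apply continuous_const).mul (by fun_prop)).add (c1.mul continuous_const)) _ _)
      have hsub : ∫ s in (0:ℝ)..1, w x * fderiv ℝ c (P x s) (Y x, 0) =
          ∫ ζ in (inner ℝ q x)..(v x), fderiv ℝ c (x, ζ) (Y x, 0) := by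
        have := intervalIntegral.smul_integral_comp_add_mul (a := 0) (b := 1)
          (fun ζ => fderiv ℝ c (x, ζ) (Y x, 0)) (w x) (inner ℝ q x)
        rw [intervalIntegral.integral_const_mul]
        simp only [smul_eq_mul] at this
        simp only [hP]
        have e : ∀ s : ℝ, s * w x = w x * s := fun s => mul_comm _ _
        simp only [e]
        rw [this]
        simp [hwdef]
      have hsplit : ∀ s, A x s = (deriv chi (a * w x) * (a * w x) * wY x) * c (P x s)
          + chi (a * w x) * ((fderiv ℝ c (P x s) (0, w x) * (inner ℝ q (Y x) + s * wY x) + c (P x s) * wY x)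
            + w x * fderiv ℝ c (P x s) (Y x, 0)) := by
        intro s
        have e1 : ((Y x, inner ℝ q (Y x) + s * wY x) : E × ℝ) = (Y x, 0) + (inner ℝ q (Y x) + s * wY x) • (0, 1) := by
          ext <;> simp
        have e2 : ((0, w x) : E × ℝ) = w x • (0, 1) := by ext <;> simp
        simp only [hA]
        rw [e1, e2]
        simp only [map_add, map_smul, smul_eq_mul]
        ring
      simp only [hsplit]
      have i1 : IntervalIntegrable (fun s => c (P x s)) volume 0 1 := c1.intervalIntegrable _ _
      have i2 : IntervalIntegrable (fun s => (fderiv ℝ c (P x s) (0, w x) * (inner ℝ q (Y x) + s * wY x) + c (P x s) * wY x)) volume 0 1 :=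
        Continuous.intervalIntegrable (((c2.clm_apply continuous_const).mul (by fun_prop)).add (c1.mul continuous_const)) _ _
      have i3 : IntervalIntegrable (fun s => w x * fderiv ℝ c (P x s) (Y x, 0)) volume 0 1 :=
        Continuous.intervalIntegrable (continuous_const.mul (c2.clm_apply continuous_const)) _ _
      rw [intervalIntegral.integral_add (i1.const_mul _) ((i2.add i3).const_mul _),
        intervalIntegral.integral_const_mul, intervalIntegral.integral_const_mul,
        intervalIntegral.integral_add i2 i3, hftc, hsub]
      simp only [hrem, hI, hBr, hP, hwY, hwdef]
      simp
      ring
    have hr0 : ∀ x ∈ Ω, x ∉ K → rem k x = 0 := by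
      intro x hx hxK
      rcases hoff x hx hxK with h | h
      · simp only [hrem, ← ha]; simp [chi_deriv_zero' h]
      · simp [hrem, hI, hP, hR x hx _ h]
    have hB0 : ∀ x ∈ Ω, x ∉ K → chi (a * w x) * Br x = 0 := by
      intro x hx hxK
      have := hinner x hx
      simp only [hA0 _ x hx hxK, hr0 x hx hxK] at this
      simpa using this.symm
    have hchiBr : ContinuousOn (fun x => chi (a * w x) * Br x) Ω :=
      (chi_contDiff.continuous.comp_continuousOn (continuousOn_const.mul hwΩ)).mul hBrc
    refine ⟨integrableOn_of_K hΩ hK hKΩ hchiBr hB0, ?_⟩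
    rw [setInt_eq hΩ hK hKΩ hB0, setInt_eq hΩ hK hKΩ hr0]
    rw [setIntegral_congr_fun hK.measurableSet (fun x hx => hinner x (hKΩ hx)),
      integral_add ((hremc k).mono hKΩ |>.integrableOn_compact hK)
        (hchiBr.mono hKΩ |>.integrableOn_compact hK)] at hfub
    linarith
  -- the remainder tends to zero
  have hlim : Tendsto (fun k : ℕ => ∫ x in Ω, rem k x) atTop (𝓝 (∫ x in Ω, (0:ℝ))) := by
    obtain ⟨C, hC0, hC⟩ := chi_bound
    apply tendsto_integral_of_dominated_convergence
      (fun x => (ball (0:E) R).indicator (fun x => C * ((‖fderiv ℝ v x‖ * |B| + ‖q‖ * |B|) * |M|)) x)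
    · intro k
      exact (hremc k).aestronglyMeasurable hΩ.measurableSet
    · rw [← IntegrableOn, integrableOn_indicator_iff measurableSet_ball, inter_comm]
      apply Integrable.const_mul
      apply Integrable.mul_const
      apply Integrable.add
      · exact hIg.mul_const _
      · exact integrableOn_const (((measure_mono inter_subset_right).trans_lt measure_ball_lt_top).ne) enorm_ne_top
    · intro k
      rw [ae_restrict_iff' hΩ.measurableSet]
      refine Eventually.of_forall fun x hx => ?_
      by_cases hxR : x ∈ ball (0:E) R
      · rw [indicator_of_mem hxR]
        simp only [hrem, Real.norm_eq_abs]
        rw [abs_mul]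
        have b1 : |wY x| ≤ ‖fderiv ℝ v x‖ * |B| + ‖q‖ * |B| := by
          have hb' : ‖Y x‖ ≤ |B| := (hYb x hx).trans (le_abs_self _)
          refine (abs_sub _ _).trans (add_le_add ?_ ?_)
          · exact ((fderiv ℝ v x).le_opNorm _).trans (by gcongr)
          · exact (abs_real_inner_le_norm _ _).trans (by gcongr)
        have b2 : |I x| ≤ |M| := by
          have := intervalIntegral.norm_integral_le_of_norm_le_const (a := (0:ℝ)) (b := 1) (C := |M|)
            (f := fun s => c (P x s)) (fun s _ => (hM x hx _).trans (le_abs_self _))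
          simpa using this
        have b3 := hC (((k:ℝ)+1) * w x)
        have b4 : |wY x * I x| ≤ (‖fderiv ℝ v x‖ * |B| + ‖q‖ * |B|) * |M| := by
          rw [abs_mul]; gcongr
        exact mul_le_mul b3 b4 (abs_nonneg _) hC0
      · rw [indicator_of_notMem hxR]
        have : R ≤ ‖x‖ := by simpa using hxR
        simp [hrem, hI, hP, hR x hx _ this]
    · rw [ae_restrict_iff' hΩ.measurableSet]
      refine Eventually.of_forall fun x hx => ?_
      apply tendsto_const_nhds.congr'
      by_cases hwx : w x = 0
      · simp [hrem, hwx]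
      · obtain ⟨N, hN⟩ := exists_nat_gt (2 / |w x|)
        filter_upwards [eventually_ge_atTop N] with k hk
        have : 2 < |((k:ℝ)+1) * w x| := by
          have hk' : (N:ℝ) ≤ k := by exact_mod_cast hk
          have hwp : 0 < |w x| := abs_pos.2 hwx
          rw [div_lt_iff₀ hwp] at hN
          rw [abs_mul, abs_of_nonneg (by positivity)]
          nlinarith
        simp [hrem, chi_deriv_zero this]
  have : (fun k : ℕ => ∫ x in Ω, chi (((k:ℝ)+1) * w x) * Br x) = fun k => - ∫ x in Ω, rem k x := funext fun k => (main k).2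
  refine ⟨fun k => (main k).1, ?_⟩
  rw [this]
  simpa using hlim.neg
end Bern

namespace Bern
open MeasureTheory Filter Topology InnerProductSpace

variable {E : Type*} [NormedAddCommGroup E] [InnerProductSpace ℝ E] [FiniteDimensional ℝ E]
  [MeasurableSpace E] [BorelSpace E]

/-- Fatou lemma for real functions -/
theorem real_fatou {α : Type*} [MeasurableSpace α] {μ : Measure α} {f : ℕ → α → ℝ} {g : α → ℝ} {C : ℝ}
    (hi : ∀ k, Integrable (f k) μ) (h0 : ∀ k, ∀ᵐ x ∂μ, 0 ≤ f k x)
    (hl : ∀ᵐ x ∂μ, Tendsto (fun k => f k x) atTop (𝓝 (g x))) (hC : ∀ k, ∫ x, f k x ∂μ ≤ C) :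
    Integrable g μ ∧ ∫ x, g x ∂μ ≤ C := by
  have hm : AEStronglyMeasurable g μ :=
    aestronglyMeasurable_of_tendsto_ae atTop (fun k => (hi k).aestronglyMeasurable) hl
  have hg0 : ∀ᵐ x ∂μ, 0 ≤ g x := by
    filter_upwards [ae_all_iff.2 h0, hl] with x h1 h2
    exact ge_of_tendsto' h2 h1
  have h1 : ∫⁻ x, ENNReal.ofReal (g x) ∂μ ≤ ENNReal.ofReal C := by
    have e1 : ∫⁻ x, ENNReal.ofReal (g x) ∂μ = ∫⁻ x, liminf (fun k => ENNReal.ofReal (f k x)) atTop ∂μ := by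
      apply lintegral_congr_ae
      filter_upwards [hl] with x hx
      exact ((ENNReal.continuous_ofReal.tendsto _).comp hx).liminf_eq.symm
    rw [e1]
    refine (lintegral_liminf_le' (fun k => (hi k).aestronglyMeasurable.aemeasurable.ennreal_ofReal)).trans ?_
    have : ∀ k, ∫⁻ x, ENNReal.ofReal (f k x) ∂μ ≤ ENNReal.ofReal C := by
      intro k
      rw [← ofReal_integral_eq_lintegral_ofReal (hi k) (h0 k)]
      exact ENNReal.ofReal_le_ofReal (hC k)
    calc _ ≤ liminf (fun _ : ℕ => ENNReal.ofReal C) atTop := liminf_le_liminf (Eventually.of_forall this)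
      _ = _ := by simp
  have hIg : Integrable g μ := by
    refine ⟨hm, ?_⟩
    rw [hasFiniteIntegral_iff_ofReal hg0]
    exact h1.trans_lt ENNReal.ofReal_lt_top
  refine ⟨hIg, ?_⟩
  have hC0 : 0 ≤ C := (integral_nonneg_of_ae (h0 0)).trans (hC 0)
  rw [← ENNReal.ofReal_le_ofReal_iff hC0, ofReal_integral_eq_lintegral_ofReal hIg hg0]
  exact h1

noncomputable def Wf (u : E → ℝ) (x : E) : ℝ := Real.sqrt (1 + ‖gradient u x‖ ^ 2)
noncomputable def Ff (u : E → ℝ) (x : E) : E := (Wf u x)⁻¹ • gradient u x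

structure Sol (r e : E) (μ : ℝ) (Ω : Set E) (u : E → ℝ) : Prop where
  isOpen : IsOpen Ω
  convex : Convex ℝ Ω
  zero_mem : (0:E) ∈ closure Ω
  norm_e : ‖e‖ = 1
  re : inner ℝ r e = 0
  pos : ∀ x ∈ Ω, 0 < inner ℝ e x
  c2 : ContDiffOn ℝ 2 u Ω
  cont : ContinuousOn u (closure Ω)
  bdry : ∀ x ∈ frontier Ω, u x = inner ℝ (r + μ • e) x
  weak : WeakDF Ω (Ff u)

theorem one_le_Wf (u : E → ℝ) (x : E) : 1 ≤ Wf u x := by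
  unfold Wf; rw [Real.one_le_sqrt]; nlinarith [sq_nonneg ‖gradient u x‖]
theorem Wf_pos (u : E → ℝ) (x : E) : 0 < Wf u x := lt_of_lt_of_le one_pos (one_le_Wf u x)
theorem Wf_sq (u : E → ℝ) (x : E) : Wf u x ^ 2 = 1 + ‖gradient u x‖ ^ 2 := by
  unfold Wf; rw [Real.sq_sqrt]; positivity
theorem norm_grad_le (u : E → ℝ) (x : E) : ‖gradient u x‖ ≤ Wf u x := by
  unfold Wf; apply Real.le_sqrt_of_sq_le; linarith
theorem norm_Ff_le (u : E → ℝ) (x : E) : ‖Ff u x‖ ≤ 1 := by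
  unfold Ff; rw [norm_smul, norm_inv, Real.norm_eq_abs, abs_of_pos (Wf_pos u x), inv_mul_le_iff₀ (Wf_pos u x)]
  simpa using norm_grad_le u x
theorem fderiv_eq_inner (u : E → ℝ) (x v : E) : fderiv ℝ u x v = inner ℝ (gradient u x) v := by
  unfold gradient; simp
theorem norm_fderiv_eq (u : E → ℝ) (x : E) : ‖fderiv ℝ u x‖ = ‖gradient u x‖ := by
  unfold gradient; simp

/-- Cauchy-Schwarz in `E × ℝ` : `(1 + ⟪p, q⟫) ≤ W W0` -/
theorem one_add_inner_le (p q : E) : 1 + inner ℝ p q ≤ Real.sqrt (1 + ‖p‖ ^ 2) * Real.sqrt (1 + ‖q‖ ^ 2) := by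
  rw [← Real.sqrt_mul (by positivity)]
  apply Real.le_sqrt_of_sq_le
  have h1 := real_inner_le_norm p q
  have h2 := abs_real_inner_le_norm p q
  have h3 : (inner ℝ p q : ℝ) ^ 2 ≤ (‖p‖ * ‖q‖) ^ 2 := sq_le_sq' (by linarith [neg_abs_le (inner ℝ p q : ℝ)]) h1
  nlinarith [sq_nonneg (‖p‖ - ‖q‖)]

theorem cont_grad {Ω : Set E} (hΩ : IsOpen Ω) {u : E → ℝ} (hu : ContDiffOn ℝ 1 u Ω) :
    ContinuousOn (gradient u) Ω := by
  have : ContinuousOn (fun x => fderiv ℝ u x) Ω := hu.continuousOn_fderiv_of_isOpen hΩ (by norm_num)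
  exact (toDual ℝ E).symm.continuous.comp_continuousOn this
theorem cont_Wf {Ω : Set E} (hΩ : IsOpen Ω) {u : E → ℝ} (hu : ContDiffOn ℝ 1 u Ω) :
    ContinuousOn (Wf u) Ω := by
  have := cont_grad hΩ hu
  unfold Wf
  fun_prop
theorem cont_Ff {Ω : Set E} (hΩ : IsOpen Ω) {u : E → ℝ} (hu : ContDiffOn ℝ 1 u Ω) :
    ContinuousOn (Ff u) Ω :=
  ((cont_Wf hΩ hu).inv₀ (fun x _ => (Wf_pos u x).ne')).smul (cont_grad hΩ hu)

theorem Sol.c1 {r e : E} {μ : ℝ} {Ω : Set E} {u : E → ℝ} (h : Sol r e μ Ω u) : ContDiffOn ℝ 1 u Ω :=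
  h.c2.of_le (by norm_num)

/-- spatial cutoff -/
noncomputable def eta (R : ℝ) (x : E) : ℝ := Real.smoothTransition (R ^ 2 + 1 - ‖x‖ ^ 2)
theorem eta_contDiff (R : ℝ) : ContDiff ℝ 1 (eta (E := E) R) := by
  unfold eta
  exact Real.smoothTransition.contDiff.comp (contDiff_const.sub (contDiff_norm_sq ℝ))
theorem eta_nonneg (R : ℝ) (x : E) : 0 ≤ eta R x := Real.smoothTransition.nonneg _
theorem eta_le_one (R : ℝ) (x : E) : eta R x ≤ 1 := Real.smoothTransition.le_one _
theorem eta_one {R : ℝ} (hR : 0 ≤ R) {x : E} (h : ‖x‖ ≤ R) : eta R x = 1 := by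
  apply Real.smoothTransition.one_of_one_le
  have := norm_nonneg x
  nlinarith
theorem eta_zero {R : ℝ} (hR : 0 ≤ R) {x : E} (h : R + 1 ≤ ‖x‖) : eta R x = 0 := by
  apply Real.smoothTransition.zero_of_nonpos
  nlinarith
theorem eta_bound {R : ℝ} (hR : 0 ≤ R) : ∃ C, 0 ≤ C ∧ ∀ x : E, ‖fderiv ℝ (eta (E := E) R) x‖ ≤ C := by
  have hc : HasCompactSupport (eta (E := E) R) := by
    apply HasCompactSupport.of_support_subset_isCompact (isCompact_closedBall (0:E) (R+1))
    intro x hx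
    by_contra h
    apply hx
    apply eta_zero hR
    simp at h; linarith
  obtain ⟨C, hC⟩ := ((eta_contDiff R).continuous_fderiv (by norm_num)).bounded_above_of_compact_support (hc.fderiv ℝ)
  exact ⟨C, (norm_nonneg _).trans (hC 0), hC⟩
attribute [irreducible] eta

theorem arctan_lip (a b : ℝ) : |Real.arctan a - Real.arctan b| ≤ |a - b| := by
  have : LipschitzWith 1 Real.arctan := by
    apply lipschitzWith_of_nnnorm_deriv_le Real.differentiable_arctan
    intro x
    rw [Real.deriv_arctan, ← NNReal.coe_le_coe]
    simp only [coe_nnnorm, NNReal.coe_one, Real.norm_eq_abs]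
    rw [abs_of_nonneg (by positivity), div_le_one (by positivity)]
    nlinarith [sq_nonneg x]
  have h := this.dist_le_mul a b
  simpa [Real.dist_eq] using h

theorem arctan_nonpos' {x : ℝ} (h : x ≤ 0) : Real.arctan x ≤ 0 := by
  have := Real.arctan_nonneg.2 (neg_nonneg.2 h)
  rw [Real.arctan_neg] at this; linarith

set_option maxHeartbeats 1000000 in
theorem area_aux (q : E) (R : ℝ) (hR : 0 ≤ R) : ∃ C : ℝ, 0 ≤ C ∧ ∀ (Ω : Set E) (u : E → ℝ), IsOpen Ω →
    ContDiffOn ℝ 1 u Ω → ContinuousOn u (closure Ω) → (∀ x ∈ frontier Ω, u x = inner ℝ q x) →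
    WeakDF Ω (Ff u) →
    IntegrableOn (fun x => eta R x * Wf u x / (1 + (u x - inner ℝ q x) ^ 2)) Ω ∧
    ∫ x in Ω, eta R x * Wf u x / (1 + (u x - inner ℝ q x) ^ 2) ≤ C := by
  obtain ⟨C1, hC10, hC1⟩ := chi_bound
  obtain ⟨C2, hC20, hC2⟩ := eta_bound (E := E) hR
  set W0 := Real.sqrt (1 + ‖q‖ ^ 2) with hW0
  have hW00 : 0 ≤ W0 := Real.sqrt_nonneg _
  set D := (C1 + 1) * W0 + C2 * 2 with hD
  have hD0 : 0 ≤ D := by positivity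
  set V := (volume (ball (0:E) (R+1))).toReal with hV
  refine ⟨D * V + W0 * V, by positivity, fun Ω u hΩ hu huc hb hY => ?_⟩
  set w : E → ℝ := fun x => u x - inner ℝ q x with hwdef
  have hwc : ContinuousOn w (closure Ω) := huc.sub (by fun_prop)
  have hw0 : ∀ x ∈ frontier Ω, w x = 0 := fun x hx => by simp [hwdef, hb x hx]
  have hwΩ : ContinuousOn w Ω := hwc.mono subset_closure
  have hwC : ContDiffOn ℝ 1 w Ω := hu.sub ((contDiff_inner_left q).of_le (by norm_num)).contDiffOn
  have hWc := cont_Wf hΩ hu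
  have hballm : volume (Ω ∩ ball (0:E) (R+1)) < ⊤ := (measure_mono inter_subset_right).trans_lt measure_ball_lt_top
  have hcst : ∀ d : ℝ, IntegrableOn ((ball (0:E) (R+1)).indicator fun _ => d) Ω := by
    intro d
    rw [integrableOn_indicator_iff measurableSet_ball, inter_comm]
    exact integrableOn_const hballm.ne enorm_ne_top
  have hcstle : ∀ d : ℝ, 0 ≤ d → ∫ x in Ω, (ball (0:E) (R+1)).indicator (fun _ => d) x ≤ d * V := by
    intro d hd
    rw [setIntegral_indicator measurableSet_ball]
    simp only [setIntegral_const, smul_eq_mul]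
    rw [mul_comm]
    gcongr
    exact ENNReal.toReal_mono measure_ball_lt_top.ne (measure_mono inter_subset_right)
  have step : ∀ k : ℕ, IntegrableOn (fun x => chi (((k:ℝ)+1) * w x) * (eta R x * Wf u x / (1 + (w x) ^ 2))) Ω ∧
      ∫ x in Ω, chi (((k:ℝ)+1) * w x) * (eta R x * Wf u x / (1 + (w x) ^ 2)) ≤ D * V := by
    intro k
    set a : ℝ := (k:ℝ)+1 with ha
    have hapos : 0 < a := by positivity
    obtain ⟨hK, hKΩ⟩ := compactK hΩ hwc hw0 (R := R + 1) (inv_pos.2 hapos)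
    set K := ({x | x ∈ closure Ω ∧ a⁻¹ ≤ |w x|} ∩ closedBall (0:E) (R+1)) with hKdef
    have hoff : ∀ x ∈ Ω, x ∉ K → |a * w x| < 1 ∨ R + 1 ≤ ‖x‖ := by
      intro x hx hxK
      by_contra hcon
      push Not at hcon
      apply hxK
      refine ⟨⟨subset_closure hx, ?_⟩, by simpa using hcon.2.le⟩
      have := hcon.1
      rw [abs_mul, abs_of_pos hapos] at this
      rw [inv_le_iff_one_le_mul₀ hapos]; linarith
    set g : E → ℝ := fun x => eta R x * (chi (a * w x) * Real.arctan (w x)) with hg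
    have hgC : ContDiffOn ℝ 1 g Ω := by
      refine (eta_contDiff R).contDiffOn.mul ?_
      exact (chi_contDiff.comp_contDiffOn (contDiffOn_const.mul hwC)).mul
        (Real.contDiff_arctan.comp_contDiffOn hwC)
    have hg0 : ∀ x ∈ Ω, x ∉ K → g x = 0 := by
      intro x hx hxK
      rcases hoff x hx hxK with h | h
      · simp [hg, chi_zero h.le]
      · simp [hg, eta_zero hR h]
    have hIg := weak_test hΩ hK hKΩ hY hgC hg0
    have hgd : ContinuousOn (fun x => fderiv ℝ g x (Ff u x)) Ω :=
      (hgC.continuousOn_fderiv_of_isOpen hΩ (by norm_num)).clm_apply (cont_Ff hΩ hu)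
    have hgi : IntegrableOn (fun x => fderiv ℝ g x (Ff u x)) Ω :=
      integrableOn_of_K hΩ hK hKΩ hgd (fun x hx hxK => by
        rw [fderiv_zero_off hΩ hK hg0 hx hxK]; simp)
    set f := (fun x => chi (a * w x) * (eta R x * Wf u x / (1 + (w x) ^ 2))) with hf
    have hfc : ContinuousOn f Ω := by
      refine (chi_contDiff.continuous.comp_continuousOn (continuousOn_const.mul hwΩ)).mul ?_
      refine ((eta_contDiff R).continuous.continuousOn.mul hWc).div (continuousOn_const.add (hwΩ.pow 2)) ?_
      intro x _; positivity
    have hfi : IntegrableOn f Ω := integrableOn_of_K hΩ hK hKΩ hfc (by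
      intro x hx hxK
      rcases hoff x hx hxK with h | h
      · simp [hf, chi_zero h.le]
      · simp [hf, eta_zero hR h])
    refine ⟨hfi, ?_⟩
    have hpt : ∀ x ∈ Ω, f x ≤ fderiv ℝ g x (Ff u x) + (ball (0:E) (R+1)).indicator (fun _ => D) x := by
      intro x hx
      by_cases hxR : R + 1 ≤ ‖x‖
      · have e1 : f x = 0 := by simp [hf, eta_zero hR hxR]
        have e2 : fderiv ℝ g x (Ff u x) = 0 := by
          have hη : ∀ y : E, 0 ≤ eta R y := eta_nonneg R
          have : fderiv ℝ (eta R) x = 0 := by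
            apply IsLocalMin.fderiv_eq_zero
            refine Eventually.of_forall fun y => ?_
            rw [eta_zero hR hxR]; exact hη y
          have hd1 : DifferentiableAt ℝ (fun x => chi (a * w x) * Real.arctan (w x)) x := by
            have : ContDiffOn ℝ 1 (fun x => chi (a * w x) * Real.arctan (w x)) Ω :=
              (chi_contDiff.comp_contDiffOn (contDiffOn_const.mul hwC)).mul
               (Real.contDiff_arctan.comp_contDiffOn hwC)
            exact (this.differentiableOn (by norm_num)).differentiableAt (hΩ.mem_nhds hx)
          have h4 := (((eta_contDiff R).differentiable (by norm_num) x).hasFDerivAt.mul hd1.hasFDerivAt)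
          have h5 : fderiv ℝ g x = _ := h4.fderiv
          rw [h5, this, eta_zero hR hxR]; simp
        rw [e1, e2]
        simp only [zero_add]
        exact indicator_nonneg (fun _ _ => hD0) _
      · have hxb : x ∈ ball (0:E) (R+1) := by simpa using hxR
        rw [indicator_of_mem hxb]
        have hwd : HasFDerivAt w (fderiv ℝ u x - innerSL ℝ q) x := by
          have h1 : HasFDerivAt u (fderiv ℝ u x) x :=
            ((hu.differentiableOn (by norm_num)).differentiableAt (hΩ.mem_nhds hx)).hasFDerivAt
          exact h1.sub (innerSL ℝ q).hasFDerivAt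
        have h1 := hasFDerivAt_chi (hwd.const_mul a)
        have h2 := (Real.hasDerivAt_arctan (w x)).comp_hasFDerivAt x hwd
        have h4 := ((eta_contDiff R).differentiable (by norm_num) x).hasFDerivAt.mul (h1.mul h2)
        have h5 : fderiv ℝ g x = _ := h4.fderiv
        rw [h5]
        set T : ℝ := fderiv ℝ u x (Ff u x) - inner ℝ q (Ff u x) with hT
        have hTge : Wf u x - W0 ≤ T := by
          have a1 : fderiv ℝ u x (Ff u x) = (Wf u x)⁻¹ * ‖gradient u x‖ ^ 2 := by
            rw [fderiv_eq_inner, Ff, inner_smul_right, real_inner_self_eq_norm_sq]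
          have a2 : inner ℝ q (Ff u x) = (Wf u x)⁻¹ * inner ℝ (gradient u x) q := by
            rw [Ff, inner_smul_right, real_inner_comm]
          have a3 := one_add_inner_le (gradient u x) q
          have a4 := Wf_sq u x
          have a5 := Wf_pos u x
          rw [hT, a1, a2]
          have a6 : (Wf u x)⁻¹ * (1 + inner ℝ (gradient u x) q) ≤ W0 := by
            rw [inv_mul_le_iff₀ a5]; exact a3
          have a7 : (Wf u x)⁻¹ * ‖gradient u x‖ ^ 2 = Wf u x - (Wf u x)⁻¹ := by
            field_simp; linarith
          rw [a7]; linarith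
        set S' : ℝ := deriv chi (a * w x) * a * Real.arctan (w x) + chi (a * w x) * (1 / (1 + w x ^ 2)) with hS'
        set Z : ℝ := fderiv ℝ (eta R) x (Ff u x) with hZ
        have hZb : |Z| ≤ C2 := by
          have := (fderiv ℝ (eta (E := E) R) x).le_opNorm (Ff u x)
          rw [Real.norm_eq_abs] at this
          refine this.trans ?_
          calc _ ≤ C2 * 1 := mul_le_mul (hC2 x) (norm_Ff_le u x) (norm_nonneg _) hC20
            _ = C2 := mul_one _
        have hexp : (eta R x • (chi (a * w x) • (1 / (1 + w x ^ 2)) • (fderiv ℝ u x - innerSL ℝ q) +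
              Real.arctan (w x) • deriv chi (a * w x) • a • (fderiv ℝ u x - innerSL ℝ q)) +
              (chi (a * w x) * Real.arctan (w x)) • fderiv ℝ (eta R) x) (Ff u x)
              = eta R x * S' * T + chi (a * w x) * Real.arctan (w x) * Z := by
          simp [hS', hT, hZ]; ring
        have hatan : |Real.arctan (w x)| ≤ |w x| := by simpa using arctan_lip (w x) 0
        have hatan2 : |Real.arctan (w x)| ≤ 2 := by
          rw [abs_le]
          have := Real.neg_pi_div_two_lt_arctan (w x)
          have := Real.arctan_lt_pi_div_two (w x)
          have := Real.pi_lt_four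
          constructor <;> linarith
        have hchi0 := chi_nonneg (a * w x)
        have hchi1 := chi_le_one (a * w x)
        have hη0 := eta_nonneg R x
        have hη1 := eta_le_one R x
        have hWp := Wf_pos u x
        have hsgn : 0 ≤ deriv chi (a * w x) * Real.arctan (w x) := by
          have hh := chi_deriv_sign (a * w x)
          rcases lt_trichotomy (w x) 0 with h | h | h
          · have h1 : deriv chi (a * w x) ≤ 0 := by
              by_contra hc
              push Not at hc
              have : a * w x < 0 := mul_neg_of_pos_of_neg hapos h
              nlinarith
            have h2 := (arctan_nonpos' h.le)
            exact mul_nonneg_of_nonpos_of_nonpos h1 h2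
          · simp [h]
          · have h1 : 0 ≤ deriv chi (a * w x) := by
              by_contra hc
              push Not at hc
              have : 0 < a * w x := mul_pos hapos h
              nlinarith
            exact mul_nonneg h1 (Real.arctan_nonneg.2 h.le)
        have hpart : deriv chi (a * w x) * a * Real.arctan (w x) ≤ C1 := by
          have b := hC1 (a * w x)
          calc _ ≤ |deriv chi (a * w x) * a * Real.arctan (w x)| := le_abs_self _
            _ = |deriv chi (a * w x) * a| * |Real.arctan (w x)| := abs_mul _ _
            _ ≤ |deriv chi (a * w x) * a| * |w x| := by gcongr
            _ = |deriv chi (a * w x) * (a * w x)| := by rw [← abs_mul, mul_assoc]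
            _ ≤ C1 := b
        have hq1 : 1 / (1 + w x ^ 2) ≤ 1 := by
          rw [div_le_one (by positivity)]; nlinarith [sq_nonneg (w x)]
        have hq0 : 0 ≤ 1 / (1 + w x ^ 2) := by positivity
        have hS1 : S' ≤ C1 + 1 := by
          have : chi (a * w x) * (1 / (1 + w x ^ 2)) ≤ 1 := mul_le_one₀ hchi1 hq0 hq1
          rw [hS']; linarith
        have hS2 : chi (a * w x) * (1 / (1 + w x ^ 2)) ≤ S' := by
          rw [hS']
          have : 0 ≤ deriv chi (a * w x) * a * Real.arctan (w x) := by
            calc 0 ≤ a * (deriv chi (a * w x) * Real.arctan (w x)) := mul_nonneg hapos.le hsgn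
              _ = _ := by ring
          exact le_add_of_nonneg_left this
        have hS0 : 0 ≤ S' := le_trans (mul_nonneg hchi0 hq0) hS2
        have hlast : - (C2 * 2) ≤ chi (a * w x) * Real.arctan (w x) * Z := by
          have : |chi (a * w x) * Real.arctan (w x) * Z| ≤ 1 * 2 * C2 := by
            rw [abs_mul, abs_mul, abs_of_nonneg hchi0]
            gcongr
          have := neg_abs_le (chi (a * w x) * Real.arctan (w x) * Z)
          linarith
        have hfx : f x = eta R x * (chi (a * w x) * (1 / (1 + w x ^ 2))) * Wf u x := by
          simp only [hf]; ring
        have k1 : f x ≤ eta R x * S' * Wf u x := by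
          rw [hfx]; gcongr
        have k2 : eta R x * S' * (Wf u x - W0) ≤ eta R x * S' * T := by
          gcongr
        have k3 : eta R x * S' * W0 ≤ (C1 + 1) * W0 := by
          gcongr
          calc eta R x * S' ≤ 1 * S' := by gcongr
            _ ≤ C1 + 1 := by linarith
        have : (_ : ℝ) = _ := hexp
        refine le_trans ?_ (add_le_add_left (le_of_eq this.symm) D)
        rw [hD]; linarith
    have := setIntegral_mono_on hfi (hgi.add (hcst D)) hΩ.measurableSet hpt
    simp only [Pi.add_apply] at this
    rw [integral_add hgi (hcst D), hIg, zero_add] at this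
    exact this.trans (hcstle D hD0)
  set finf : E → ℝ := fun x => (if w x = 0 then 0 else 1) * (eta R x * Wf u x / (1 + (w x) ^ 2)) with hfinf
  have hfat := real_fatou (μ := volume.restrict Ω) (g := finf) (fun k => (step k).1)
    (fun k => Eventually.of_forall fun x => mul_nonneg (chi_nonneg _)
      (div_nonneg (mul_nonneg (eta_nonneg _ _) (Wf_pos u x).le) (by positivity)))
    (Eventually.of_forall fun x => by
      simp only [hfinf]
      apply Tendsto.mul_const
      by_cases hwx : w x = 0
      · simp [hwx, chi_zero]
      · apply tendsto_const_nhds.congr'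
        obtain ⟨N, hN⟩ := exists_nat_gt (2 / |w x|)
        filter_upwards [eventually_ge_atTop N] with k hk
        have : 2 < |((k:ℝ)+1) * w x| := by
          have hk' : (N:ℝ) ≤ k := by exact_mod_cast hk
          have hwp : 0 < |w x| := abs_pos.2 hwx
          rw [div_lt_iff₀ hwp] at hN
          rw [abs_mul, abs_of_nonneg (by positivity)]
          nlinarith
        simp [chi_one this.le, hwx]) (fun k => (step k).2)
  have hae : ∀ᵐ x ∂(volume.restrict Ω), eta R x * Wf u x / (1 + (w x) ^ 2) ≤
      finf x + (ball (0:E) (R+1)).indicator (fun _ => W0) x := by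
    have hnull := ae_zero_fderiv hΩ hwΩ (fun x hx => (hwC.differentiableOn (by norm_num)).differentiableAt (hΩ.mem_nhds hx))
    filter_upwards [hnull, ae_restrict_mem hΩ.measurableSet] with x hx hxΩ
    by_cases hwx : w x = 0
    · have hwd : HasFDerivAt w (fderiv ℝ u x - innerSL ℝ q) x := by
        have h1 : HasFDerivAt u (fderiv ℝ u x) x :=
          ((hu.differentiableOn (by norm_num)).differentiableAt (hΩ.mem_nhds hxΩ)).hasFDerivAt
        exact h1.sub (innerSL ℝ q).hasFDerivAt
      have h1 := hx hwx
      rw [hwd.fderiv] at h1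
      have h2 : gradient u x = q := by
        unfold gradient
        rw [sub_eq_zero.1 h1]
        exact (toDual ℝ E).symm_apply_apply q
      have h3 : Wf u x = W0 := by simp [Wf, h2, hW0]
      simp only [hfinf, hwx, h3]
      by_cases hxR : R + 1 ≤ ‖x‖
      · simp [eta_zero hR hxR]
        exact indicator_nonneg (fun _ _ => hW00) _
      · have hxb : x ∈ ball (0:E) (R+1) := by simpa using hxR
        rw [indicator_of_mem hxb]
        have := eta_le_one R x
        simp; nlinarith
    · simp only [hfinf, hwx, if_false, one_mul]
      have : 0 ≤ (ball (0:E) (R+1)).indicator (fun _ => W0) x := indicator_nonneg (fun _ _ => hW00) _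
      linarith
  have hmeas : ContinuousOn (fun x => eta R x * Wf u x / (1 + (w x) ^ 2)) Ω := by
    refine ((eta_contDiff R).continuous.continuousOn.mul hWc).div (continuousOn_const.add (hwΩ.pow 2)) ?_
    intro x _; positivity
  have hI : IntegrableOn (fun x => eta R x * Wf u x / (1 + (w x) ^ 2)) Ω := by
    refine Integrable.mono' (hfat.1.add (hcst W0)) (hmeas.aestronglyMeasurable hΩ.measurableSet) ?_
    filter_upwards [hae] with x hx
    rw [Real.norm_eq_abs, abs_of_nonneg]
    · exact hx
    · exact (div_nonneg (mul_nonneg (eta_nonneg _ _) (Wf_pos u x).le) (by positivity))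
  refine ⟨hI, ?_⟩
  have := integral_mono_ae hI (hfat.1.add (hcst W0)) hae
  simp only [Pi.add_apply] at this
  rw [integral_add hfat.1 (hcst W0)] at this
  linarith [hfat.2, hcstle W0 hW00]
end Bern

namespace Bern
open MeasureTheory Filter Topology InnerProductSpace

variable {E : Type*} [NormedAddCommGroup E] [InnerProductSpace ℝ E] [FiniteDimensional ℝ E]
  [MeasurableSpace E] [BorelSpace E]


/-! ### geometry of the polar coordinates -/
noncomputable def kap (r : E) : ℝ := Real.sqrt (1 + ‖r‖ ^ 2)
noncomputable def tL (e : E) : E × ℝ →L[ℝ] ℝ := (innerSL ℝ e).comp (ContinuousLinearMap.fst ℝ E ℝ)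
noncomputable def zL (r : E) : E × ℝ →L[ℝ] ℝ :=
  (kap r)⁻¹ • (ContinuousLinearMap.snd ℝ E ℝ - (innerSL ℝ r).comp (ContinuousLinearMap.fst ℝ E ℝ))
noncomputable def rho (r e : E) (p : E × ℝ) : ℝ := Real.sqrt ((tL e p) ^ 2 + (zL r p) ^ 2)
noncomputable def eth (r e : E) (p : E × ℝ) : E × ℝ :=
  (-(zL r p / rho r e p) • e - (tL e p / (rho r e p * kap r)) • r, tL e p / (rho r e p * kap r))
noncomputable def Sg (r e : E) (X : E × ℝ) (p : E) : ℝ :=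
  (tL e X * (1 + inner ℝ r p) / kap r + zL r X * inner ℝ e p) / rho r e X

theorem tL_apply (e : E) (x : E) (ζ : ℝ) : tL e (x, ζ) = inner ℝ e x := by simp [tL]
theorem zL_apply (r : E) (x : E) (ζ : ℝ) : zL r (x, ζ) = (ζ - inner ℝ r x) / kap r := by
  simp [zL]; ring
theorem kap_pos (r : E) : 0 < kap r := Real.sqrt_pos.2 (by positivity)
theorem kap_sq (r : E) : kap r ^ 2 = 1 + ‖r‖ ^ 2 := Real.sq_sqrt (by positivity)
theorem one_le_kap (r : E) : 1 ≤ kap r := by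
  unfold kap; rw [Real.one_le_sqrt]; nlinarith [sq_nonneg ‖r‖]
theorem rho_sq (r e : E) (p : E × ℝ) : rho r e p ^ 2 = (tL e p) ^ 2 + (zL r p) ^ 2 :=
  Real.sq_sqrt (by positivity)
theorem rho_pos {r e : E} {p : E × ℝ} (h : 0 < tL e p) : 0 < rho r e p :=
  Real.sqrt_pos.2 (by positivity)
theorem abs_z_le (r e : E) (p : E × ℝ) : |zL r p| ≤ rho r e p := by
  apply Real.abs_le_sqrt; nlinarith [sq_nonneg (tL e p)]
theorem abs_t_le (r e : E) (p : E × ℝ) : |tL e p| ≤ rho r e p := by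
  apply Real.abs_le_sqrt; nlinarith [sq_nonneg (zL r p)]

theorem rho_deriv {r e : E} {p : E × ℝ} (h : 0 < tL e p) :
    HasFDerivAt (rho r e) ((rho r e p)⁻¹ • (tL e p • tL e + zL r p • zL r)) p := by
  have h1 : HasFDerivAt (fun p => tL e p ^ 2 + zL r p ^ 2)
      ((2 * tL e p) • tL e + (2 * zL r p) • zL r) p := by
    have := ((tL e).hasFDerivAt (x := p)).pow 2
    have h2 := ((zL r).hasFDerivAt (x := p)).pow 2
    refine (this.add h2).congr_fderiv ?_
    ext v <;> simp
  have h2 := h1.sqrt (by positivity)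
  refine h2.congr_fderiv ?_
  ext v <;> simp [rho] <;> field_simp

theorem a_deriv {r e : E} {p : E × ℝ} (h : 0 < tL e p) :
    HasFDerivAt (fun p => zL r p / rho r e p)
      ((tL e p / rho r e p ^ 3) • (tL e p • zL r - zL r p • tL e)) p := by
  have hρ := rho_pos (r := r) h
  have h1 := ((zL r).hasFDerivAt (x := p)).fun_mul ((hasDerivAt_inv hρ.ne').comp_hasFDerivAt p (rho_deriv (r := r) h))
  simp only [Function.comp_def, ← div_eq_mul_inv] at h1
  refine h1.congr_fderiv ?_
  have hs := rho_sq r e p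
  apply ContinuousLinearMap.ext
  intro v
  simp only [ContinuousLinearMap.smul_apply, ContinuousLinearMap.sub_apply, ContinuousLinearMap.add_apply, smul_eq_mul]
  field_simp
  rw [hs]; ring

theorem b_deriv {r e : E} {p : E × ℝ} (h : 0 < tL e p) :
    HasFDerivAt (fun p => tL e p / (rho r e p * kap r))
      ((zL r p / (rho r e p ^ 3 * kap r)) • (zL r p • tL e - tL e p • zL r)) p := by
  have hρ := rho_pos (r := r) h
  have hk := kap_pos r
  have h1 := ((tL e).hasFDerivAt (x := p)).fun_mul ((hasDerivAt_inv (mul_pos hρ hk).ne').comp_hasFDerivAt p ((rho_deriv (r := r) h).mul_const (kap r)))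
  simp only [Function.comp_def, ← div_eq_mul_inv] at h1
  refine h1.congr_fderiv ?_
  have hs := rho_sq r e p
  apply ContinuousLinearMap.ext
  intro v
  simp only [ContinuousLinearMap.smul_apply, ContinuousLinearMap.sub_apply, ContinuousLinearMap.add_apply, smul_eq_mul]
  field_simp
  rw [hs]; ring

theorem contDiffOn_rho {r e : E} : ContDiffOn ℝ 1 (rho r e) {p | 0 < tL e p} := by
  have : ContDiffOn ℝ 1 (fun p : E × ℝ => tL e p ^ 2 + zL r p ^ 2) {p | 0 < tL e p} :=
    (((tL e).contDiff.pow 2).add ((zL r).contDiff.pow 2)).contDiffOn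
  exact this.sqrt (fun p hp => by have : 0 < tL e p := hp; positivity)

theorem eth_unit {r e : E} (he : ‖e‖ = 1) (hre : inner ℝ r e = 0) {p : E × ℝ} (h : 0 < tL e p) :
    ‖(eth r e p).1‖ ^ 2 + (eth r e p).2 ^ 2 = 1 := by
  have hρ := rho_pos (r := r) h
  have hk := kap_pos r
  have hs := rho_sq r e p
  have hks := kap_sq r
  have e1 : ‖(eth r e p).1‖ ^ 2 = (zL r p / rho r e p) ^ 2 + (tL e p / (rho r e p * kap r)) ^ 2 * ‖r‖ ^ 2 := by
    simp only [eth]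
    rw [norm_sub_sq_real, norm_smul, norm_smul, inner_smul_left, inner_smul_right, real_inner_comm, hre, he]
    simp [mul_pow, div_pow, sq_abs]
  rw [e1]
  simp only [eth]
  field_simp
  rw [hs, hks]; ring

theorem unit_flux_le {a : E} {b : ℝ} (h : ‖a‖ ^ 2 + b ^ 2 = 1) (p : E) :
    |b - inner ℝ a p| ≤ Real.sqrt (1 + ‖p‖ ^ 2) := by
  apply Real.abs_le_sqrt
  have h2 := abs_real_inner_le_norm a p
  have h3 : (inner ℝ a p : ℝ) ^ 2 ≤ (‖a‖ * ‖p‖) ^ 2 := by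
    rw [← sq_abs (inner ℝ a p : ℝ)]; exact pow_le_pow_left₀ (abs_nonneg _) h2 2
  have h4 : |b * inner ℝ a p| ≤ |b| * (‖a‖ * ‖p‖) := by rw [abs_mul]; gcongr
  have h5 := neg_abs_le (b * inner ℝ a p)
  have h6 := sq_abs b
  nlinarith [sq_nonneg (‖a‖ - |b| * ‖p‖), abs_nonneg b, norm_nonneg a]

theorem Sg_eq {r e : E} {p : E × ℝ} (h : 0 < tL e p) (P : E) :
    Sg r e p P = (eth r e p).2 - inner ℝ (eth r e p).1 P := by
  have hρ := rho_pos (r := r) h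
  have hk := kap_pos r
  simp only [Sg, eth, inner_sub_left, inner_smul_left]
  simp
  field_simp
  ring

theorem abs_Sg_le {r e : E} (he : ‖e‖ = 1) (hre : inner ℝ r e = 0) {p : E × ℝ} (h : 0 < tL e p) (P : E) :
    |Sg r e p P| ≤ Real.sqrt (1 + ‖P‖ ^ 2) := by
  rw [Sg_eq h]; exact unit_flux_le (eth_unit he hre h) P

noncomputable def W0f (r e : E) (μ : ℝ) : ℝ := Real.sqrt (1 + ‖r + μ • e‖ ^ 2)

theorem W0f_sq {r e : E} {μ : ℝ} (he : ‖e‖ = 1) (hre : inner ℝ r e = 0) :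
    W0f r e μ ^ 2 = kap r ^ 2 + μ ^ 2 := by
  rw [W0f, Real.sq_sqrt (by positivity), kap_sq, norm_add_sq_real, inner_smul_right, hre, norm_smul, he]
  simp; ring

theorem Sg_plane {r e : E} {μ : ℝ} (he : ‖e‖ = 1) (hre : inner ℝ r e = 0) {x : E} (h : 0 < inner ℝ e x) :
    Sg r e (x, inner ℝ (r + μ • e) x) (r + μ • e) = W0f r e μ := by
  have hk := kap_pos r
  have hW := W0f_sq (μ := μ) he hre
  have hWp : 0 < W0f r e μ := Real.sqrt_pos.2 (by positivity)
  have hz : zL r (x, inner ℝ (r + μ • e) x) = μ * inner ℝ e x / kap r := by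
    rw [zL_apply, inner_add_left, inner_smul_left]; simp
  have ht : tL e (x, inner ℝ (r + μ • e) x) = inner ℝ e x := tL_apply _ _ _
  have hρ : rho r e (x, inner ℝ (r + μ • e) x) = inner ℝ e x * W0f r e μ / kap r := by
    unfold rho
    rw [hz, ht, Real.sqrt_eq_iff_eq_sq (by positivity) (by positivity)]
    field_simp
    rw [hW]
  rw [Sg, hz, ht, hρ]
  have h1 : inner ℝ r (r + μ • e) = ‖r‖ ^ 2 := by
    rw [inner_add_right, inner_smul_right, hre, real_inner_self_eq_norm_sq]; ring
  have h2 : inner ℝ e (r + μ • e) = μ := by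
    rw [inner_add_right, inner_smul_right, real_inner_comm, hre, real_inner_self_eq_norm_sq, he]; ring
  rw [h1, h2, ← kap_sq]
  field_simp
  rw [hW]

/-! ### consequences of the area bound -/
theorem Sol.int_W {r e : E} {μ : ℝ} {Ω : Set E} {u : E → ℝ} (h : Sol r e μ Ω u) (R : ℝ) :
    IntegrableOn (Wf u) (Ω ∩ ball 0 R) := by
  rcases le_or_gt R 0 with hR | hR
  · rw [ball_eq_empty.2 hR]; simp
  obtain ⟨C, hC0, hC⟩ := area_aux (r + μ • e) R hR.le
  obtain ⟨h1, -⟩ := hC Ω u h.isOpen h.c1 h.cont h.bdry h.weak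
  have hwc : ContinuousOn (fun x => u x - inner ℝ (r + μ • e) x) (closure Ω ∩ closedBall 0 R) :=
    (h.cont.sub (by fun_prop)).mono inter_subset_left
  have hcomp : IsCompact (closure Ω ∩ closedBall (0:E) R) := (isCompact_closedBall _ _).inter_left isClosed_closure
  obtain ⟨L, hL⟩ := hcomp.exists_bound_of_continuousOn hwc
  have h2 : IntegrableOn (fun x => (1 + L ^ 2) * (eta R x * Wf u x / (1 + (u x - inner ℝ (r + μ • e) x) ^ 2))) (Ω ∩ ball 0 R) :=
    (h1.mono_set inter_subset_left).const_mul _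
  refine Integrable.mono' h2 (((cont_Wf h.isOpen h.c1).mono inter_subset_left).aestronglyMeasurable
    (h.isOpen.measurableSet.inter measurableSet_ball)) ?_
  rw [ae_restrict_iff' (h.isOpen.measurableSet.inter measurableSet_ball)]
  refine Eventually.of_forall fun x hx => ?_
  have hx2 : ‖x‖ ≤ R := by have := hx.2; simp at this; exact this.le
  rw [eta_one hR.le hx2, Real.norm_eq_abs, abs_of_pos (Wf_pos u x), one_mul]
  have h3 := hL x ⟨subset_closure hx.1, by simpa using hx2⟩
  rw [Real.norm_eq_abs] at h3
  have h4 : (u x - inner ℝ (r + μ • e) x) ^ 2 ≤ L ^ 2 := by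
    rw [← sq_abs]; exact pow_le_pow_left₀ (abs_nonneg _) h3 2
  have hW := Wf_pos u x
  rw [← mul_div_assoc, le_div_iff₀ (by positivity)]
  nlinarith

/-- uniform area bound in balls of `E × ℝ` -/
theorem area_bound (r e : E) (μ : ℝ) : ∃ C : ℝ, 0 ≤ C ∧ ∀ (Ω : Set E) (u : E → ℝ), Sol r e μ Ω u →
    ∀ φ : E → ℝ, (∀ x ∈ Ω, 0 ≤ φ x) → (∀ x ∈ Ω, φ x ≤ 1) → (∀ x ∈ Ω, 4 ≤ ‖x‖ ^ 2 + u x ^ 2 → φ x = 0) →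
      ∫ x in Ω, φ x * Wf u x ≤ C := by
  obtain ⟨C, hC0, hC⟩ := area_aux (r + μ • e) 2 (by norm_num)
  set L := 2 + 2 * ‖r + μ • e‖ with hL
  refine ⟨(1 + L ^ 2) * C, by positivity, fun Ω u h φ h0 h1 h2 => ?_⟩
  obtain ⟨h3, h4⟩ := hC Ω u h.isOpen h.c1 h.cont h.bdry h.weak
  calc ∫ x in Ω, φ x * Wf u x ≤ ∫ x in Ω, (1 + L ^ 2) * (eta 2 x * Wf u x / (1 + (u x - inner ℝ (r + μ • e) x) ^ 2)) := by
        apply integral_mono_of_nonneg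
        · filter_upwards [ae_restrict_mem h.isOpen.measurableSet] with x hx
          exact mul_nonneg (h0 x hx) (Wf_pos u x).le
        · exact h3.const_mul _
        · filter_upwards [ae_restrict_mem h.isOpen.measurableSet] with x hx
          have hW := Wf_pos u x
          by_cases hs : 4 ≤ ‖x‖ ^ 2 + u x ^ 2
          · rw [h2 x hx hs, zero_mul]
            have := eta_nonneg 2 x
            positivity
          · push Not at hs
            have hx2 : ‖x‖ ≤ 2 := by nlinarith [sq_nonneg (u x), norm_nonneg x]
            have hu2 : |u x| ≤ 2 := abs_le_of_sq_le_sq (by nlinarith [sq_nonneg ‖x‖]) (by norm_num)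
            rw [eta_one (by norm_num) hx2, one_mul]
            have hw : |u x - inner ℝ (r + μ • e) x| ≤ L := by
              refine (abs_sub _ _).trans ?_
              have := abs_real_inner_le_norm (r + μ • e) x
              have : ‖r + μ • e‖ * ‖x‖ ≤ ‖r + μ • e‖ * 2 := by gcongr
              rw [hL]; linarith
            have h5 : (u x - inner ℝ (r + μ • e) x) ^ 2 ≤ L ^ 2 := by
              rw [← sq_abs]; exact pow_le_pow_left₀ (abs_nonneg _) hw 2
            rw [← mul_div_assoc, le_div_iff₀ (by positivity)]
            have := h1 x hx
            have := h0 x hx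
            calc φ x * Wf u x * (1 + (u x - inner ℝ (r + μ • e) x) ^ 2) ≤ 1 * Wf u x * (1 + L ^ 2) := by gcongr
              _ = _ := by ring
    _ ≤ (1 + L ^ 2) * C := by
        rw [integral_const_mul]; gcongr
end Bern

namespace Bern
open MeasureTheory Filter Topology InnerProductSpace

variable {E : Type*} [NormedAddCommGroup E] [InnerProductSpace ℝ E] [FiniteDimensional ℝ E]
  [MeasurableSpace E] [BorelSpace E]


/-! ### flux identities -/
structure Flux (Ω : Set E) (w : E → ℝ) (b : E → ℝ) : Prop where
  int : ∀ k : ℕ, IntegrableOn (fun x => chi (((k:ℝ) + 1) * w x) * b x) Ω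
  lim : Tendsto (fun k : ℕ => ∫ x in Ω, chi (((k:ℝ) + 1) * w x) * b x) atTop (𝓝 0)

theorem Flux.congr {Ω : Set E} {w b b' : E → ℝ} (hΩ : MeasurableSet Ω) (h : Flux Ω w b)
    (hb : ∀ x ∈ Ω, b' x = b x) : Flux Ω w b' := by
  have h1 : ∀ k : ℕ, EqOn (fun x => chi (((k:ℝ) + 1) * w x) * b x) (fun x => chi (((k:ℝ) + 1) * w x) * b' x) Ω :=
    fun k x hx => by simp [hb x hx]
  refine ⟨fun k => (h.int k).congr_fun (h1 k) hΩ, ?_⟩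
  refine h.lim.congr fun k => setIntegral_congr_fun hΩ (h1 k)

theorem Flux.add {Ω : Set E} {w b b' : E → ℝ} (h : Flux Ω w b) (h' : Flux Ω w b') :
    Flux Ω w (fun x => b x + b' x) := by
  refine ⟨fun k => ?_, ?_⟩
  · simp only [mul_add]; exact (h.int k).add (h'.int k)
  · have := h.lim.add h'.lim
    rw [add_zero] at this
    refine this.congr fun k => ?_
    simp only [mul_add]
    rw [integral_add (h.int k) (h'.int k)]

theorem Flux.sub {Ω : Set E} {w b b' : E → ℝ} (h : Flux Ω w b) (h' : Flux Ω w b') :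
    Flux Ω w (fun x => b x - b' x) := by
  refine ⟨fun k => ?_, ?_⟩
  · simp only [mul_sub]; exact (h.int k).sub (h'.int k)
  · have := h.lim.sub h'.lim
    rw [sub_zero] at this
    refine this.congr fun k => ?_
    simp only [mul_sub]
    rw [integral_sub (h.int k) (h'.int k)]

theorem chi_seq_tendsto {w : ℝ} (hw : w ≠ 0) :
    Tendsto (fun k : ℕ => chi (((k:ℝ) + 1) * w)) atTop (𝓝 1) := by
  refine tendsto_const_nhds.congr' ?_
  obtain ⟨N, hN⟩ := exists_nat_ge (2 / |w|)
  filter_upwards [eventually_ge_atTop N] with k hk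
  symm
  apply chi_one
  have hw' : 0 < |w| := abs_pos.2 hw
  rw [div_le_iff₀ hw'] at hN
  rw [abs_mul, abs_of_nonneg (by positivity)]
  have : (N:ℝ) ≤ k := by exact_mod_cast hk
  nlinarith

theorem chi_seq_zero (k : ℕ) {w : ℝ} (hw : w = 0) : chi (((k:ℝ) + 1) * w) = 0 := by
  rw [hw, mul_zero]; apply chi_zero; simp

theorem chi_cont_on {Ω : Set E} {w : E → ℝ} (hw : ContinuousOn w Ω) (k : ℕ) :
    ContinuousOn (fun x => chi (((k:ℝ) + 1) * w x)) Ω :=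
  chi_contDiff.continuous.comp_continuousOn (continuousOn_const.mul hw)

/-- dominated convergence for the cutoffs -/
theorem chi_dct {Ω : Set E} (hΩ : MeasurableSet Ω) {w b : E → ℝ} (hw : ContinuousOn w Ω) (hb : IntegrableOn b Ω)
    (h0 : ∀ᵐ x ∂(volume.restrict Ω), w x = 0 → b x = 0) :
    Tendsto (fun k : ℕ => ∫ x in Ω, chi (((k:ℝ) + 1) * w x) * b x) atTop (𝓝 (∫ x in Ω, b x)) := by
  refine tendsto_integral_of_dominated_convergence (fun x => ‖b x‖) (fun k => ?_) hb.norm (fun k => ?_) ?_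
  · exact ((chi_cont_on hw k).aestronglyMeasurable hΩ).mul hb.aestronglyMeasurable
  · refine Eventually.of_forall fun x => ?_
    rw [norm_mul, Real.norm_eq_abs, abs_of_nonneg (chi_nonneg _)]
    exact mul_le_of_le_one_left (norm_nonneg _) (chi_le_one _)
  · filter_upwards [h0] with x hx
    by_cases h : w x = 0
    · simp [hx h]
    · simpa using (chi_seq_tendsto h).mul_const (b x)

theorem Flux.integral_eq_zero {Ω : Set E} (hΩ : MeasurableSet Ω) {w b : E → ℝ} (h : Flux Ω w b)
    (hw : ContinuousOn w Ω) (hb : IntegrableOn b Ω)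
    (h0 : ∀ᵐ x ∂(volume.restrict Ω), w x = 0 → b x = 0) : ∫ x in Ω, b x = 0 :=
  tendsto_nhds_unique (chi_dct hΩ hw hb h0) h.lim

theorem Sol.int_fderiv {r e : E} {μ : ℝ} {Ω : Set E} {u : E → ℝ} (h : Sol r e μ Ω u) (R : ℝ) :
    IntegrableOn (fun x => ‖fderiv ℝ u x‖) (Ω ∩ ball 0 R) := by
  refine Integrable.mono' (h.int_W R) ((((h.c1.continuousOn_fderiv_of_isOpen h.isOpen (by norm_num)).norm).mono inter_subset_left).aestronglyMeasurable
    (h.isOpen.measurableSet.inter measurableSet_ball)) ?_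
  refine Eventually.of_forall fun x => ?_
  rw [norm_norm, norm_fderiv_eq]; exact norm_grad_le u x

theorem vert_ftc {Ω : Set E} (hΩ : IsOpen Ω) {c : E × ℝ → ℝ} (hc : ContDiffOn ℝ 1 c (Ω ×ˢ univ)) {x : E} (hx : x ∈ Ω)
    (a b : ℝ) : ∫ ζ in a..b, fderiv ℝ c (x, ζ) (0, 1) = c (x, b) - c (x, a) := by
  have hΩ2 : IsOpen (Ω ×ˢ (univ : Set ℝ)) := hΩ.prod isOpen_univ
  refine intervalIntegral.integral_eq_sub_of_hasDerivAt (f := fun ζ => c (x, ζ)) (fun ζ _ => ?_) ?_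
  · have h1 : HasFDerivAt c (fderiv ℝ c (x, ζ)) (x, ζ) :=
      ((hc.contDiffAt (hΩ2.mem_nhds ⟨hx, mem_univ _⟩)).differentiableAt (by norm_num)).hasFDerivAt
    have h2 : HasDerivAt (fun ζ : ℝ => (x, ζ)) ((0:E), (1:ℝ)) ζ := (hasDerivAt_const ζ x).prodMk (hasDerivAt_id ζ)
    exact h1.comp_hasDerivAt ζ h2
  · apply Continuous.intervalIntegrable
    have := hc.continuousOn_fderiv_of_isOpen hΩ2 (by norm_num)
    have h3 : Continuous (fun ζ : ℝ => fderiv ℝ c (x, ζ)) :=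
      this.comp_continuous (by fun_prop) (fun ζ => ⟨hx, mem_univ _⟩)
    exact h3.clm_apply continuous_const

theorem cont_slice {Ω : Set E} (hΩ : IsOpen Ω) {c : E × ℝ → ℝ} (hc : ContDiffOn ℝ 1 c (Ω ×ˢ univ)) {x : E} (hx : x ∈ Ω) :
    Continuous (fun ζ : ℝ => fderiv ℝ c (x, ζ)) :=
  (hc.continuousOn_fderiv_of_isOpen (hΩ.prod isOpen_univ) (by norm_num)).comp_continuous (by fun_prop)
    (fun ζ => ⟨hx, mem_univ _⟩)

theorem flux_N {r e : E} {μ : ℝ} {Ω Ω' : Set E} {u v : E → ℝ} (hu : Sol r e μ Ω u) (hv : Sol r e μ Ω' v)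
    (hsub : Ω' ⊆ Ω) {c : E × ℝ → ℝ} (hc : ContDiffOn ℝ 1 c (Ω' ×ˢ univ)) {M R : ℝ}
    (hM : ∀ x ∈ Ω', ∀ ζ, |c (x, ζ)| ≤ M) (hR : ∀ x ∈ Ω', ∀ ζ, R ≤ ‖x‖ → c (x, ζ) = 0) :
    Flux Ω' (fun x => v x - inner ℝ (r + μ • e) x) (fun x =>
      c (x, v x) * ((1 + inner ℝ (gradient u x) (gradient v x)) / Wf u x)
      - c (x, inner ℝ (r + μ • e) x) * ((1 + inner ℝ (r + μ • e) (gradient u x)) / Wf u x)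
      - ∫ ζ in (inner ℝ (r + μ • e) x)..(v x), fderiv ℝ c (x, ζ) (-(Ff u x), (Wf u x)⁻¹)) := by
  obtain ⟨h1, h2⟩ := flux_piece hv.isOpen hv.c1 hv.cont hv.bdry (hv.int_fderiv R)
    ((cont_Ff hu.isOpen hu.c1).mono hsub) (fun x _ => norm_Ff_le u x) (hu.weak.mono hsub) hc hM hR
  refine Flux.congr hv.isOpen.measurableSet ⟨h1, h2⟩ fun x hx => ?_
  have hcs := cont_slice hv.isOpen hc hx
  have h3 := vert_ftc hv.isOpen hc hx (inner ℝ (r + μ • e) x) (v x)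
  have h4 : ∫ ζ in (inner ℝ (r + μ • e) x)..(v x), fderiv ℝ c (x, ζ) (-(Ff u x), (Wf u x)⁻¹) =
      (Wf u x)⁻¹ * (c (x, v x) - c (x, inner ℝ (r + μ • e) x))
      - ∫ ζ in (inner ℝ (r + μ • e) x)..(v x), fderiv ℝ c (x, ζ) (Ff u x, 0) := by
    rw [← h3, ← intervalIntegral.integral_const_mul, ← intervalIntegral.integral_sub]
    · congr 1; ext ζ
      rw [← smul_eq_mul, ← map_smul, ← map_sub]; simp
    · exact ((hcs.clm_apply continuous_const).const_mul _).intervalIntegrable _ _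
    · exact (hcs.clm_apply continuous_const).intervalIntegrable _ _
  rw [h4, fderiv_eq_inner, Ff, inner_smul_right, inner_smul_right, real_inner_comm (gradient u x) (gradient v x)]
  ring

theorem eth_div {r e : E} (he : ‖e‖ = 1) (hre : inner ℝ r e = 0) {p : E × ℝ} (h : 0 < tL e p) :
    fderiv ℝ (fun p => zL r p / rho r e p) p (e, 0) + fderiv ℝ (fun p => tL e p / (rho r e p * kap r)) p (r, 0)
      = fderiv ℝ (fun p => tL e p / (rho r e p * kap r)) p (0, 1) := by
  rw [(a_deriv (r := r) h).fderiv, (b_deriv (r := r) h).fderiv]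
  have hρ := rho_pos (r := r) h
  have hk := kap_pos r
  have hks := kap_sq r
  simp only [ContinuousLinearMap.smul_apply, ContinuousLinearMap.sub_apply, smul_eq_mul, tL_apply, zL_apply, hre, real_inner_self_eq_norm_sq, he]
  rw [real_inner_comm, hre]
  simp
  field_simp
  rw [hks]; ring

theorem a_smooth (r e : E) : ContDiffOn ℝ 1 (fun p => zL r p / rho r e p) {p | 0 < tL e p} :=
  (zL r).contDiff.contDiffOn.div contDiffOn_rho (fun p hp => (rho_pos hp).ne')
theorem b_smooth (r e : E) : ContDiffOn ℝ 1 (fun p => tL e p / (rho r e p * kap r)) {p | 0 < tL e p} :=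
  (tL e).contDiff.contDiffOn.div (contDiffOn_rho.mul contDiffOn_const) (fun p hp => (mul_pos (rho_pos hp) (kap_pos r)).ne')

theorem a_bd {r e : E} {p : E × ℝ} (h : 0 < tL e p) : |zL r p / rho r e p| ≤ 1 := by
  have hρ := rho_pos (r := r) h
  rw [abs_div, abs_of_pos hρ, div_le_one hρ]; exact abs_z_le r e p
theorem b_bd {r e : E} {p : E × ℝ} (h : 0 < tL e p) : |tL e p / (rho r e p * kap r)| ≤ 1 := by
  have hρ := rho_pos (r := r) h
  have hk := one_le_kap r
  rw [abs_div, abs_of_pos (a := rho r e p * kap r) (by positivity), div_le_one (by positivity)]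
  have := abs_t_le r e p
  nlinarith

theorem flux_theta {r e : E} {μ : ℝ} {Ω : Set E} {u : E → ℝ} (hu : Sol r e μ Ω u)
    {c : E × ℝ → ℝ} (hc : ContDiffOn ℝ 1 c (Ω ×ˢ univ)) {M R : ℝ}
    (hM : ∀ x ∈ Ω, ∀ ζ, |c (x, ζ)| ≤ M) (hR : ∀ x ∈ Ω, ∀ ζ, R ≤ ‖x‖ → c (x, ζ) = 0) :
    Flux Ω (fun x => u x - inner ℝ (r + μ • e) x) (fun x =>
      c (x, u x) * Sg r e (x, u x) (gradient u x)
      - c (x, inner ℝ (r + μ • e) x) * W0f r e μ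
      - ∫ ζ in (inner ℝ (r + μ • e) x)..(u x), fderiv ℝ c (x, ζ) (eth r e (x, ζ))) := by
  have hpos : ∀ x ∈ Ω, ∀ ζ : ℝ, 0 < tL e (x, ζ) := fun x hx ζ => by rw [tL_apply]; exact hu.pos x hx
  have hΩ2 : IsOpen (Ω ×ˢ (univ : Set ℝ)) := hu.isOpen.prod isOpen_univ
  have hsub : (Ω ×ˢ (univ : Set ℝ)) ⊆ {p | 0 < tL e p} := fun p hp => hpos p.1 hp.1 p.2
  have hca := ((a_smooth r e).mono hsub).mul hc
  have hcb := ((b_smooth r e).mono hsub).mul hc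
  have f1 := flux_piece hu.isOpen hu.c1 hu.cont hu.bdry (hu.int_fderiv R)
    (Y := fun _ => e) continuousOn_const (fun x _ => le_refl ‖e‖) (weakDF_const Ω e) hca (M := M)
    (fun x hx ζ => by
      show |_ * _| ≤ M
      rw [abs_mul]
      exact (mul_le_of_le_one_left (abs_nonneg _) (a_bd (hpos x hx ζ))).trans (hM x hx ζ))
    (fun x hx ζ hh => by show _ * _ = (0:ℝ); rw [hR x hx ζ hh, mul_zero])
  have f2 := flux_piece hu.isOpen hu.c1 hu.cont hu.bdry (hu.int_fderiv R)
    (Y := fun _ => r) continuousOn_const (fun x _ => le_refl ‖r‖) (weakDF_const Ω r) hcb (M := M)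
    (fun x hx ζ => by
      show |_ * _| ≤ M
      rw [abs_mul]
      exact (mul_le_of_le_one_left (abs_nonneg _) (b_bd (hpos x hx ζ))).trans (hM x hx ζ))
    (fun x hx ζ hh => by show _ * _ = (0:ℝ); rw [hR x hx ζ hh, mul_zero])
  have F := Flux.add ⟨f1.1, f1.2⟩ ⟨f2.1, f2.2⟩
  refine Flux.congr hu.isOpen.measurableSet F fun x hx => ?_
  have hsa := cont_slice hu.isOpen hca hx
  have hsb := cont_slice hu.isOpen hcb hx
  have h3 := vert_ftc hu.isOpen hcb hx (inner ℝ (r + μ • e) x) (u x)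
  have key : ∀ ζ : ℝ, fderiv ℝ c (x, ζ) (eth r e (x, ζ)) =
      fderiv ℝ ((fun p => tL e p / (rho r e p * kap r)) * c) (x, ζ) (0, 1)
      - fderiv ℝ ((fun p => zL r p / rho r e p) * c) (x, ζ) (e, 0)
      - fderiv ℝ ((fun p => tL e p / (rho r e p * kap r)) * c) (x, ζ) (r, 0) := by
    intro ζ
    have hd : DifferentiableAt ℝ c (x, ζ) := (hc.contDiffAt (hΩ2.mem_nhds ⟨hx, mem_univ _⟩)).differentiableAt (by norm_num)
    have hp := hpos x hx ζ
    rw [fderiv_mul (b_deriv hp).differentiableAt hd, fderiv_mul (a_deriv hp).differentiableAt hd]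
    have := eth_div hu.norm_e hu.re hp
    have e0 : eth r e (x, ζ) = (tL e (x, ζ) / (rho r e (x, ζ) * kap r)) • ((0:E), (1:ℝ))
        - (zL r (x, ζ) / rho r e (x, ζ)) • (e, (0:ℝ)) - (tL e (x, ζ) / (rho r e (x, ζ) * kap r)) • (r, (0:ℝ)) := by
      simp [eth]
    rw [e0, map_sub, map_sub, map_smul, map_smul, map_smul]
    simp only [ContinuousLinearMap.add_apply, ContinuousLinearMap.smul_apply, smul_eq_mul]
    linear_combination c (x, ζ) * this
  have h4 : ∫ ζ in (inner ℝ (r + μ • e) x)..(u x), fderiv ℝ c (x, ζ) (eth r e (x, ζ)) = 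
      (((fun p => tL e p / (rho r e p * kap r)) * c) (x, u x) - ((fun p => tL e p / (rho r e p * kap r)) * c) (x, inner ℝ (r + μ • e) x))
      - (∫ ζ in (inner ℝ (r + μ • e) x)..(u x), fderiv ℝ ((fun p => zL r p / rho r e p) * c) (x, ζ) (e, 0))
      - (∫ ζ in (inner ℝ (r + μ • e) x)..(u x), fderiv ℝ ((fun p => tL e p / (rho r e p * kap r)) * c) (x, ζ) (r, 0)) := by
    refine Eq.trans ?_ (congrArg (fun y => y - _ - _) h3)
    beta_reduce
    rw [← intervalIntegral.integral_sub, ← intervalIntegral.integral_sub]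
    · congr 1; ext ζ; exact key ζ
    · exact ((hsb.clm_apply continuous_const).sub (hsa.clm_apply continuous_const)).intervalIntegrable _ _
    · exact (hsb.clm_apply continuous_const).intervalIntegrable _ _
    · exact (hsb.clm_apply continuous_const).intervalIntegrable _ _
    · exact (hsa.clm_apply continuous_const).intervalIntegrable _ _
  rw [h4, ← Sg_plane (μ := μ) hu.norm_e hu.re (hu.pos x hx), fderiv_eq_inner, fderiv_eq_inner]
  have hρ1 := rho_pos (r := r) (hpos x hx (u x))
  have hρ2 := rho_pos (r := r) (hpos x hx (inner ℝ (r + μ • e) x))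
  have hk := kap_pos r
  generalize (∫ ζ in (inner ℝ (r + μ • e) x)..(u x), fderiv ℝ ((fun p => zL r p / rho r e p) * c) (x, ζ) (e, 0)) = I1
  generalize (∫ ζ in (inner ℝ (r + μ • e) x)..(u x), fderiv ℝ ((fun p => tL e p / (rho r e p * kap r)) * c) (x, ζ) (r, 0)) = I2
  simp only [Pi.mul_apply, Sg]
  rw [real_inner_comm e (gradient u x), real_inner_comm r (gradient u x), real_inner_comm e (r + μ • e), real_inner_comm r (r + μ • e)]
  field_simp
  ring
end Bern

namespace Bern
open MeasureTheory Filter Topology InnerProductSpace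

variable {E : Type*} [NormedAddCommGroup E] [InnerProductSpace ℝ E] [FiniteDimensional ℝ E]
  [MeasurableSpace E] [BorelSpace E]


/-! ### the radial cutoff -/
noncomputable def ph (p : E × ℝ) : ℝ := Real.smoothTransition (2 - (‖p.1‖ ^ 2 + p.2 ^ 2))
noncomputable def dph (p : E × ℝ) : ℝ := deriv Real.smoothTransition (2 - (‖p.1‖ ^ 2 + p.2 ^ 2))
theorem ph_contDiff : ContDiff ℝ 1 (ph (E := E)) := by
  unfold ph
  exact (Real.smoothTransition.contDiff (n := 1)).comp (contDiff_const.sub ((contDiff_fst.norm_sq ℝ).add (contDiff_snd.pow 2)))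
theorem ph_nonneg (p : E × ℝ) : 0 ≤ ph p := Real.smoothTransition.nonneg _
theorem ph_le_one (p : E × ℝ) : ph p ≤ 1 := Real.smoothTransition.le_one _
theorem ph_zero {p : E × ℝ} (h : 2 ≤ ‖p.1‖ ^ 2 + p.2 ^ 2) : ph p = 0 :=
  Real.smoothTransition.zero_of_nonpos (by linarith)
theorem ph_pos {p : E × ℝ} (h : ‖p.1‖ ^ 2 + p.2 ^ 2 < 2) : 0 < ph p :=
  Real.smoothTransition.pos_of_pos (by linarith)
theorem dph_nonneg (p : E × ℝ) : 0 ≤ dph p := by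
  unfold dph; exact Real.smoothTransition.monotone.deriv_nonneg
theorem dph_zero {p : E × ℝ} (h : 2 ≤ ‖p.1‖ ^ 2 + p.2 ^ 2) : dph p = 0 := by
  apply IsLocalMin.deriv_eq_zero
  refine Eventually.of_forall fun y => ?_
  show Real.smoothTransition _ ≤ _
  rw [Real.smoothTransition.zero_of_nonpos (by linarith)]
  exact Real.smoothTransition.nonneg _
theorem dph_cont : Continuous (dph (E := E)) := by
  unfold dph
  have : Continuous (deriv Real.smoothTransition) := (Real.smoothTransition.contDiff (n := 1)).continuous_deriv (by norm_num)
  exact this.comp (by fun_prop)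
theorem ph_deriv (p : E × ℝ) (a : E) (b : ℝ) :
    fderiv ℝ ph p (a, b) = -(dph p * (2 * inner ℝ p.1 a + 2 * p.2 * b)) := by
  have h1 : HasFDerivAt (fun p : E × ℝ => 2 - (‖p.1‖ ^ 2 + p.2 ^ 2)) _ p :=
    (((hasFDerivAt_fst (𝕜 := ℝ) (p := p)).norm_sq).add ((hasFDerivAt_snd (𝕜 := ℝ) (p := p)).pow 2)).const_sub 2
  have h2 : HasDerivAt Real.smoothTransition (deriv Real.smoothTransition (2 - (‖p.1‖ ^ 2 + p.2 ^ 2))) (2 - (‖p.1‖ ^ 2 + p.2 ^ 2)) :=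
    ((Real.smoothTransition.contDiff (n := 1)).differentiable (by norm_num) _).hasDerivAt
  have h3 := h2.comp_hasFDerivAt p h1
  have h4 : fderiv ℝ ph p = _ := h3.fderiv
  rw [h4]
  simp [dph]
  ring
theorem dph_bound : ∃ C, 0 ≤ C ∧ ∀ p : E × ℝ, dph p ≤ C := by
  have hc : HasCompactSupport (dph (E := E)) := by
    apply HasCompactSupport.of_support_subset_isCompact (isCompact_closedBall (0:E × ℝ) 2)
    intro p hp
    by_contra h
    apply hp
    apply dph_zero
    simp [Prod.norm_def] at h
    by_contra h2
    push Not at h2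
    have h3 : ‖p.1‖ ≤ 2 := by nlinarith [sq_nonneg p.2, norm_nonneg p.1]
    have h4 := h h3
    have h5 := sq_abs p.2
    nlinarith [sq_nonneg ‖p.1‖]
  obtain ⟨C, hC⟩ := dph_cont.bounded_above_of_compact_support hc
  refine ⟨C, (norm_nonneg _).trans (hC 0), fun p => (le_abs_self _).trans (hC p)⟩
theorem ph_bound : ∃ C, 0 ≤ C ∧ ∀ (p : E × ℝ) (a : E) (b : ℝ), ‖a‖ ≤ 1 → |b| ≤ 1 → |fderiv ℝ ph p (a, b)| ≤ C := by
  obtain ⟨C, hC0, hC⟩ := dph_bound (E := E)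
  refine ⟨C * 8, by positivity, fun p a b ha hb => ?_⟩
  rw [ph_deriv, abs_neg, abs_mul, abs_of_nonneg (dph_nonneg p)]
  by_cases h : 2 ≤ ‖p.1‖ ^ 2 + p.2 ^ 2
  · rw [dph_zero h]; simp; positivity
  push Not at h
  have h1 : ‖p.1‖ ≤ 2 := by nlinarith [sq_nonneg p.2, norm_nonneg p.1]
  have h2 : |p.2| ≤ 2 := abs_le_of_sq_le_sq (by nlinarith [sq_nonneg ‖p.1‖]) (by norm_num)
  have h3 := abs_real_inner_le_norm p.1 a
  have h4 : ‖p.1‖ * ‖a‖ ≤ 2 * 1 := by gcongr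
  have h5 : |p.2 * b| ≤ 2 * 1 := by rw [abs_mul]; gcongr
  have h6 : |2 * inner ℝ p.1 a + 2 * p.2 * b| ≤ 8 := by
    have := abs_le.1 (h3.trans h4)
    have := abs_le.1 h5
    rw [abs_le]; constructor <;> nlinarith
  exact mul_le_mul (hC p) h6 (abs_nonneg _) hC0
theorem ph_R {x : E} {ζ : ℝ} (h : 2 ≤ ‖x‖) : ph (x, ζ) = 0 :=
  ph_zero (by show 2 ≤ ‖x‖ ^ 2 + ζ ^ 2; nlinarith [sq_nonneg ζ])
theorem dph_R {x : E} {ζ : ℝ} (h : 2 ≤ ‖x‖) : dph (x, ζ) = 0 :=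
  dph_zero (by show 2 ≤ ‖x‖ ^ 2 + ζ ^ 2; nlinarith [sq_nonneg ζ])

theorem eth_perp {r e : E} {p : E × ℝ} (h : 0 < tL e p) : inner ℝ p.1 (eth r e p).1 + p.2 * (eth r e p).2 = 0 := by
  have hρ := rho_pos (r := r) h
  have hk := kap_pos r
  obtain ⟨x, ζ⟩ := p
  simp only [eth, inner_sub_right, inner_smul_right]
  rw [real_inner_comm, real_inner_comm r x]
  have h1 : tL e (x, ζ) = inner ℝ e x := tL_apply _ _ _
  have h2 : ζ - inner ℝ r x = zL r (x, ζ) * kap r := by rw [zL_apply]; field_simp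
  rw [← h1]
  have h3 : inner ℝ r x = ζ - zL r (x, ζ) * kap r := by linarith
  rw [h3]
  field_simp
  ring

theorem ph_eth {r e : E} {p : E × ℝ} (h : 0 < tL e p) : fderiv ℝ ph p (eth r e p) = 0 := by
  have := ph_deriv p (eth r e p).1 (eth r e p).2
  rw [Prod.mk.eta] at this
  rw [this]
  have := eth_perp (r := r) h
  have h2 : 2 * inner ℝ p.1 (eth r e p).1 + 2 * p.2 * (eth r e p).2 = 0 := by linarith
  rw [h2]; simp

/-- integrability on bounded pieces -/
theorem int_of_bound {Ω : Set E} (hΩ : IsOpen Ω) {f g : E → ℝ} {R : ℝ} (hf : ContinuousOn f Ω) 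
    (hg : IntegrableOn g (Ω ∩ ball 0 R)) (h : ∀ x ∈ Ω, |f x| ≤ g x) (h0 : ∀ x ∈ Ω, R ≤ ‖x‖ → f x = 0) : IntegrableOn f Ω := by
  have h1 : IntegrableOn f (Ω ∩ ball 0 R) := by
    refine Integrable.mono' hg ((hf.mono inter_subset_left).aestronglyMeasurable (hΩ.measurableSet.inter measurableSet_ball)) ?_
    rw [ae_restrict_iff' (hΩ.measurableSet.inter measurableSet_ball)]
    exact Eventually.of_forall fun x hx => h x hx.1
  refine h1.of_forall_diff_eq_zero hΩ.measurableSet fun x hx => h0 x hx.1 ?_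
  by_contra h2
  exact hx.2 ⟨hx.1, by simpa using h2⟩

theorem int_const_ball {Ω : Set E} (C R : ℝ) : IntegrableOn (fun _ => C) (Ω ∩ ball (0:E) R) := by
  refine integrableOn_const ?_ enorm_ne_top
  exact ((measure_mono inter_subset_right).trans_lt measure_ball_lt_top).ne

theorem cont_uΩ {r e : E} {μ : ℝ} {Ω : Set E} {u : E → ℝ} (hu : Sol r e μ Ω u) : ContinuousOn u Ω := hu.cont.mono subset_closure
theorem cont_pair {Ω : Set E} {u : E → ℝ} (hu : ContinuousOn u Ω) {c : E × ℝ → ℝ} (hc : Continuous c) :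
    ContinuousOn (fun x => c (x, u x)) Ω := hc.comp_continuousOn (continuousOn_id.prodMk hu)

theorem cont_S {r e : E} {μ : ℝ} {Ω : Set E} {u : E → ℝ} (hu : Sol r e μ Ω u) :
    ContinuousOn (fun x => Sg r e (x, u x) (gradient u x)) Ω := by
  have h1 : ContinuousOn (fun x => ((x, u x) : E × ℝ)) Ω := continuousOn_id.prodMk (cont_uΩ hu)
  have h2 := cont_grad hu.isOpen hu.c1
  have h3 : ContinuousOn (fun x => rho r e (x, u x)) Ω := by
    unfold rho
    have a1 := (tL e).continuous.comp_continuousOn h1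
    have a2 := (zL r).continuous.comp_continuousOn h1
    exact ((a1.pow 2).add (a2.pow 2)).sqrt
  unfold Sg
  refine ContinuousOn.div ?_ h3 (fun x hx => (rho_pos (by rw [tL_apply]; exact hu.pos x hx)).ne')
  exact ((((tL e).continuous.comp_continuousOn h1).mul (continuousOn_const.add (continuousOn_const.inner h2))).div_const _).add
    (((zL r).continuous.comp_continuousOn h1).mul (continuousOn_const.inner h2))

theorem S_le {r e : E} {μ : ℝ} {Ω : Set E} {u : E → ℝ} (hu : Sol r e μ Ω u) {x : E} (hx : x ∈ Ω) :
    |Sg r e (x, u x) (gradient u x)| ≤ Wf u x :=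
  abs_Sg_le hu.norm_e hu.re (by rw [tL_apply]; exact hu.pos x hx) _

theorem int_phW {r e : E} {μ : ℝ} {Ω : Set E} {u : E → ℝ} (hu : Sol r e μ Ω u) :
    IntegrableOn (fun x => ph (x, u x) * Wf u x) Ω := by
  refine int_of_bound hu.isOpen ((cont_pair (cont_uΩ hu) ph_contDiff.continuous).mul (cont_Wf hu.isOpen hu.c1)) (hu.int_W 2) (fun x hx => ?_) (fun x hx h => by rw [ph_R h, zero_mul])
  rw [abs_of_nonneg (mul_nonneg (ph_nonneg _) (Wf_pos u x).le)]
  exact mul_le_of_le_one_left (Wf_pos u x).le (ph_le_one _)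

theorem int_phS {r e : E} {μ : ℝ} {Ω : Set E} {u : E → ℝ} (hu : Sol r e μ Ω u) :
    IntegrableOn (fun x => ph (x, u x) * Sg r e (x, u x) (gradient u x)) Ω := by
  refine int_of_bound hu.isOpen ((cont_pair (cont_uΩ hu) ph_contDiff.continuous).mul (cont_S hu)) (hu.int_W 2) (fun x hx => ?_) (fun x hx h => by rw [ph_R h, zero_mul])
  rw [abs_mul, abs_of_nonneg (ph_nonneg _)]
  exact (mul_le_of_le_one_left (abs_nonneg _) (ph_le_one _)).trans (S_le hu hx)

theorem int_phl {Ω : Set E} (hΩ : IsOpen Ω) (q : E) : IntegrableOn (fun x => ph (x, inner ℝ q x)) Ω := by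
  refine int_of_bound hΩ (cont_pair (by fun_prop) ph_contDiff.continuous) (int_const_ball 1 2) (fun x hx => ?_) (fun x hx h => by rw [ph_R h])
  rw [abs_of_nonneg (ph_nonneg _)]; exact ph_le_one _

/-- on the contact set the gradients agree a.e. -/
theorem Sol.contact {r e : E} {μ : ℝ} {Ω : Set E} {u : E → ℝ} (hu : Sol r e μ Ω u) :
    ∀ᵐ x ∂(volume.restrict Ω), u x - inner ℝ (r + μ • e) x = 0 → gradient u x = r + μ • e := by
  have hd : ∀ x ∈ Ω, DifferentiableAt ℝ u x := fun x hx => (hu.c1.contDiffAt (hu.isOpen.mem_nhds hx)).differentiableAt (by norm_num)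
  have := ae_zero_fderiv hu.isOpen (w := fun x => u x - inner ℝ (r + μ • e) x) ((cont_uΩ hu).sub (by fun_prop))
    (fun x hx => (hd x hx).sub (innerSL ℝ (r + μ • e)).differentiableAt)
  filter_upwards [this, ae_restrict_mem hu.isOpen.measurableSet] with x hx hxΩ h0
  have h1 := hx h0
  have h2 : HasFDerivAt (fun x => inner ℝ (r + μ • e) x) (innerSL ℝ (r + μ • e)) x := (innerSL ℝ (r + μ • e)).hasFDerivAt
  have h3 := ((hd x hxΩ).hasFDerivAt.sub h2).fderiv
  have h4 : fderiv ℝ u x - innerSL ℝ (r + μ • e) = 0 := by rw [← h3]; exact h1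
  refine ext_inner_right ℝ fun v => ?_
  rw [← fderiv_eq_inner]
  have := congrArg (fun L => L v) h4
  simp only [ContinuousLinearMap.sub_apply, innerSL_apply_apply, ContinuousLinearMap.zero_apply] at this
  linarith

theorem radial_eq {r e : E} {μ : ℝ} {Ω : Set E} {u : E → ℝ} (hu : Sol r e μ Ω u) :
    ∫ x in Ω, ph (x, u x) * Sg r e (x, u x) (gradient u x) = W0f r e μ * ∫ x in Ω, ph (x, inner ℝ (r + μ • e) x) := by
  have hF := flux_theta hu (c := ph) ph_contDiff.contDiffOn (M := 1) (R := 2)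
    (fun x _ ζ => by rw [abs_of_nonneg (ph_nonneg _)]; exact ph_le_one _) (fun x _ ζ h => ph_R h)
  have hF2 := hF.congr (b' := fun x => ph (x, u x) * Sg r e (x, u x) (gradient u x) - ph (x, inner ℝ (r + μ • e) x) * W0f r e μ)
    hu.isOpen.measurableSet (fun x hx => by
      have : ∀ ζ : ℝ, fderiv ℝ ph (x, ζ) (eth r e (x, ζ)) = 0 := fun ζ => ph_eth (by rw [tL_apply]; exact hu.pos x hx)
      simp [this])
  have h1 := int_phS hu
  have h2 := (int_phl hu.isOpen (r + μ • e)).mul_const (W0f r e μ)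
  have := hF2.integral_eq_zero hu.isOpen.measurableSet ((cont_uΩ hu).sub (by fun_prop)) (h1.sub h2) (by
    filter_upwards [hu.contact, ae_restrict_mem hu.isOpen.measurableSet] with x hx hxΩ h0
    rw [hx h0]
    have : u x = inner ℝ (r + μ • e) x := by linarith
    rw [this, Sg_plane hu.norm_e hu.re (hu.pos x hxΩ)]; simp)
  rw [integral_sub h1 h2, integral_mul_const] at this
  linarith

/-! ### scaling -/
noncomputable def sc (T : ℝ) (u : E → ℝ) (x : E) : ℝ := T⁻¹ * u (T • x)
def sO (T : ℝ) (Ω : Set E) : Set E := (fun x : E => T • x) ⁻¹' Ω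

theorem sO_open {Ω : Set E} (hΩ : IsOpen Ω) (T : ℝ) : IsOpen (sO T Ω) := hΩ.preimage (by fun_prop)
theorem sO_mul (T S : ℝ) (Ω : Set E) : sO S (sO T Ω) = sO (T * S) Ω := by
  ext x; simp [sO, mul_smul]
theorem sc_mul (T S : ℝ) (u : E → ℝ) : sc S (sc T u) = sc (T * S) u := by
  ext x; simp [sc, mul_smul]; ring

theorem fderiv_sc {T : ℝ} (hT : T ≠ 0) (u : E → ℝ) (x : E) (hd : DifferentiableAt ℝ u (T • x)) : fderiv ℝ (sc T u) x = fderiv ℝ u (T • x) := by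
  have h1 : HasFDerivAt (fun x : E => T • x) (T • ContinuousLinearMap.id ℝ E) x := (hasFDerivAt_id x).const_smul T
  have h2 := (hd.hasFDerivAt.comp x h1).const_mul T⁻¹
  have h3 : fderiv ℝ (sc T u) x = _ := h2.fderiv
  rw [h3]; ext v; simp; field_simp
theorem grad_sc {T : ℝ} (hT : T ≠ 0) (u : E → ℝ) (x : E) (hd : DifferentiableAt ℝ u (T • x)) : gradient (sc T u) x = gradient u (T • x) := by
  unfold gradient; rw [fderiv_sc hT u x hd]
theorem Wf_sc {T : ℝ} (hT : T ≠ 0) (u : E → ℝ) (x : E) (hd : DifferentiableAt ℝ u (T • x)) : Wf (sc T u) x = Wf u (T • x) := by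
  unfold Wf; rw [grad_sc hT u x hd]
theorem Ff_sc {T : ℝ} (hT : T ≠ 0) (u : E → ℝ) (x : E) (hd : DifferentiableAt ℝ u (T • x)) : Ff (sc T u) x = Ff u (T • x) := by
  unfold Ff; rw [grad_sc hT u x hd, Wf_sc hT u x hd]

theorem Sol.diff {r e : E} {μ : ℝ} {Ω : Set E} {u : E → ℝ} (hu : Sol r e μ Ω u) {x : E} (hx : x ∈ Ω) : DifferentiableAt ℝ u x :=
  (hu.c1.contDiffAt (hu.isOpen.mem_nhds hx)).differentiableAt (by norm_num)

theorem Sol.scale {r e : E} {μ : ℝ} {Ω : Set E} {u : E → ℝ} (hu : Sol r e μ Ω u) {T : ℝ} (hT : 0 < T) :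
    Sol r e μ (sO T Ω) (sc T u) := by
  have hcl : closure (sO T Ω) = sO T (closure Ω) := ((Homeomorph.smulOfNeZero T hT.ne').preimage_closure Ω).symm
  have hfr : frontier (sO T Ω) = sO T (frontier Ω) := ((Homeomorph.smulOfNeZero T hT.ne').preimage_frontier Ω).symm
  refine ⟨sO_open hu.isOpen T, ?_, ?_, hu.norm_e, hu.re, ?_, ?_, ?_, ?_, ?_⟩
  · exact hu.convex.is_linear_preimage (IsLinearMap.isLinearMap_smul T)
  · rw [hcl]; simpa [sO] using hu.zero_mem
  · intro x hx
    have := hu.pos _ hx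
    rw [inner_smul_right] at this
    exact pos_of_mul_pos_right this hT.le |> fun h => h
  · unfold sc
    exact contDiffOn_const.mul (hu.c2.comp (contDiff_const_smul T).contDiffOn (fun x hx => hx))
  · rw [hcl]; unfold sc
    exact continuousOn_const.mul (hu.cont.comp (by fun_prop) (fun x hx => hx))
  · intro x hx
    rw [hfr] at hx
    rw [sc, hu.bdry _ hx, inner_smul_right]; field_simp
  · intro ψ hψ hψc hψs
    have hψ' : ContDiff ℝ 1 (fun y => ψ (T⁻¹ • y)) := hψ.comp (contDiff_const_smul _)
    have key := hu.weak (fun y => ψ (T⁻¹ • y)) hψ' (hψc.comp_homeomorph (Homeomorph.smulOfNeZero T⁻¹ (inv_ne_zero hT.ne')))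
      (by
        have := tsupport_comp_eq_preimage ψ (Homeomorph.smulOfNeZero (α := E) T⁻¹ (inv_ne_zero hT.ne'))
        intro y hy
        have h2 : T⁻¹ • y ∈ tsupport ψ := by
          have h3 : y ∈ tsupport (ψ ∘ (Homeomorph.smulOfNeZero (α := E) T⁻¹ (inv_ne_zero hT.ne'))) := hy
          rw [this] at h3; exact h3
        have h4 := hψs h2
        simpa [sO, smul_smul, hT.ne'] using h4)
    have h5 := Measure.integral_comp_smul (volume : Measure E) (fun y => fderiv ℝ (fun y => ψ (T⁻¹ • y)) y (Ff u y)) T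
    rw [key, smul_zero] at h5
    have h6 : ∀ x, fderiv ℝ (fun y => ψ (T⁻¹ • y)) (T • x) (Ff u (T • x)) = T⁻¹ * fderiv ℝ ψ x (Ff (sc T u) x) := by
      intro x
      have h7 : fderiv ℝ (fun y => ψ (T⁻¹ • y)) (T • x) = T⁻¹ • fderiv ℝ ψ x := by
        have := fderiv_comp_smul (𝕜 := ℝ) (f := ψ) (x := T • x) T⁻¹
        rw [this]; simp [smul_smul, hT.ne']
      rw [h7]
      by_cases hx : x ∈ tsupport ψ
      · rw [Ff_sc hT.ne' u x (hu.diff (hψs hx))]; simp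
      · have : fderiv ℝ ψ x = 0 := by
          by_contra h8
          exact hx (support_fderiv_subset ℝ h8)
        rw [this]; simp
    simp only [h6] at h5
    rw [integral_const_mul] at h5
    exact (mul_eq_zero.1 h5).resolve_left (inv_ne_zero hT.ne')
end Bern

namespace Bern
open MeasureTheory Filter Topology InnerProductSpace

variable {E : Type*} [NormedAddCommGroup E] [InnerProductSpace ℝ E] [FiniteDimensional ℝ E]
  [MeasurableSpace E] [BorelSpace E]


/-! ### dilation comparison -/
noncomputable def gf (u : E → ℝ) (x : E) : ℝ := u x - inner ℝ x (gradient u x)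
open Classical in
noncomputable def vh (q : E) (lam : ℝ) (Ω : Set E) (u : E → ℝ) (x : E) : ℝ :=
  if lam • x ∈ Ω then sc lam u x else inner ℝ q x

theorem cont_gf {r e : E} {μ : ℝ} {Ω : Set E} {u : E → ℝ} (hu : Sol r e μ Ω u) : ContinuousOn (gf u) Ω := by
  unfold gf
  exact (cont_uΩ hu).sub (continuousOn_id.inner (cont_grad hu.isOpen hu.c1))

theorem ray_deriv {u : E → ℝ} {x : E} {s : ℝ} (hs : s ≠ 0) (hd : DifferentiableAt ℝ u (s • x)) :
    HasDerivAt (fun s : ℝ => sc s u x) (-(gf u (s • x)) / s ^ 2) s := by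
  have h1 : HasDerivAt (fun s : ℝ => s • x) ((1:ℝ) • x) s := (hasDerivAt_id s).smul_const x
  have h2 := hd.hasFDerivAt.comp_hasDerivAt s h1
  have h3 := (hasDerivAt_inv hs).mul h2
  refine h3.congr_deriv ?_
  rw [one_smul, fderiv_eq_inner, gf, inner_smul_left, real_inner_comm]
  simp
  field_simp
  ring

theorem ray_A {r e : E} {μ : ℝ} {Ω : Set E} {u : E → ℝ} (hu : Sol r e μ Ω u) {x : E} {τ : ℝ} (hτ : 1 ≤ τ)
    (h : ∀ s ∈ Icc 1 τ, s • x ∈ Ω) :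
    ‖u x - sc τ u x‖ₑ ≤ ∫⁻ s in Icc 1 τ, ‖Ω.indicator (gf u) (s • x)‖ₑ := by
  have hc : ContinuousOn (fun s : ℝ => -(gf u (s • x)) / s ^ 2) (Icc 1 τ) := by
    refine ContinuousOn.div ?_ (by fun_prop) (fun s hs => by have := hs.1; positivity)
    exact ((cont_gf hu).comp (by fun_prop) h).neg
  have hi : ∫ s in (1:ℝ)..τ, -(gf u (s • x)) / s ^ 2 = sc τ u x - sc 1 u x := by
    refine intervalIntegral.integral_eq_sub_of_hasDerivAt (f := fun s : ℝ => sc s u x) (fun s hs => ?_) ?_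
    · rw [uIcc_of_le hτ] at hs
      exact ray_deriv (by have := hs.1; positivity) (hu.diff (h s hs))
    · apply ContinuousOn.intervalIntegrable; rwa [uIcc_of_le hτ]
  have h1 : sc 1 u x = u x := by simp [sc]
  rw [h1, intervalIntegral.integral_of_le hτ] at hi
  have h2 : u x - sc τ u x = -(∫ s in Ioc 1 τ, -(gf u (s • x)) / s ^ 2) := by rw [hi]; ring
  rw [h2, enorm_neg]
  refine (enorm_integral_le_lintegral_enorm _).trans ?_
  calc ∫⁻ s in Ioc 1 τ, ‖-(gf u (s • x)) / s ^ 2‖ₑ ≤ ∫⁻ s in Ioc 1 τ, ‖Ω.indicator (gf u) (s • x)‖ₑ := by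
        refine setLIntegral_mono' measurableSet_Ioc fun s hs => ?_
        rw [indicator_of_mem (h s ⟨hs.1.le, hs.2⟩)]
        rw [enorm_le_iff_norm_le, norm_div, norm_neg]
        refine div_le_self (norm_nonneg _) ?_
        rw [norm_pow, Real.norm_eq_abs]
        have := hs.1
        rw [abs_of_pos (by linarith)]
        nlinarith
    _ ≤ _ := lintegral_mono_set Ioc_subset_Icc_self

theorem ray_bound {r e : E} {μ : ℝ} {Ω : Set E} {u : E → ℝ} (hu : Sol r e μ Ω u) {x : E} (hx : x ∈ Ω) {lam : ℝ}
    (hl : 1 ≤ lam) :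
    ‖u x - vh (r + μ • e) lam Ω u x‖ₑ ≤ ∫⁻ s in Icc 1 lam, ‖Ω.indicator (gf u) (s • x)‖ₑ := by
  by_cases hm : lam • x ∈ Ω
  · rw [vh, if_pos hm]
    refine ray_A hu hl fun s hs => ?_
    rcases eq_or_lt_of_le hl with h1 | h1
    · have : s = 1 := le_antisymm (by rw [h1]; exact hs.2) hs.1
      rw [this, one_smul]; exact hx
    have hs1 := hs.1
    have hs2 := hs.2
    have := hu.convex hx hm (a := (lam - s) / (lam - 1)) (b := (s - 1) / (lam - 1))
      (div_nonneg (by linarith) (by linarith)) (div_nonneg (by linarith) (by linarith))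
      (by rw [← add_div, div_eq_one_iff_eq (by linarith)]; ring)
    convert this using 1
    rw [smul_smul, ← add_smul]
    congr 1
    have : lam - 1 ≠ 0 := by linarith
    field_simp
    ring
  · rw [vh, if_neg hm]
    have hS : IsCompact {s : ℝ | s ∈ Icc 1 lam ∧ s • x ∉ Ω} := by
      have : {s : ℝ | s ∈ Icc 1 lam ∧ s • x ∉ Ω} = Icc 1 lam ∩ (fun s : ℝ => s • x) ⁻¹' Ωᶜ := rfl
      rw [this]
      exact isCompact_Icc.inter_right (hu.isOpen.isClosed_compl.preimage (by fun_prop))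
    obtain ⟨τ, ⟨hτ1, hτ2⟩, hτ3⟩ := hS.exists_isLeast ⟨lam, ⟨⟨hl, le_rfl⟩, hm⟩⟩
    have h1 : 1 < τ := by
      rcases eq_or_lt_of_le hτ1.1 with h | h
      · exfalso; apply hτ2; rw [← h, one_smul]; exact hx
      · exact h
    have h2 : ∀ s ∈ Ico 1 τ, s • x ∈ Ω := fun s hs => by
      by_contra h
      have := hτ3 ⟨⟨hs.1, hs.2.le.trans hτ1.2⟩, h⟩
      exact absurd hs.2 (not_lt.2 this)
    have hne : (𝓝[Ico 1 τ] τ).NeBot := by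
      rw [← mem_closure_iff_nhdsWithin_neBot, closure_Ico h1.ne]; exact ⟨h1.le, le_rfl⟩
    have ht : Tendsto (fun s : ℝ => s • x) (𝓝[Ico 1 τ] τ) (𝓝[Ω] (τ • x)) := by
      refine tendsto_nhdsWithin_iff.2 ⟨?_, ?_⟩
      · exact ((continuous_id.smul continuous_const).tendsto τ).mono_left nhdsWithin_le_nhds
      · filter_upwards [self_mem_nhdsWithin] with s hs using h2 s hs
    have hcl : τ • x ∈ closure Ω := mem_closure_of_tendsto (ht.mono_right nhdsWithin_le_nhds)
      (by filter_upwards [self_mem_nhdsWithin] with s hs using h2 s hs)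
    have hfr : τ • x ∈ frontier Ω := by
      rw [frontier, hu.isOpen.interior_eq]; exact ⟨hcl, hτ2⟩
    have hut : Tendsto (fun s : ℝ => u (s • x)) (𝓝[Ico 1 τ] τ) (𝓝 (u (τ • x))) :=
      ((hu.cont _ hcl).mono subset_closure).tendsto.comp ht
    have hit : Tendsto (fun s : ℝ => s⁻¹) (𝓝[Ico 1 τ] τ) (𝓝 τ⁻¹) :=
      (tendsto_inv₀ (by positivity)).mono_left nhdsWithin_le_nhds
    have h3 : Tendsto (fun s : ℝ => sc s u x) (𝓝[Ico 1 τ] τ) (𝓝 (inner ℝ (r + μ • e) x)) := by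
      have := hit.mul hut
      rw [hu.bdry _ hfr, inner_smul_right, inv_mul_cancel_left₀ (by positivity)] at this
      exact this
    have h4 : Tendsto (fun s : ℝ => ‖u x - sc s u x‖ₑ) (𝓝[Ico 1 τ] τ) (𝓝 ‖u x - inner ℝ (r + μ • e) x‖ₑ) :=
      (h3.const_sub (u x)).enorm
    refine le_of_tendsto h4 ?_
    filter_upwards [self_mem_nhdsWithin] with s hs
    refine (ray_A hu hs.1 fun s' hs' => h2 s' ⟨hs'.1, hs'.2.trans_lt hs.2⟩).trans ?_
    exact lintegral_mono_set (Icc_subset_Icc_right (hs.2.le.trans hτ1.2))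

theorem meas_ind {Ω : Set E} (hΩ : IsOpen Ω) {g : E → ℝ} (hg : ContinuousOn g Ω) : Measurable (Ω.indicator g) := by
  classical
  rw [← piecewise_eq_indicator]
  exact hg.measurable_piecewise continuousOn_const hΩ.measurableSet

theorem ray_int {r e : E} {μ : ℝ} {Ω : Set E} {u : E → ℝ} (hu : Sol r e μ Ω u) {lam : ℝ} (hl : 1 ≤ lam) :
    ∫⁻ x in Ω ∩ closedBall 0 2, ‖u x - vh (r + μ • e) lam Ω u x‖ₑ ≤
      ENNReal.ofReal (lam - 1) * ∫⁻ x in Ω ∩ closedBall 0 (2 * lam), ‖gf u x‖ₑ := by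
  have hmeas := meas_ind hu.isOpen (cont_gf hu)
  have hmB : MeasurableSet (Ω ∩ closedBall (0:E) 2) := hu.isOpen.measurableSet.inter measurableSet_closedBall
  set f : E → ENNReal := (closedBall (0:E) (2 * lam)).indicator (fun y => ‖Ω.indicator (gf u) y‖ₑ) with hf
  have hfm : Measurable f := hmeas.enorm.indicator measurableSet_closedBall
  have hff : ∫⁻ y, f y = ∫⁻ x in Ω ∩ closedBall 0 (2 * lam), ‖gf u x‖ₑ := by
    rw [hf, lintegral_indicator measurableSet_closedBall, inter_comm, ← Measure.restrict_restrict measurableSet_closedBall]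
    rw [← lintegral_indicator measurableSet_closedBall, ← lintegral_indicator measurableSet_closedBall, ← lintegral_indicator hu.isOpen.measurableSet]
    congr 1; ext y
    by_cases h1 : y ∈ Ω <;> by_cases h2 : y ∈ closedBall (0:E) (2 * lam) <;> simp [h1, h2, indicator]
  calc ∫⁻ x in Ω ∩ closedBall 0 2, ‖u x - vh (r + μ • e) lam Ω u x‖ₑ
      ≤ ∫⁻ x in Ω ∩ closedBall 0 2, ∫⁻ s in Icc 1 lam, f (s • x) := by
        refine setLIntegral_mono' hmB fun x hx => (ray_bound hu hx.1 hl).trans ?_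
        refine setLIntegral_mono' measurableSet_Icc fun s hs => ?_
        have hmem : s • x ∈ closedBall (0:E) (2 * lam) := by
          have := hx.2
          simp at this ⊢
          rw [norm_smul, Real.norm_eq_abs, abs_of_pos (by linarith [hs.1]), mul_comm]
          exact mul_le_mul this hs.2 (by linarith [hs.1]) (by norm_num)
        rw [hf, indicator_of_mem hmem]
    _ ≤ ∫⁻ x, ∫⁻ s in Icc 1 lam, f (s • x) := setLIntegral_le_lintegral _ _
    _ = ∫⁻ s in Icc 1 lam, ∫⁻ x, f (s • x) := by
        refine lintegral_lintegral_swap ?_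
        refine (hfm.comp ?_).aemeasurable
        exact (continuous_snd.smul continuous_fst).measurable
    _ ≤ ∫⁻ s in Icc 1 lam, ∫⁻ y, f y := by
        refine setLIntegral_mono' measurableSet_Icc fun s hs => ?_
        have hs0 : s ≠ 0 := by linarith [hs.1]
        have h1 : ∫⁻ x, f (s • x) = ∫⁻ y, f y ∂(Measure.map (fun x : E => s • x) volume) := by
          rw [lintegral_map hfm (measurable_const_smul s)]
        rw [h1, Measure.map_addHaar_smul _ hs0, lintegral_smul_measure]
        refine mul_le_of_le_one_left (zero_le) ?_
        rw [ENNReal.ofReal_le_one, abs_inv, abs_of_nonneg (pow_nonneg (by linarith [hs.1]) _)]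
        exact inv_le_one_of_one_le₀ (one_le_pow₀ hs.1)
    _ = _ := by
        rw [lintegral_const, hff, mul_comm]
        simp
end Bern

namespace Bern
open MeasureTheory Filter Topology InnerProductSpace

variable {E : Type*} [NormedAddCommGroup E] [InnerProductSpace ℝ E] [FiniteDimensional ℝ E]
  [MeasurableSpace E] [BorelSpace E]


theorem int_of_bound' {Ω : Set E} (hΩ : IsOpen Ω) {f g : E → ℝ} {R : ℝ} (hf : ContinuousOn f Ω) 
    (hg : IntegrableOn g (Ω ∩ ball 0 R)) (h : ∀ x ∈ Ω, ‖x‖ < R → |f x| ≤ g x) (h0 : ∀ x ∈ Ω, R ≤ ‖x‖ → f x = 0) : IntegrableOn f Ω := by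
  have h1 : IntegrableOn f (Ω ∩ ball 0 R) := by
    refine Integrable.mono' hg ((hf.mono inter_subset_left).aestronglyMeasurable (hΩ.measurableSet.inter measurableSet_ball)) ?_
    rw [ae_restrict_iff' (hΩ.measurableSet.inter measurableSet_ball)]
    exact Eventually.of_forall fun x hx => h x hx.1 (by simpa using hx.2)
  refine h1.of_forall_diff_eq_zero hΩ.measurableSet fun x hx => h0 x hx.1 ?_
  by_contra h2
  exact hx.2 ⟨hx.1, by simpa using h2⟩

noncomputable def GG (r e : E) (Ω : Set E) (u : E → ℝ) : ℝ :=
  ∫ x in Ω, ph (x, u x) * (Wf u x - Sg r e (x, u x) (gradient u x))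

theorem GG_eq {r e : E} {μ : ℝ} {Ω : Set E} {u : E → ℝ} (hu : Sol r e μ Ω u) :
    GG r e Ω u = (∫ x in Ω, ph (x, u x) * Wf u x) - W0f r e μ * ∫ x in Ω, ph (x, inner ℝ (r + μ • e) x) := by
  rw [← radial_eq hu, GG, ← integral_sub (int_phW hu) (int_phS hu)]
  simp only [mul_sub]

theorem sO_sub {r e : E} {μ : ℝ} {Ω : Set E} {u : E → ℝ} (hu : Sol r e μ Ω u) {lam : ℝ} (hl : 1 ≤ lam) : sO lam Ω ⊆ Ω := by
  intro x hx
  have h1 := hu.convex.combo_closure_interior_mem_interior hu.zero_mem (y := lam • x) (by rw [hu.isOpen.interior_eq]; exact hx)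
    (a := 1 - lam⁻¹) (b := lam⁻¹) (by have := inv_le_one_of_one_le₀ hl; linarith) (by positivity) (by ring)
  rw [hu.isOpen.interior_eq, smul_zero, zero_add, smul_smul, inv_mul_cancel₀ (by positivity), one_smul] at h1
  exact h1

theorem abs_one_add_inner_le (p q : E) : |1 + inner ℝ p q| ≤ Real.sqrt (1 + ‖p‖ ^ 2) * Real.sqrt (1 + ‖q‖ ^ 2) := by
  rw [abs_le]
  constructor
  · have := one_add_inner_le (-p) q
    rw [inner_neg_left, norm_neg] at this
    linarith
  · exact one_add_inner_le p q

theorem Wf_inv_le (u : E → ℝ) (x : E) : |(Wf u x)⁻¹| ≤ 1 := by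
  rw [abs_of_pos (inv_pos.2 (Wf_pos u x))]; exact inv_le_one_of_one_le₀ (one_le_Wf u x)

noncomputable def JJ (u : E → ℝ) (a b : ℝ) (x : E) : ℝ :=
  ∫ ζ in a..b, fderiv ℝ ph (x, ζ) (-(Ff u x), (Wf u x)⁻¹)

theorem JJ_int (u : E → ℝ) (a b : ℝ) (x : E) : IntervalIntegrable (fun ζ => fderiv ℝ ph (x, ζ) (-(Ff u x), (Wf u x)⁻¹)) volume a b := by
  apply Continuous.intervalIntegrable
  have : Continuous (fun ζ : ℝ => fderiv ℝ ph (x, ζ)) := (ph_contDiff.continuous_fderiv (by norm_num)).comp (by fun_prop)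
  exact this.clm_apply continuous_const

theorem JJ_bound : ∃ C : ℝ, 0 ≤ C ∧ ∀ (u : E → ℝ) (a b : ℝ) (x : E), |JJ u a b x| ≤ C * |b - a| := by
  obtain ⟨C, hC0, hC⟩ := ph_bound (E := E)
  refine ⟨C, hC0, fun u a b x => ?_⟩
  unfold JJ
  rw [← Real.norm_eq_abs]
  refine intervalIntegral.norm_integral_le_of_norm_le_const fun ζ _ => ?_
  exact hC _ _ _ (by rw [norm_neg]; exact norm_Ff_le u x) (Wf_inv_le u x)

theorem JJ_zero {u : E → ℝ} {a b : ℝ} {x : E} (h : 2 ≤ ‖x‖) : JJ u a b x = 0 := by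
  have : ∀ ζ : ℝ, fderiv ℝ ph (x, ζ) (-(Ff u x), (Wf u x)⁻¹) = 0 := fun ζ => by rw [ph_deriv, dph_R h]; simp
  simp [JJ, this]

theorem JJ_cont {r e : E} {μ : ℝ} {Ω Ω' : Set E} {u : E → ℝ} (hu : Sol r e μ Ω u) (hs : Ω' ⊆ Ω) {a b : E → ℝ}
    (ha : ContinuousOn a Ω') (hb : ContinuousOn b Ω') : ContinuousOn (fun x => JJ u (a x) (b x) x) Ω' := by
  unfold JJ
  refine contOn_interval (f := fun x ζ => fderiv ℝ ph (x, ζ) (-(Ff u x), (Wf u x)⁻¹)) ?_ ha hb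
  have h1 : Continuous (fun p : E × ℝ => fderiv ℝ ph (p.1, p.2)) := ph_contDiff.continuous_fderiv (by norm_num)
  have h2 : ContinuousOn (fun p : E × ℝ => Ff u p.1) (Ω' ×ˢ univ) :=
    (cont_Ff hu.isOpen hu.c1).comp continuousOn_fst (fun p hp => hs hp.1)
  have h3 : ContinuousOn (fun p : E × ℝ => (Wf u p.1)⁻¹) (Ω' ×ˢ univ) :=
    ((cont_Wf hu.isOpen hu.c1).inv₀ (fun x _ => (Wf_pos u x).ne')).comp continuousOn_fst (fun p hp => hs hp.1)
  exact h1.continuousOn.clm_apply (h2.neg.prodMk h3)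

theorem w_bound {r e : E} {μ : ℝ} {Ω : Set E} {u : E → ℝ} (hu : Sol r e μ Ω u) (R : ℝ) :
    ∃ L, 0 ≤ L ∧ ∀ x ∈ closure Ω, ‖x‖ ≤ R → |u x - inner ℝ (r + μ • e) x| ≤ L ∧ |u x| ≤ L := by
  have hcomp : IsCompact (closure Ω ∩ closedBall (0:E) R) := (isCompact_closedBall _ _).inter_left isClosed_closure
  have hwc : ContinuousOn (fun x => u x - inner ℝ (r + μ • e) x) (closure Ω ∩ closedBall 0 R) :=
    (hu.cont.sub (by fun_prop)).mono inter_subset_left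
  obtain ⟨L, hL⟩ := hcomp.exists_bound_of_continuousOn hwc
  obtain ⟨L', hL'⟩ := hcomp.exists_bound_of_continuousOn (hu.cont.mono inter_subset_left)
  refine ⟨max 0 (max L L'), le_max_left _ _, fun x hx hxR => ⟨?_, ?_⟩⟩
  · exact (hL x ⟨hx, by simpa using hxR⟩).trans ((le_max_left _ _).trans (le_max_right _ _))
  · exact (hL' x ⟨hx, by simpa using hxR⟩).trans ((le_max_right _ _).trans (le_max_right _ _))

theorem JJ_integrable {r e : E} {μ : ℝ} {Ω Ω' : Set E} {u v : E → ℝ} (hu : Sol r e μ Ω u) (hv : Sol r e μ Ω' v) (hs : Ω' ⊆ Ω) :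
    IntegrableOn (fun x => JJ u (inner ℝ (r + μ • e) x) (v x) x) Ω' := by
  obtain ⟨C, hC0, hC⟩ := JJ_bound (E := E)
  obtain ⟨L, hL0, hL⟩ := w_bound hv 2
  refine int_of_bound' hv.isOpen (JJ_cont hu hs (by fun_prop) (cont_uΩ hv)) (int_const_ball (C * L) 2) (fun x hx hx2 => ?_)
    (fun x hx h => JJ_zero h)
  refine (hC _ _ _ _).trans ?_
  gcongr
  exact (hL x (subset_closure hx) hx2.le).1

theorem flux_eq {r e : E} {μ : ℝ} {Ω Ω' : Set E} {u v : E → ℝ} (hu : Sol r e μ Ω u) (hv : Sol r e μ Ω' v) (hs : Ω' ⊆ Ω) :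
    IntegrableOn (fun x => ph (x, v x) * ((1 + inner ℝ (gradient u x) (gradient v x)) / Wf u x)) Ω' ∧
    IntegrableOn (fun x => ph (x, inner ℝ (r + μ • e) x) * ((1 + inner ℝ (r + μ • e) (gradient u x)) / Wf u x)) Ω' ∧
    ∫ x in Ω', ph (x, v x) * ((1 + inner ℝ (gradient u x) (gradient v x)) / Wf u x) =
      (∫ x in Ω', ph (x, inner ℝ (r + μ • e) x) * ((1 + inner ℝ (r + μ • e) (gradient u x)) / Wf u x))
      + ∫ x in Ω', JJ u (inner ℝ (r + μ • e) x) (v x) x := by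
  have hF := flux_N hu hv hs (c := ph) ph_contDiff.contDiffOn (M := 1) (R := 2)
    (fun x _ ζ => by rw [abs_of_nonneg (ph_nonneg _)]; exact ph_le_one _) (fun x _ ζ h => ph_R h)
  have cg := (cont_grad hu.isOpen hu.c1).mono hs
  have cW := (cont_Wf hu.isOpen hu.c1).mono hs
  have h1 : IntegrableOn (fun x => ph (x, v x) * ((1 + inner ℝ (gradient u x) (gradient v x)) / Wf u x)) Ω' := by
    refine int_of_bound hv.isOpen ((cont_pair (cont_uΩ hv) ph_contDiff.continuous).mul 
      ((continuousOn_const.add (cg.inner (cont_grad hv.isOpen hv.c1))).div cW (fun x _ => (Wf_pos u x).ne')))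
      (hv.int_W 2) (fun x hx => ?_) (fun x hx h => by rw [ph_R h, zero_mul])
    rw [abs_mul, abs_of_nonneg (ph_nonneg _)]
    refine (mul_le_of_le_one_left (abs_nonneg _) (ph_le_one _)).trans ?_
    rw [abs_div, abs_of_pos (Wf_pos u x), div_le_iff₀ (Wf_pos u x), mul_comm]
    exact abs_one_add_inner_le _ _
  have h2 : IntegrableOn (fun x => ph (x, inner ℝ (r + μ • e) x) * ((1 + inner ℝ (r + μ • e) (gradient u x)) / Wf u x)) Ω' := by
    refine int_of_bound hv.isOpen ((cont_pair (by fun_prop) ph_contDiff.continuous).mul 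
      ((continuousOn_const.add (continuousOn_const.inner cg)).div cW (fun x _ => (Wf_pos u x).ne')))
      (int_const_ball (W0f r e μ) 2) (fun x hx => ?_) (fun x hx h => by rw [ph_R h, zero_mul])
    rw [abs_mul, abs_of_nonneg (ph_nonneg _)]
    refine (mul_le_of_le_one_left (abs_nonneg _) (ph_le_one _)).trans ?_
    rw [abs_div, abs_of_pos (Wf_pos u x), div_le_iff₀ (Wf_pos u x)]
    exact abs_one_add_inner_le _ _
  have h3 := JJ_integrable hu hv hs
  refine ⟨h1, h2, ?_⟩
  have h4 := hF.integral_eq_zero hv.isOpen.measurableSet ((cont_uΩ hv).sub (by fun_prop)) ((h1.sub h2).sub h3) (by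
    filter_upwards [hv.contact, ae_restrict_mem hv.isOpen.measurableSet] with x hx hxΩ h0
    rw [hx h0]
    have : v x = inner ℝ (r + μ • e) x := by linarith
    rw [this, intervalIntegral.integral_same, real_inner_comm]; simp)
  have h5 : ∫ x in Ω', (ph (x, v x) * ((1 + inner ℝ (gradient u x) (gradient v x)) / Wf u x)
      - ph (x, inner ℝ (r + μ • e) x) * ((1 + inner ℝ (r + μ • e) (gradient u x)) / Wf u x)
      - JJ u (inner ℝ (r + μ • e) x) (v x) x) = 0 := h4
  rw [integral_sub (by exact h1.sub h2) h3, integral_sub h1 h2] at h5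
  linarith

theorem step_ineq {r e : E} {μ : ℝ} {Ω : Set E} {u : E → ℝ} (hu : Sol r e μ Ω u) {lam : ℝ} (hl : 1 ≤ lam) :
    IntegrableOn (fun x => JJ u (vh (r + μ • e) lam Ω u x) (u x) x) Ω ∧
    GG r e Ω u - GG r e (sO lam Ω) (sc lam u) ≤ ∫ x in Ω, JJ u (vh (r + μ • e) lam Ω u x) (u x) x := by
  have hl0 : 0 < lam := by linarith
  have hv := hu.scale hl0
  have hs := sO_sub hu hl
  set Ω' := sO lam Ω with hΩ'
  set v := sc lam u with hvdef
  have hm' : MeasurableSet Ω' := hv.isOpen.measurableSet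
  have hm : MeasurableSet Ω := hu.isOpen.measurableSet
  obtain ⟨a1, a2, a3⟩ := flux_eq hu hu subset_rfl
  obtain ⟨b1, b2, b3⟩ := flux_eq hu hv hs
  have J1 := JJ_integrable hu hu subset_rfl
  have J2 := JJ_integrable hu hv hs
  have hJ : ∀ x ∈ Ω, JJ u (vh (r + μ • e) lam Ω u x) (u x) x = JJ u (inner ℝ (r + μ • e) x) (u x) x
      - Ω'.indicator (fun x => JJ u (inner ℝ (r + μ • e) x) (v x) x) x := by
    intro x hx
    by_cases hx' : x ∈ Ω'
    · have : lam • x ∈ Ω := hx'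
      rw [indicator_of_mem hx', vh, if_pos this]
      unfold JJ
      rw [intervalIntegral.integral_interval_sub_left (JJ_int _ _ _ _) (JJ_int _ _ _ _)]
    · have : lam • x ∉ Ω := hx'
      rw [indicator_of_notMem hx', vh, if_neg this, sub_zero]
  have J2' : IntegrableOn (Ω'.indicator (fun x => JJ u (inner ℝ (r + μ • e) x) (v x) x)) Ω :=
    ((integrable_indicator_iff hm').2 J2).integrableOn
  have hIg : IntegrableOn (fun x => JJ u (vh (r + μ • e) lam Ω u x) (u x) x) Ω :=
    (J1.sub J2').congr_fun (fun x hx => (hJ x hx).symm) hm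
  refine ⟨hIg, ?_⟩
  have hI : ∫ x in Ω, JJ u (vh (r + μ • e) lam Ω u x) (u x) x = (∫ x in Ω, JJ u (inner ℝ (r + μ • e) x) (u x) x)
      - ∫ x in Ω', JJ u (inner ℝ (r + μ • e) x) (v x) x := by
    rw [setIntegral_congr_fun hm hJ, integral_sub J1 J2', setIntegral_indicator hm', inter_eq_self_of_subset_right hs]
  have h1 : ∫ x in Ω, ph (x, u x) * Wf u x = ∫ x in Ω, ph (x, u x) * ((1 + inner ℝ (gradient u x) (gradient u x)) / Wf u x) := by
    refine setIntegral_congr_fun hm fun x _ => ?_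
    have := Wf_sq u x
    have hW := Wf_pos u x
    rw [real_inner_self_eq_norm_sq, ← this]; field_simp
  have h2 : ∫ x in Ω', ph (x, v x) * ((1 + inner ℝ (gradient u x) (gradient v x)) / Wf u x) ≤ ∫ x in Ω', ph (x, v x) * Wf v x := by
    refine setIntegral_mono_on b1 (int_phW hv) hm' fun x _ => ?_
    refine mul_le_mul_of_nonneg_left ?_ (ph_nonneg _)
    rw [div_le_iff₀ (Wf_pos u x), mul_comm]
    exact one_add_inner_le _ _
  have h3 : (∫ x in Ω, ph (x, inner ℝ (r + μ • e) x) * ((1 + inner ℝ (r + μ • e) (gradient u x)) / Wf u x)) 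
      - (∫ x in Ω', ph (x, inner ℝ (r + μ • e) x) * ((1 + inner ℝ (r + μ • e) (gradient u x)) / Wf u x))
      ≤ W0f r e μ * ((∫ x in Ω, ph (x, inner ℝ (r + μ • e) x)) - ∫ x in Ω', ph (x, inner ℝ (r + μ • e) x)) := by
    have hp := int_phl hu.isOpen (r + μ • e)
    rw [← integral_diff hm' a2 hs, ← integral_diff hm' hp hs, ← integral_const_mul]
    refine setIntegral_mono_on (a2.mono_set diff_subset) ((hp.mono_set diff_subset).const_mul _) (hm.diff hm') fun x _ => ?_
    rw [mul_comm (W0f r e μ)]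
    refine mul_le_mul_of_nonneg_left ?_ (ph_nonneg _)
    rw [div_le_iff₀ (Wf_pos u x)]
    exact one_add_inner_le _ _
  rw [GG_eq hu, GG_eq hv, hI]
  rw [h1]
  linarith
end Bern

namespace Bern
open MeasureTheory Filter Topology InnerProductSpace

variable {E : Type*} [NormedAddCommGroup E] [InnerProductSpace ℝ E] [FiniteDimensional ℝ E]
  [MeasurableSpace E] [BorelSpace E]


noncomputable def Qd (u : E → ℝ) (x : E) : ℝ := 2 * dph (x, u x) * (gf u x) ^ 2 / Wf u x
noncomputable def QQ (Ω : Set E) (u : E → ℝ) : ℝ := ∫ x in Ω, Qd u x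

theorem Qd_nonneg (u : E → ℝ) (x : E) : 0 ≤ Qd u x := by
  have := dph_nonneg (x, u x); have := Wf_pos u x
  unfold Qd; positivity

theorem gf_le {u : E → ℝ} {x : E} {a b : ℝ} (h1 : |u x| ≤ a) (h2 : ‖x‖ ≤ b) : |gf u x| ≤ (a + b) * Wf u x := by
  unfold gf
  have h3 := abs_real_inner_le_norm x (gradient u x)
  have hW := one_le_Wf u x
  have h4 : ‖x‖ * ‖gradient u x‖ ≤ b * Wf u x := mul_le_mul h2 (norm_grad_le u x) (norm_nonneg _) ((norm_nonneg _).trans h2)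
  have h5 := abs_sub (u x) (inner ℝ x (gradient u x))
  have h6 : a ≤ a * Wf u x := le_mul_of_one_le_right ((abs_nonneg _).trans h1) hW
  linarith

theorem int_Qd {r e : E} {μ : ℝ} {Ω : Set E} {u : E → ℝ} (hu : Sol r e μ Ω u) : IntegrableOn (Qd u) Ω := by
  obtain ⟨C, hC0, hC⟩ := dph_bound (E := E)
  have cW := cont_Wf hu.isOpen hu.c1
  refine int_of_bound' hu.isOpen (R := 2) (g := fun x => (2 * C * 16) * Wf u x) ?_ ((hu.int_W 2).const_mul _) (fun x hx hx2 => ?_) (fun x hx h => by simp [Qd, dph_R h])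
  · unfold Qd
    exact ((continuousOn_const.mul (cont_pair (cont_uΩ hu) dph_cont)).mul ((cont_gf hu).pow 2)).div cW (fun x _ => (Wf_pos u x).ne')
  · rw [abs_of_nonneg (Qd_nonneg u x)]
    have hW := Wf_pos u x
    have hd := dph_nonneg (x, u x)
    by_cases h : 2 ≤ ‖x‖ ^ 2 + u x ^ 2
    · have : Qd u x = 0 := by unfold Qd; rw [dph_zero h]; simp
      rw [this]; positivity
    · push Not at h
      have h2 : |u x| ≤ 2 := abs_le_of_sq_le_sq (by nlinarith [sq_nonneg ‖x‖]) (by norm_num)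
      have h3 := gf_le h2 hx2.le
      have h4 : gf u x ^ 2 ≤ ((2 + 2) * Wf u x) ^ 2 := by
        rw [← sq_abs]; exact pow_le_pow_left₀ (abs_nonneg _) h3 2
      unfold Qd
      rw [div_le_iff₀ hW]
      calc 2 * dph (x, u x) * gf u x ^ 2 ≤ 2 * C * ((2 + 2) * Wf u x) ^ 2 := by
            gcongr
            exact hC _
        _ = _ := by ring

theorem int_gf {r e : E} {μ : ℝ} {Ω : Set E} {u : E → ℝ} (hu : Sol r e μ Ω u) (R : ℝ) :
    IntegrableOn (gf u) (Ω ∩ closedBall 0 R) := by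
  obtain ⟨L, hL0, hL⟩ := w_bound hu R
  have hm : MeasurableSet (Ω ∩ closedBall (0:E) R) := hu.isOpen.measurableSet.inter measurableSet_closedBall
  have h1 : IntegrableOn (Wf u) (Ω ∩ closedBall 0 R) := (hu.int_W (R + 1)).mono_set
    (inter_subset_inter_right _ (closedBall_subset_ball (by linarith)))
  refine Integrable.mono' (h1.const_mul (L + R)) (((cont_gf hu).mono inter_subset_left).aestronglyMeasurable hm) ?_
  rw [ae_restrict_iff' hm]
  refine Eventually.of_forall fun x hx => ?_
  have hx2 : ‖x‖ ≤ R := by simpa using hx.2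
  exact gf_le (hL x (subset_closure hx.1) hx2).2 hx2

theorem int_w_ball {r e : E} {μ : ℝ} {Ω : Set E} {u : E → ℝ} (hu : Sol r e μ Ω u) (R : ℝ) :
    IntegrableOn (fun x => u x - inner ℝ (r + μ • e) x) (Ω ∩ closedBall 0 R) := by
  obtain ⟨L, hL0, hL⟩ := w_bound hu R
  have hm : MeasurableSet (Ω ∩ closedBall (0:E) R) := hu.isOpen.measurableSet.inter measurableSet_closedBall
  have h1 : IntegrableOn (fun _ => L) (Ω ∩ closedBall 0 R) := (int_const_ball L (R + 1)).mono_set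
    (inter_subset_inter_right _ (closedBall_subset_ball (by linarith)))
  refine Integrable.mono' h1 ((((cont_uΩ hu).sub (by fun_prop)).mono inter_subset_left).aestronglyMeasurable hm) ?_
  rw [ae_restrict_iff' hm]
  refine Eventually.of_forall fun x hx => ?_
  have hx2 : ‖x‖ ≤ R := by simpa using hx.2
  exact (hL x (subset_closure hx.1) hx2).1

theorem int_diff {r e : E} {μ : ℝ} {Ω : Set E} {u : E → ℝ} (hu : Sol r e μ Ω u) {lam : ℝ} (hl : 1 ≤ lam) :
    IntegrableOn (fun x => u x - vh (r + μ • e) lam Ω u x) (Ω ∩ closedBall 0 2) := by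
  have hv := hu.scale (show 0 < lam by linarith)
  have h1 := int_w_ball hu 2
  have h2 := int_w_ball hv 2
  have hm : MeasurableSet (sO lam Ω ∩ closedBall (0:E) 2) := hv.isOpen.measurableSet.inter measurableSet_closedBall
  have hm2 : MeasurableSet (Ω ∩ closedBall (0:E) 2) := hu.isOpen.measurableSet.inter measurableSet_closedBall
  have h3 : IntegrableOn ((sO lam Ω ∩ closedBall (0:E) 2).indicator (fun x => sc lam u x - inner ℝ (r + μ • e) x)) (Ω ∩ closedBall 0 2) :=
    ((integrable_indicator_iff hm).2 h2).integrableOn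
  refine (h1.sub h3).congr_fun (fun x hx => ?_) hm2
  by_cases hx' : lam • x ∈ Ω
  · have : x ∈ sO lam Ω ∩ closedBall (0:E) 2 := ⟨hx', hx.2⟩
    simp only [vh, if_pos hx', Pi.sub_apply, indicator_of_mem this]; ring
  · have : x ∉ sO lam Ω ∩ closedBall (0:E) 2 := fun h => hx' h.1
    simp only [vh, if_neg hx', Pi.sub_apply, indicator_of_notMem this]; ring

noncomputable def lk (k : ℕ) : ℝ := 1 + ((k:ℝ) + 1)⁻¹
theorem lk_gt (k : ℕ) : 1 < lk k := by unfold lk; have : 0 < ((k:ℝ) + 1)⁻¹ := by positivity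
                                       linarith
theorem inv_tendsto : Tendsto (fun k : ℕ => ((k:ℝ) + 1)⁻¹) atTop (𝓝 0) := by
  simpa using tendsto_one_div_add_atTop_nhds_zero_nat (𝕜 := ℝ)
theorem lk_tendsto : Tendsto lk atTop (𝓝 1) := by
  have := inv_tendsto.const_add 1
  rw [add_zero] at this; exact this

theorem seq_slope {f : ℝ → ℝ} {f' : ℝ} (h : HasDerivAt f f' 1) :
    Tendsto (fun k : ℕ => ((k:ℝ) + 1) * (f (lk k) - f 1)) atTop (𝓝 f') := by
  have h1 := hasDerivAt_iff_tendsto_slope_zero.1 h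
  have h2 : Tendsto (fun k : ℕ => ((k:ℝ) + 1)⁻¹) atTop (𝓝[≠] 0) :=
    tendsto_nhdsWithin_iff.2 ⟨inv_tendsto, Eventually.of_forall fun k => by
      have : ((k:ℝ) + 1)⁻¹ ≠ 0 := by positivity
      exact this⟩
  have h3 := h1.comp h2
  refine h3.congr fun k => ?_
  simp [lk]

theorem ev_mem {r e : E} {μ : ℝ} {Ω : Set E} {u : E → ℝ} (hu : Sol r e μ Ω u) {x : E} (hx : x ∈ Ω) :
    ∀ᶠ k in atTop, lk k • x ∈ Ω := by
  have : Tendsto (fun k => lk k • x) atTop (𝓝 x) := by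
    have := lk_tendsto.smul_const x
    rwa [one_smul] at this
  exact this (hu.isOpen.mem_nhds hx)

theorem lim_diff {r e : E} {μ : ℝ} {Ω : Set E} {u : E → ℝ} (hu : Sol r e μ Ω u) {x : E} (hx : x ∈ Ω) :
    Tendsto (fun k : ℕ => ((k:ℝ) + 1) * |u x - vh (r + μ • e) (lk k) Ω u x|) atTop (𝓝 |gf u x|) := by
  have h1 : HasDerivAt (fun s : ℝ => sc s u x) (-(gf u ((1:ℝ) • x)) / 1 ^ 2) 1 :=
    ray_deriv (u := u) (x := x) one_ne_zero (by rw [one_smul]; exact hu.diff hx)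
  have h2 := (seq_slope h1).abs
  have h3 : |-(gf u ((1:ℝ) • x)) / 1 ^ 2| = |gf u x| := by simp
  rw [h3] at h2
  refine h2.congr' ?_
  filter_upwards [ev_mem hu hx] with k hk
  rw [vh, if_pos hk, abs_mul, abs_of_pos (by positivity), abs_sub_comm]
  simp [sc]

theorem lim_JJ {r e : E} {μ : ℝ} {Ω : Set E} {u : E → ℝ} (hu : Sol r e μ Ω u) {x : E} (hx : x ∈ Ω) :
    Tendsto (fun k : ℕ => ((k:ℝ) + 1) * JJ u (vh (r + μ • e) (lk k) Ω u x) (u x) x) atTop (𝓝 (-(Qd u x))) := by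
  have h1 : HasDerivAt (fun s : ℝ => sc s u x) (-(gf u ((1:ℝ) • x)) / 1 ^ 2) 1 :=
    ray_deriv (u := u) (x := x) one_ne_zero (by rw [one_smul]; exact hu.diff hx)
  have hc : Continuous (fun ζ => fderiv ℝ ph (x, ζ) (-(Ff u x), (Wf u x)⁻¹)) := by
    have : Continuous (fun ζ : ℝ => fderiv ℝ ph (x, ζ)) := (ph_contDiff.continuous_fderiv (by norm_num)).comp (by fun_prop)
    exact this.clm_apply continuous_const
  have s1 : sc 1 u x = u x := by simp [sc]
  have h2 : HasDerivAt (fun y => ∫ ζ in (u x)..y, fderiv ℝ ph (x, ζ) (-(Ff u x), (Wf u x)⁻¹))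
      (fderiv ℝ ph (x, u x) (-(Ff u x), (Wf u x)⁻¹)) (sc 1 u x) := by
    rw [s1]; exact (hc.integral_hasStrictDerivAt (u x) (u x)).hasDerivAt
  have h3 := (seq_slope (h2.comp 1 h1)).neg
  have h4 : -(fderiv ℝ ph (x, u x) (-(Ff u x), (Wf u x)⁻¹) * (-(gf u ((1:ℝ) • x)) / 1 ^ 2)) = -(Qd u x) := by
    rw [ph_deriv, Qd, one_smul, Ff, inner_neg_right, inner_smul_right]
    have := Wf_pos u x
    simp only [gf]
    field_simp
    ring
  rw [h4] at h3
  refine h3.congr' ?_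
  filter_upwards [ev_mem hu hx] with k hk
  rw [vh, if_pos hk]
  simp only [Function.comp_def, s1, intervalIntegral.integral_same, sub_zero]
  rw [intervalIntegral.integral_symm, JJ]; ring

theorem lim_ball {r e : E} {μ : ℝ} {Ω : Set E} {u : E → ℝ} (hu : Sol r e μ Ω u) :
    Tendsto (fun k : ℕ => ∫ x in Ω ∩ closedBall 0 (2 * lk k), ‖gf u x‖) atTop (𝓝 (∫ x in Ω ∩ closedBall 0 2, ‖gf u x‖)) := by
  have hanti : Antitone lk := fun a b hab => by
    unfold lk; gcongr
  have : Ω ∩ closedBall (0:E) 2 = ⋂ k, Ω ∩ closedBall 0 (2 * lk k) := by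
    ext x
    simp only [mem_iInter, mem_inter_iff, mem_closedBall, dist_zero_right]
    constructor
    · rintro ⟨h1, h2⟩ k
      exact ⟨h1, by linarith [lk_gt k]⟩
    · intro h
      refine ⟨(h 0).1, ?_⟩
      have := lk_tendsto.const_mul 2
      rw [mul_one] at this
      exact ge_of_tendsto' this fun k => (h k).2
  rw [this]
  refine tendsto_setIntegral_of_antitone (fun k => hu.isOpen.measurableSet.inter measurableSet_closedBall)
    (fun a b hab => inter_subset_inter_right _ (closedBall_subset_closedBall (by have := hanti hab; linarith))) ⟨0, (int_gf hu _).norm⟩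

theorem diff_le {r e : E} {μ : ℝ} {Ω : Set E} {u : E → ℝ} (hu : Sol r e μ Ω u) (k : ℕ) :
    ((k:ℝ) + 1) * ∫ x in Ω ∩ closedBall 0 2, |u x - vh (r + μ • e) (lk k) Ω u x| ≤ ∫ x in Ω ∩ closedBall 0 (2 * lk k), ‖gf u x‖ := by
  have h1 := ray_int hu (lk_gt k).le
  rw [← ofReal_integral_norm_eq_lintegral_enorm (int_diff hu (lk_gt k).le), ← ofReal_integral_norm_eq_lintegral_enorm (int_gf hu _),
    ← ENNReal.ofReal_mul (by linarith [lk_gt k]), ENNReal.ofReal_le_ofReal_iff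
      (mul_nonneg (by linarith [lk_gt k]) (integral_nonneg fun x => norm_nonneg _))] at h1
  have h2 : lk k - 1 = ((k:ℝ) + 1)⁻¹ := by simp [lk]
  rw [h2] at h1
  have h3 : (0:ℝ) < (k:ℝ) + 1 := by positivity
  rw [← div_eq_inv_mul, le_div_iff₀ h3, mul_comm] at h1
  exact h1

theorem step_lim {r e : E} {μ : ℝ} {Ω : Set E} {u : E → ℝ} (hu : Sol r e μ Ω u) {ε : ℝ} (hε : 0 < ε) :
    ∀ᶠ k : ℕ in atTop, ((k:ℝ) + 1) * (GG r e Ω u - GG r e (sO (lk k) Ω) (sc (lk k) u)) < -QQ Ω u + ε := by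
  by_contra hcon
  rw [not_eventually] at hcon
  obtain ⟨C, hC0, hC⟩ := JJ_bound (E := E)
  have hm : MeasurableSet (Ω ∩ closedBall (0:E) 2) := hu.isOpen.measurableSet.inter measurableSet_closedBall
  set B : ℝ := ∫ x in Ω ∩ closedBall 0 2, ‖gf u x‖ with hB
  have hev : ∀ᶠ k : ℕ in atTop, C * ∫ x in Ω ∩ closedBall 0 (2 * lk k), ‖gf u x‖ < C * B + ε / 2 :=
    ((lim_ball hu).const_mul C).eventually_lt_const (by linarith)
  obtain ⟨s, hs, hs2⟩ := extraction_of_frequently_atTop (hcon.and_eventually hev)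
  set I : ℕ → E → ℝ := fun k x => JJ u (vh (r + μ • e) (lk k) Ω u x) (u x) x with hI
  set D : ℕ → E → ℝ := fun k => (Ω ∩ closedBall (0:E) 2).indicator (fun x => |u x - vh (r + μ • e) (lk k) Ω u x|) with hD
  have hDi : ∀ k, IntegrableOn (D k) Ω := fun k => ((integrable_indicator_iff hm).2 (int_diff hu (lk_gt k).le).abs).integrableOn
  have hIi : ∀ k, IntegrableOn (I k) Ω := fun k => (step_ineq hu (lk_gt k).le).1
  have hDint : ∀ k, ∫ x in Ω, D k x = ∫ x in Ω ∩ closedBall 0 2, |u x - vh (r + μ • e) (lk k) Ω u x| := fun k => by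
    rw [hD, setIntegral_indicator hm, ← inter_assoc, inter_self]
  have hgi : IntegrableOn ((Ω ∩ closedBall (0:E) 2).indicator (fun x => |gf u x|)) Ω :=
    ((integrable_indicator_iff hm).2 (int_gf hu 2).abs).integrableOn
  have key := real_fatou (μ := volume.restrict Ω) (f := fun j x => C * (((s j : ℕ):ℝ) + 1) * D (s j) x - (((s j : ℕ):ℝ) + 1) * I (s j) x)
    (g := fun x => C * (Ω ∩ closedBall (0:E) 2).indicator (fun x => |gf u x|) x - (-(Qd u x))) (C := C * B + QQ Ω u - ε / 2)
    (fun j => ((hDi _).const_mul _).sub ((hIi _).const_mul _)) (fun j => ?_) ?_ (fun j => ?_)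
  · have h1 := key.2
    have h2 : ∫ x in Ω, (C * (Ω ∩ closedBall (0:E) 2).indicator (fun x => |gf u x|) x - (-(Qd u x))) = C * B + QQ Ω u := by
      have hq : IntegrableOn (fun x => -(Qd u x)) Ω := (int_Qd hu).neg
      rw [integral_sub (hgi.const_mul C) hq, integral_const_mul, setIntegral_indicator hm, ← inter_assoc, inter_self, integral_neg, QQ, hB]
      simp only [Real.norm_eq_abs]; ring
    rw [h2] at h1
    linarith
  · filter_upwards [ae_restrict_mem hu.isOpen.measurableSet] with x hx
    have h0 : (0:ℝ) ≤ ((s j : ℕ):ℝ) + 1 := by positivity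
    have : I (s j) x ≤ C * D (s j) x := by
      by_cases hx2 : x ∈ closedBall (0:E) 2
      · rw [hD]; simp only; rw [indicator_of_mem (show x ∈ Ω ∩ closedBall (0:E) 2 from ⟨hx, hx2⟩)]
        exact (le_abs_self _).trans (hC _ _ _ _)
      · rw [hD]; simp only; rw [indicator_of_notMem (show x ∉ Ω ∩ closedBall (0:E) 2 from fun h => hx2 h.2), hI]
        simp only
        rw [JJ_zero (by simp at hx2; exact hx2.le)]; simp
    nlinarith
  · filter_upwards [ae_restrict_mem hu.isOpen.measurableSet] with x hx
    refine Tendsto.sub ?_ ((lim_JJ hu hx).comp hs.tendsto_atTop)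
    by_cases hx2 : x ∈ closedBall (0:E) 2
    · simp only [hD, indicator_of_mem (show x ∈ Ω ∩ closedBall (0:E) 2 from ⟨hx, hx2⟩), mul_assoc]
      exact ((lim_diff hu hx).comp hs.tendsto_atTop).const_mul C
    · simp only [hD, indicator_of_notMem (show x ∉ Ω ∩ closedBall (0:E) 2 from fun h => hx2 h.2), mul_zero]
      exact tendsto_const_nhds
  · obtain ⟨h1, h2⟩ := hs2 j
    have h0 : (0:ℝ) ≤ ((s j : ℕ):ℝ) + 1 := by positivity
    have h3 := mul_le_mul_of_nonneg_left (step_ineq hu (lk_gt (s j)).le).2 h0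
    have h4 := mul_le_mul_of_nonneg_left (diff_le hu (s j)) hC0
    rw [integral_sub ((hDi _).const_mul _) ((hIi _).const_mul _), integral_const_mul, integral_const_mul, hDint, mul_assoc]
    push Not at h1
    have h5 : ∫ x in Ω, I (s j) x = ∫ x in Ω, JJ u (vh (r + μ • e) (lk (s j)) Ω u x) (u x) x := rfl
    rw [h5]
    linarith
end Bern

namespace Bern
open MeasureTheory Filter Topology InnerProductSpace

variable {E : Type*} [NormedAddCommGroup E] [InnerProductSpace ℝ E] [FiniteDimensional ℝ E]
  [MeasurableSpace E] [BorelSpace E]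


theorem Sg_smul {r e : E} {T : ℝ} (hT : 0 < T) (p : E × ℝ) (P : E) : Sg r e (T • p) P = Sg r e p P := by
  have hρ : rho r e (T • p) = T * rho r e p := by
    unfold rho
    rw [map_smul, map_smul, smul_eq_mul, smul_eq_mul, mul_pow, mul_pow, ← mul_add, Real.sqrt_mul (by positivity), Real.sqrt_sq hT.le]
  unfold Sg
  rw [hρ, map_smul, map_smul, smul_eq_mul, smul_eq_mul]
  rw [show T * tL e p * (1 + inner ℝ r P) / kap r + T * zL r p * inner ℝ e P = T * (tL e p * (1 + inner ℝ r P) / kap r + zL r p * inner ℝ e P) by ring]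
  exact mul_div_mul_left _ _ hT.ne'

open Pointwise in
theorem smul_sO {T : ℝ} (hT : T ≠ 0) (Ω : Set E) : T • sO T Ω = Ω := by
  ext x; rw [mem_smul_set_iff_inv_smul_mem₀ hT]; simp [sO, smul_smul, hT]

theorem GG_scale {r e : E} {μ : ℝ} {Ω : Set E} {u : E → ℝ} (hu : Sol r e μ Ω u) {T : ℝ} (hT : 0 < T) :
    GG r e (sO T Ω) (sc T u) = (T ^ Module.finrank ℝ E)⁻¹ * ∫ y in Ω, ph (T⁻¹ • y, T⁻¹ * u y) * (Wf u y - Sg r e (y, u y) (gradient u y)) := by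
  have h := Measure.setIntegral_comp_smul_of_pos (volume : Measure E) (fun y => ph (T⁻¹ • y, T⁻¹ * u y) * (Wf u y - Sg r e (y, u y) (gradient u y))) (sO T Ω) hT
  rw [smul_sO hT.ne', smul_eq_mul] at h
  rw [← h, GG]
  refine setIntegral_congr_fun (sO_open hu.isOpen T).measurableSet (fun x hx => ?_)
  have hd := hu.diff hx
  rw [Wf_sc hT.ne' u x hd, grad_sc hT.ne' u x hd, ← Sg_smul hT, smul_smul, inv_mul_cancel₀ hT.ne', one_smul]
  simp only [Prod.smul_mk, sc, smul_eq_mul]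
  rw [mul_inv_cancel_left₀ hT.ne']

theorem GG_cont {r e : E} {μ : ℝ} {Ω : Set E} {u : E → ℝ} (hu : Sol r e μ Ω u) :
    ContinuousOn (fun T => GG r e (sO T Ω) (sc T u)) (Ioi 0) := by
  have h1 : ContinuousOn (fun T : ℝ => (T ^ Module.finrank ℝ E)⁻¹ * ∫ y in Ω, ph (T⁻¹ • y, T⁻¹ * u y) * (Wf u y - Sg r e (y, u y) (gradient u y))) (Ioi 0) := by
    refine ContinuousOn.mul (ContinuousOn.inv₀ (by fun_prop) (fun T hT => pow_ne_zero _ (ne_of_gt hT))) ?_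
    intro T0 hT0
    have hT0' : (0:ℝ) < T0 := hT0
    apply ContinuousAt.continuousWithinAt
    have hev : ∀ᶠ T in 𝓝 T0, 0 < T ∧ T < 2 * T0 := (eventually_gt_nhds hT0').and (eventually_lt_nhds (by linarith))
    refine continuousAt_of_dominated (bound := (Ω ∩ ball (0:E) (4 * T0)).indicator (fun x => 2 * Wf u x)) ?_ ?_ ?_ ?_
    · refine Eventually.of_forall (fun T => ContinuousOn.aestronglyMeasurable ?_ hu.isOpen.measurableSet)
      refine ContinuousOn.mul (ph_contDiff.continuous.comp_continuousOn ?_) ((cont_Wf hu.isOpen hu.c1).sub (cont_S hu))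
      exact (continuousOn_id.const_smul _).prodMk (continuousOn_const.mul (cont_uΩ hu))
    · filter_upwards [hev] with T hT
      filter_upwards [ae_restrict_mem hu.isOpen.measurableSet] with x hx
      by_cases hx2 : x ∈ ball (0:E) (4 * T0)
      · rw [indicator_of_mem (show x ∈ Ω ∩ ball (0:E) (4 * T0) from ⟨hx, hx2⟩), norm_mul, Real.norm_eq_abs, Real.norm_eq_abs, abs_of_nonneg (ph_nonneg _)]
        have h := abs_le.1 (S_le hu hx)
        have h2 : |Wf u x - Sg r e (x, u x) (gradient u x)| ≤ 2 * Wf u x := abs_le.2 ⟨by linarith, by linarith⟩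
        exact (mul_le_of_le_one_left (abs_nonneg _) (ph_le_one _)).trans h2
      · rw [indicator_of_notMem (show x ∉ Ω ∩ ball (0:E) (4 * T0) from fun h => hx2 h.2), ph_R, zero_mul, norm_zero]
        rw [norm_smul, norm_inv, Real.norm_eq_abs, abs_of_pos hT.1, ← div_eq_inv_mul, le_div_iff₀ hT.1]
        simp at hx2; linarith [hT.2]
    · exact ((integrable_indicator_iff (hu.isOpen.measurableSet.inter measurableSet_ball)).2 ((hu.int_W _).const_mul 2)).integrableOn
    · refine Eventually.of_forall (fun x => ContinuousAt.mul ?_ continuousAt_const)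
      have hi : ContinuousAt (fun T : ℝ => T⁻¹) T0 := continuousAt_inv₀ hT0'.ne'
      exact ph_contDiff.continuous.continuousAt.comp ((hi.smul continuousAt_const).prodMk (hi.mul continuousAt_const))
  exact h1.congr (fun T hT => GG_scale hu hT)

theorem GG_nonneg {r e : E} {μ : ℝ} {Ω : Set E} {u : E → ℝ} (hu : Sol r e μ Ω u) : 0 ≤ GG r e Ω u :=
  setIntegral_nonneg hu.isOpen.measurableSet (fun x hx => mul_nonneg (ph_nonneg _) (sub_nonneg.2 ((le_abs_self _).trans (S_le hu hx))))

theorem GG_bound (r e : E) (μ : ℝ) : ∃ C : ℝ, ∀ (Ω : Set E) (u : E → ℝ), Sol r e μ Ω u → GG r e Ω u ≤ C := by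
  obtain ⟨C, hC0, hC⟩ := area_bound r e μ
  refine ⟨2 * C, fun Ω u hu => ?_⟩
  have h1 := hC Ω u hu (fun x => ph (x, u x)) (fun x _ => ph_nonneg _) (fun x _ => ph_le_one _) (fun x _ h => ph_zero (by show 2 ≤ ‖x‖ ^ 2 + u x ^ 2; linarith))
  have h2 : GG r e Ω u ≤ ∫ x in Ω, 2 * (ph (x, u x) * Wf u x) := by
    unfold GG
    refine integral_mono_of_nonneg ?_ ((int_phW hu).const_mul 2) ?_
    · filter_upwards [ae_restrict_mem hu.isOpen.measurableSet] with x hx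
      exact mul_nonneg (ph_nonneg _) (sub_nonneg.2 ((le_abs_self _).trans (S_le hu hx)))
    · filter_upwards [ae_restrict_mem hu.isOpen.measurableSet] with x hx
      have h := abs_le.1 (S_le hu hx)
      have h3 := ph_nonneg (x, u x)
      nlinarith
  rw [integral_const_mul] at h2
  linarith

theorem GG_slope {r e : E} {μ : ℝ} {Ω : Set E} {u : E → ℝ} (hu : Sol r e μ Ω u) {T c : ℝ} (hT : 0 < T) (hc : -QQ (sO T Ω) (sc T u) / T < c) :
    ∃ᶠ z in 𝓝[>] T, slope (fun T => -GG r e (sO T Ω) (sc T u)) T z < c := by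
  have hε : 0 < c * T + QQ (sO T Ω) (sc T u) := by rw [div_lt_iff₀ hT] at hc; linarith
  have h := step_lim (hu.scale hT) hε
  have ht : Tendsto (fun k : ℕ => T * lk k) atTop (𝓝[>] T) := by
    refine tendsto_nhdsWithin_iff.2 ⟨?_, Eventually.of_forall fun k => ?_⟩
    · simpa using lk_tendsto.const_mul T
    · have := lk_gt k; show T < T * lk k; nlinarith
  refine ht.frequently (h.mono (fun k hk => ?_)).frequently
  rw [sO_mul, sc_mul] at hk
  have e1 : T * lk k - T = T / ((k:ℝ) + 1) := by unfold lk; field_simp; ring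
  have e2 : slope (fun T => -GG r e (sO T Ω) (sc T u)) T (T * lk k) = ((k:ℝ) + 1) * (GG r e (sO T Ω) (sc T u) - GG r e (sO (T * lk k) Ω) (sc (T * lk k) u)) / T := by
    rw [slope_def_field, e1]; field_simp; ring
  rw [e2, div_lt_iff₀ hT]; linarith

theorem GG_log {r e : E} {μ : ℝ} {Ω : Set E} {u : E → ℝ} (hu : Sol r e μ Ω u) {T0 T1 c : ℝ} (hT0 : 0 < T0) (h01 : T0 ≤ T1)
    (hc : ∀ T ∈ Ico T0 T1, c ≤ QQ (sO T Ω) (sc T u)) :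
    GG r e (sO T0 Ω) (sc T0 u) + c * (Real.log T1 - Real.log T0) ≤ GG r e (sO T1 Ω) (sc T1 u) := by
  have key := image_le_of_liminf_slope_right_le_deriv_boundary (f := fun T => -GG r e (sO T Ω) (sc T u)) (a := T0) (b := T1)
    ((GG_cont hu).mono (fun T hT => lt_of_lt_of_le hT0 hT.1)).neg
    (B := fun T => -GG r e (sO T0 Ω) (sc T0 u) - c * (Real.log T - Real.log T0)) (B' := fun T => -(c * T⁻¹)) (by simp)
    (by
      refine continuousOn_const.sub (continuousOn_const.mul (ContinuousOn.sub (Real.continuousOn_log.mono ?_) continuousOn_const))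
      intro T hT; exact (lt_of_lt_of_le hT0 hT.1).ne')
    (fun T hT => by
      have := (((Real.hasDerivAt_log (lt_of_lt_of_le hT0 hT.1).ne').sub_const (Real.log T0)).const_mul c).const_sub (-GG r e (sO T0 Ω) (sc T0 u))
      exact this.hasDerivWithinAt)
    (fun T hT s hs => by
      have hT' := lt_of_lt_of_le hT0 hT.1
      refine GG_slope hu hT' (lt_of_le_of_lt ?_ hs)
      rw [neg_div, div_eq_mul_inv]
      exact neg_le_neg (mul_le_mul_of_nonneg_right (hc T hT) (by positivity)))
    (x := T1) ⟨h01, le_rfl⟩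
  linarith

theorem QQ_nonneg {r e : E} {μ : ℝ} {Ω : Set E} {u : E → ℝ} (hu : Sol r e μ Ω u) : 0 ≤ QQ Ω u :=
  integral_nonneg (fun x => Qd_nonneg _ _)

theorem GG_mono {r e : E} {μ : ℝ} {Ω : Set E} {u : E → ℝ} (hu : Sol r e μ Ω u) {T0 T1 : ℝ} (hT0 : 0 < T0) (h01 : T0 ≤ T1) :
    GG r e (sO T0 Ω) (sc T0 u) ≤ GG r e (sO T1 Ω) (sc T1 u) := by
  have := GG_log hu hT0 h01 (c := 0) (fun T hT => QQ_nonneg (hu.scale (lt_of_lt_of_le hT0 hT.1)))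
  linarith

theorem QQ_small {r e : E} {μ : ℝ} {Ω : Set E} {u : E → ℝ} (hu : Sol r e μ Ω u) {T0 ε : ℝ} (hT0 : 0 < T0) (hε : 0 < ε) :
    ∃ T, T0 ≤ T ∧ QQ (sO T Ω) (sc T u) < ε := by
  by_contra hcon
  push Not at hcon
  obtain ⟨C, hC⟩ := GG_bound r e μ
  set L : ℝ := |C| / ε + 1 with hL
  have hLp : 0 < L := by positivity
  have h01 : T0 ≤ T0 * Real.exp L := le_mul_of_one_le_right hT0.le (Real.one_le_exp hLp.le)
  have h := GG_log hu hT0 h01 (c := ε) (fun T hT => hcon T hT.1)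
  rw [Real.log_mul hT0.ne' (Real.exp_pos _).ne', Real.log_exp] at h
  have h2 := hC _ _ (hu.scale (lt_of_lt_of_le hT0 h01))
  have h3 := GG_nonneg (hu.scale hT0)
  have h4 : ε * L = |C| + ε := by rw [hL]; field_simp
  have h5 := le_abs_self C
  nlinarith
end Bern

namespace Bern
open MeasureTheory Filter Topology InnerProductSpace

variable {E : Type*} [NormedAddCommGroup E] [InnerProductSpace ℝ E] [FiniteDimensional ℝ E]
  [MeasurableSpace E] [BorelSpace E]


noncomputable def zf (r : E) (u : E → ℝ) (x : E) : ℝ := (u x - inner ℝ r x) / kap r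
noncomputable def kg (r e : E) (u : E → ℝ) (x : E) : ℝ :=
  inner ℝ e x / kap r * (1 + inner ℝ r (gradient u x)) + zf r u x * inner ℝ e (gradient u x)
noncomputable def Zk (r e : E) (u : E → ℝ) (x : E) : E :=
  kg r e u x • Ff u x - (Wf u x * zf r u x) • e - (Wf u x * (inner ℝ e x / kap r)) • r

theorem grad_c1 {r e : E} {μ : ℝ} {Ω : Set E} {u : E → ℝ} (hu : Sol r e μ Ω u) : ContDiffOn ℝ 1 (gradient u) Ω := by
  have h1 : ContDiffOn ℝ 1 (fun x => fderiv ℝ u x) Ω := hu.c2.fderiv_of_isOpen hu.isOpen (by norm_num)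
  exact (toDual ℝ E).symm.contDiff.comp_contDiffOn h1

theorem hess {r e : E} {μ : ℝ} {Ω : Set E} {u : E → ℝ} (hu : Sol r e μ Ω u) {x : E} (hx : x ∈ Ω) :
    ∃ H : E →L[ℝ] E, HasFDerivAt (gradient u) H x ∧ ∀ a b, inner ℝ (H a) b = inner ℝ a (H b) := by
  have h1 := ((grad_c1 hu).contDiffAt (hu.isOpen.mem_nhds hx)).differentiableAt (by norm_num)
  refine ⟨_, h1.hasFDerivAt, fun a b => ?_⟩
  have h2 : IsSymmSndFDerivAt ℝ u x := (hu.c2.contDiffAt (hu.isOpen.mem_nhds hx)).isSymmSndFDerivAt (by simp)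
  have h3 : ∀ a b, inner ℝ (fderiv ℝ (gradient u) x a) b = fderiv ℝ (fderiv ℝ u) x a b := by
    intro a b
    have h4 : fderiv ℝ u = fun y => innerSL ℝ (gradient u y) := by
      ext y v; rw [fderiv_eq_inner]; rfl
    have h5 : HasFDerivAt (fderiv ℝ u) ((innerSL ℝ).comp (fderiv ℝ (gradient u) x)) x := by
      rw [h4]
      exact (innerSL ℝ).hasFDerivAt.comp x h1.hasFDerivAt
    rw [h5.fderiv]; rfl
  rw [h3, h2 a b, ← h3, real_inner_comm]

theorem W_deriv {u : E → ℝ} {x : E} {H : E →L[ℝ] E} (h : HasFDerivAt (gradient u) H x) :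
    HasFDerivAt (Wf u) ((Wf u x)⁻¹ • (innerSL ℝ (gradient u x)).comp H) x := by
  have h1 := (h.norm_sq.const_add 1).sqrt (by positivity)
  refine h1.congr_fderiv ?_
  ext v
  simp [Wf]; field_simp

theorem z_deriv {r : E} {u : E → ℝ} {x : E} (h : DifferentiableAt ℝ u x) :
    HasFDerivAt (zf r u) ((kap r)⁻¹ • (innerSL ℝ (gradient u x) - innerSL ℝ r)) x := by
  have h1 : HasFDerivAt (fun x => (kap r)⁻¹ * (u x - innerSL ℝ r x)) _ x := (h.hasFDerivAt.sub (innerSL ℝ r).hasFDerivAt).const_mul (kap r)⁻¹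
  have h2 : zf r u = fun x => (kap r)⁻¹ * (u x - innerSL ℝ r x) := by ext x; simp [zf]; ring
  rw [h2]
  refine h1.congr_fderiv ?_
  ext v; simp

theorem kg_deriv {r e : E} {u : E → ℝ} {x : E} {H : E →L[ℝ] E} (h : HasFDerivAt (gradient u) H x) (hd : DifferentiableAt ℝ u x) :
    HasFDerivAt (kg r e u) ((inner ℝ e x / kap r) • (innerSL ℝ r).comp H + ((1 + inner ℝ r (gradient u x)) / kap r) • innerSL ℝ e
      + zf r u x • (innerSL ℝ e).comp H + inner ℝ e (gradient u x) • ((kap r)⁻¹ • (innerSL ℝ (gradient u x) - innerSL ℝ r))) x := by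
  have h1 : HasFDerivAt (fun x => (kap r)⁻¹ * innerSL ℝ e x) _ x := (innerSL ℝ e).hasFDerivAt.const_mul (kap r)⁻¹
  have h2 : HasFDerivAt (fun x => 1 + innerSL ℝ r (gradient u x)) _ x := ((innerSL ℝ r).hasFDerivAt.comp x h).const_add 1
  have h3 : HasFDerivAt (fun x => innerSL ℝ e (gradient u x)) _ x := (innerSL ℝ e).hasFDerivAt.comp x h
  have h4 := (h1.fun_mul h2).add ((z_deriv (r := r) hd).fun_mul h3)
  have h5 : kg r e u = (fun x => (kap r)⁻¹ * innerSL ℝ e x * (1 + innerSL ℝ r (gradient u x))) + fun x => zf r u x * innerSL ℝ e (gradient u x) := by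
    ext x; simp only [kg, Pi.add_apply, innerSL_apply_apply]; ring
  rw [h5]
  refine h4.congr_fderiv ?_
  apply ContinuousLinearMap.ext; intro v
  simp only [ContinuousLinearMap.add_apply, ContinuousLinearMap.smul_apply, ContinuousLinearMap.sub_apply, ContinuousLinearMap.comp_apply, innerSL_apply_apply, smul_eq_mul]; ring

theorem killing_alg {r e : E} {u : E → ℝ} {x : E} {H : E →L[ℝ] E} (h : HasFDerivAt (gradient u) H x)
    (hs : ∀ a b, inner ℝ (H a) b = inner ℝ a (H b)) (hd : DifferentiableAt ℝ u x) (hre : inner ℝ r e = 0) {ψ : E → ℝ} (hψ : DifferentiableAt ℝ ψ x) :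
    fderiv ℝ (fun x => ψ x * kg r e u x) x (Ff u x) - fderiv ℝ (fun x => ψ x * (Wf u x * zf r u x)) x e
      - fderiv ℝ (fun x => ψ x * (Wf u x * (inner ℝ e x / kap r))) x r = fderiv ℝ ψ x (Zk r e u x) := by
  have h0 := hψ.hasFDerivAt
  have h1 := (h0.fun_mul (kg_deriv (r := r) (e := e) h hd)).fderiv
  have h2 := (h0.fun_mul ((W_deriv h).fun_mul (z_deriv (r := r) hd))).fderiv
  have h3' : HasFDerivAt (fun x => inner ℝ e x / kap r) ((kap r)⁻¹ • innerSL ℝ e) x := by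
    have := (innerSL ℝ e).hasFDerivAt (x := x) |>.const_mul (kap r)⁻¹
    have h5 : (fun x => inner ℝ e x / kap r) = fun x => (kap r)⁻¹ * innerSL ℝ e x := by ext x; simp; ring
    rw [h5]; exact this
  have h3 := (h0.fun_mul ((W_deriv h).fun_mul h3')).fderiv
  rw [h1, h2, h3]
  have hW := Wf_pos u x
  have hW2 := Wf_sq u x
  have hk := kap_pos r
  have e1 := hs (gradient u x) e
  have e2 := hs (gradient u x) r
  simp only [Zk, Ff, map_sub, map_smul, ContinuousLinearMap.add_apply, ContinuousLinearMap.smul_apply, ContinuousLinearMap.sub_apply, ContinuousLinearMap.comp_apply, innerSL_apply_apply, smul_eq_mul, real_inner_comm r e, hre]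
  rw [real_inner_comm (gradient u x) e, real_inner_comm (gradient u x) r] at *
  rw [real_inner_self_eq_norm_sq, real_inner_comm (H (gradient u x)) e, real_inner_comm (H (gradient u x)) r, e1, e2]
  have e3 : ‖gradient u x‖ ^ 2 = Wf u x ^ 2 - 1 := by linarith
  rw [e3]
  generalize fderiv ℝ ψ x (gradient u x) = a1
  generalize fderiv ℝ ψ x e = a2
  generalize fderiv ℝ ψ x r = a3
  field_simp
  ring
end Bern

namespace Bern
open MeasureTheory Filter Topology InnerProductSpace

variable {E : Type*} [NormedAddCommGroup E] [InnerProductSpace ℝ E] [FiniteDimensional ℝ E]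
  [MeasurableSpace E] [BorelSpace E]


theorem Wf_c1 {r e : E} {μ : ℝ} {Ω : Set E} {u : E → ℝ} (hu : Sol r e μ Ω u) : ContDiffOn ℝ 1 (Wf u) Ω := by
  unfold Wf
  refine ContDiffOn.sqrt (contDiffOn_const.add ((grad_c1 hu).norm_sq ℝ)) (fun x _ => by positivity)
theorem zf_c1 {r e : E} {μ : ℝ} {Ω : Set E} {u : E → ℝ} (hu : Sol r e μ Ω u) : ContDiffOn ℝ 1 (zf r u) Ω := by
  unfold zf
  exact (hu.c1.sub (innerSL ℝ r).contDiff.contDiffOn).div_const _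
theorem tf_c1 (e : E) (Ω : Set E) : ContDiffOn ℝ 1 (fun x : E => inner ℝ e x) Ω := (innerSL ℝ e).contDiff.contDiffOn
theorem kg_c1 {r e : E} {μ : ℝ} {Ω : Set E} {u : E → ℝ} (hu : Sol r e μ Ω u) : ContDiffOn ℝ 1 (kg r e u) Ω := by
  unfold kg
  refine (((tf_c1 e Ω).div_const _).mul (contDiffOn_const.add ?_)).add ((zf_c1 hu).mul ?_)
  · exact (innerSL ℝ r).contDiff.comp_contDiffOn (grad_c1 hu)
  · exact (innerSL ℝ e).contDiff.comp_contDiffOn (grad_c1 hu)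

theorem int_piece {Ω K : Set E} (hΩ : IsOpen Ω) (hK : IsCompact K) (hKΩ : K ⊆ Ω) {Y : E → E} (hY : ContinuousOn Y Ω)
    {g : E → ℝ} (hg : ContDiffOn ℝ 1 g Ω) (h0 : ∀ x ∈ Ω, x ∉ K → g x = 0) : IntegrableOn (fun x => fderiv ℝ g x (Y x)) Ω := by
  refine integrableOn_of_K hΩ hK hKΩ ((hg.continuousOn_fderiv_of_isOpen hΩ (by norm_num)).clm_apply hY) (fun x hx hxK => ?_)
  have : g =ᶠ[𝓝 x] fun _ => 0 := by
    filter_upwards [(hΩ.sdiff hK.isClosed).mem_nhds ⟨hx, hxK⟩] with y hy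
    exact h0 y hy.1 hy.2
  rw [this.fderiv_eq]; simp

theorem killing_int {r e : E} {μ : ℝ} {Ω K : Set E} {u : E → ℝ} (hu : Sol r e μ Ω u) (hK : IsCompact K) (hKΩ : K ⊆ Ω)
    {ψ : E → ℝ} (hψ : ContDiffOn ℝ 1 ψ Ω) (h0 : ∀ x ∈ Ω, x ∉ K → ψ x = 0) : ∫ x in Ω, fderiv ℝ ψ x (Zk r e u x) = 0 := by
  have c1 := hψ.mul (kg_c1 hu)
  have c2 := hψ.mul ((Wf_c1 hu).mul (zf_c1 hu))
  have c3 := hψ.mul ((Wf_c1 hu).mul ((tf_c1 e Ω).div_const (kap r)))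
  have z1 : ∀ f : E → ℝ, ∀ x ∈ Ω, x ∉ K → ψ x * f x = 0 := fun f x hx hxK => by rw [h0 x hx hxK, zero_mul]
  have i1 := weak_test hu.isOpen hK hKΩ hu.weak c1 (z1 _)
  have i2 := weak_test hu.isOpen hK hKΩ (weakDF_const Ω e) c2 (z1 _)
  have i3 := weak_test hu.isOpen hK hKΩ (weakDF_const Ω r) c3 (z1 _)
  have j1 := int_piece hu.isOpen hK hKΩ (cont_Ff hu.isOpen hu.c1) c1 (z1 _)
  have j2 := int_piece hu.isOpen hK hKΩ (Y := fun _ => e) continuousOn_const c2 (z1 _)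
  have j3 := int_piece hu.isOpen hK hKΩ (Y := fun _ => r) continuousOn_const c3 (z1 _)
  have h := integral_sub (j1.sub j2) j3
  have h' := integral_sub j1 j2
  simp only [Pi.sub_apply] at h h'
  rw [h', i1, i2, i3] at h
  rw [sub_zero, sub_zero] at h
  rw [← h]
  refine setIntegral_congr_fun hu.isOpen.measurableSet (fun x hx => ?_)
  obtain ⟨H, hH, hs⟩ := hess hu hx
  exact (killing_alg hH hs (hu.diff hx) hu.re ((hψ.contDiffAt (hu.isOpen.mem_nhds hx)).differentiableAt (by norm_num))).symm
end Bern

namespace Bern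
open MeasureTheory Filter Topology InnerProductSpace

variable {E : Type*} [NormedAddCommGroup E] [InnerProductSpace ℝ E] [FiniteDimensional ℝ E]
  [MeasurableSpace E] [BorelSpace E]


noncomputable def Th (r e : E) (μ : ℝ) (u : E → ℝ) (x : E) : ℝ := Real.arctan (zf r u x / inner ℝ e x) - Real.arctan (μ / kap r)

theorem zf_eq (r : E) (u : E → ℝ) (x : E) : zL r (x, u x) = zf r u x := zL_apply _ _ _

theorem kg_eq {r e : E} {u : E → ℝ} {x : E} (h : 0 < inner ℝ e x) : kg r e u x = rho r e (x, u x) * Sg r e (x, u x) (gradient u x) := by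
  have hρ := rho_pos (r := r) (e := e) (p := (x, u x)) (by rw [tL_apply]; exact h)
  rw [kg, Sg, tL_apply, zf_eq]; field_simp

section
variable {r e : E} {u : E → ℝ} {x : E}
theorem pZ (he : ‖e‖ = 1) (hre : inner ℝ r e = 0) :
    inner ℝ (gradient u x) (Zk r e u x) = Wf u x * (inner ℝ e x / kap r) - kg r e u x / Wf u x := by
  have hW := Wf_pos u x
  have hW2 := Wf_sq u x
  have hk := kap_pos r
  have e3 : ‖gradient u x‖ ^ 2 = Wf u x ^ 2 - 1 := by linarith
  have e4 : kg r e u x = inner ℝ e x / kap r * (1 + inner ℝ r (gradient u x)) + zf r u x * inner ℝ e (gradient u x) := rfl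
  rw [Zk, Ff, inner_sub_right, inner_sub_right, inner_smul_right, inner_smul_right, inner_smul_right, inner_smul_right, real_inner_self_eq_norm_sq, e3,
    real_inner_comm e, real_inner_comm r]
  field_simp
  have e5 : kg r e u x * kap r = inner ℝ e x * (1 + inner ℝ r (gradient u x)) + zf r u x * inner ℝ e (gradient u x) * kap r := by
    rw [e4]; field_simp
  linear_combination Wf u x ^ 2 * e5
theorem eZ (he : ‖e‖ = 1) (hre : inner ℝ r e = 0) :
    inner ℝ e (Zk r e u x) = kg r e u x * inner ℝ e (gradient u x) / Wf u x - Wf u x * zf r u x := by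
  rw [Zk, Ff, inner_sub_right, inner_sub_right, inner_smul_right, inner_smul_right, inner_smul_right, inner_smul_right, real_inner_self_eq_norm_sq, he,
    real_inner_comm r e, hre]
  ring
theorem rZ (he : ‖e‖ = 1) (hre : inner ℝ r e = 0) :
    inner ℝ r (Zk r e u x) = kg r e u x * inner ℝ r (gradient u x) / Wf u x - Wf u x * (inner ℝ e x / kap r) * (kap r ^ 2 - 1) := by
  rw [Zk, Ff, inner_sub_right, inner_sub_right, inner_smul_right, inner_smul_right, inner_smul_right, inner_smul_right, real_inner_self_eq_norm_sq, hre, kap_sq]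
  ring
theorem xZ : inner ℝ x (Zk r e u x) = kg r e u x * inner ℝ x (gradient u x) / Wf u x - Wf u x * zf r u x * inner ℝ e x
      - Wf u x * (inner ℝ e x / kap r) * inner ℝ r x := by
  rw [Zk, Ff, inner_sub_right, inner_sub_right, inner_smul_right, inner_smul_right, inner_smul_right, inner_smul_right, real_inner_comm e x, real_inner_comm r x]
  ring

theorem pr_Z (he : ‖e‖ = 1) (hre : inner ℝ r e = 0) : inner ℝ (gradient u x) (Zk r e u x) - inner ℝ r (Zk r e u x) =
    kap r * Wf u x * inner ℝ e x - kg r e u x * (1 + inner ℝ r (gradient u x)) / Wf u x := by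
  rw [pZ he hre, rZ he hre]
  have := kap_pos r
  have := Wf_pos u x
  field_simp; ring

theorem Th_deriv {μ : ℝ} (he : ‖e‖ = 1) (hre : inner ℝ r e = 0) (hd : DifferentiableAt ℝ u x) (ht : 0 < inner ℝ e x) :
    ∃ L : E →L[ℝ] ℝ, HasFDerivAt (Th r e μ u) L x ∧ L (Zk r e u x) = Wf u x - Sg r e (x, u x) (gradient u x) ^ 2 / Wf u x := by
  have h1 : HasFDerivAt (fun x => inner ℝ e x) (innerSL ℝ e) x := (innerSL ℝ e).hasFDerivAt
  have h2 := (z_deriv (r := r) hd).fun_mul ((hasDerivAt_inv ht.ne').comp_hasFDerivAt x h1)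
  have h3 := ((Real.hasDerivAt_arctan _).comp_hasFDerivAt x h2).sub_const (Real.arctan (μ / kap r))
  simp only [Function.comp_def, ← div_eq_mul_inv] at h3
  refine ⟨_, h3, ?_⟩
  have hρ := rho_pos (r := r) (e := e) (p := (x, u x)) (by rw [tL_apply]; exact ht)
  have hρ2 := rho_sq r e (x, u x)
  rw [tL_apply, zf_eq] at hρ2
  have hk := kap_pos r
  have hW := Wf_pos u x
  have e1 : Sg r e (x, u x) (gradient u x) = kg r e u x / rho r e (x, u x) := by rw [kg_eq ht]; field_simp
  have e4 : kg r e u x = inner ℝ e x / kap r * (1 + inner ℝ r (gradient u x)) + zf r u x * inner ℝ e (gradient u x) := rfl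
  rw [e1, div_pow (kg r e u x), hρ2]
  have e6 : inner ℝ (gradient u x) (Zk r e u x) = inner ℝ r (Zk r e u x) + (kap r * Wf u x * inner ℝ e x - kg r e u x * (1 + inner ℝ r (gradient u x)) / Wf u x) := by
    rw [← pr_Z he hre]; ring
  simp only [ContinuousLinearMap.smul_apply, ContinuousLinearMap.add_apply, ContinuousLinearMap.sub_apply, innerSL_apply_apply, smul_eq_mul]
  rw [e6, eZ he hre]
  have hpos : 0 < inner ℝ e x ^ 2 + zf r u x ^ 2 := by positivity
  have e7 : inner ℝ r (gradient u x) = kap r / inner ℝ e x * (kg r e u x - zf r u x * inner ℝ e (gradient u x)) - 1 := by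
    rw [e4]; field_simp; ring
  rw [e7]
  generalize kg r e u x = g at *
  generalize zf r u x = z at *
  generalize inner ℝ e (gradient u x) = a at *
  generalize inner ℝ e x = t at *
  generalize inner ℝ r (Zk r e u x) = b at *
  generalize Wf u x = W at *
  generalize kap r = k at *
  have h8 : 1 + (z / t) ^ 2 = (t ^ 2 + z ^ 2) / t ^ 2 := by field_simp
  rw [h8]
  field_simp
  ring

theorem ph_Z (hd : DifferentiableAt ℝ u x) (he : ‖e‖ = 1) (hre : inner ℝ r e = 0) :
    HasFDerivAt (fun x => ph (x, u x)) ((fderiv ℝ ph (x, u x)).comp ((ContinuousLinearMap.id ℝ E).prod (fderiv ℝ u x))) x ∧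
    ((fderiv ℝ ph (x, u x)).comp ((ContinuousLinearMap.id ℝ E).prod (fderiv ℝ u x))) (Zk r e u x) = 2 * dph (x, u x) * kg r e u x * gf u x / Wf u x := by
  constructor
  · have h1 : HasFDerivAt (fun x => (x, u x)) ((ContinuousLinearMap.id ℝ E).prod (fderiv ℝ u x)) x := (hasFDerivAt_id x).prodMk hd.hasFDerivAt
    exact ((ph_contDiff (E := E)).differentiable (by norm_num) (x, u x)).hasFDerivAt.comp x h1
  · have e0 : ((fderiv ℝ ph (x, u x)).comp ((ContinuousLinearMap.id ℝ E).prod (fderiv ℝ u x))) (Zk r e u x) =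
      fderiv ℝ ph (x, u x) (Zk r e u x, fderiv ℝ u x (Zk r e u x)) := rfl
    rw [e0, ph_deriv, fderiv_eq_inner, pZ he hre]
    simp only
    rw [xZ, gf]
    have hk := kap_pos r
    have hW := Wf_pos u x
    have e2 : u x = kap r * zf r u x + inner ℝ r x := by rw [zf]; field_simp; ring
    rw [e2]
    field_simp
    ring

theorem w_Z {μ : ℝ} (hd : DifferentiableAt ℝ u x) (he : ‖e‖ = 1) (hre : inner ℝ r e = 0) (ht : 0 < inner ℝ e x) :
    ∃ L : E →L[ℝ] ℝ, HasFDerivAt (fun x => u x - inner ℝ (r + μ • e) x) L x ∧ |L (Zk r e u x)| ≤ 2 * (kap r + |μ|) * (rho r e (x, u x) * Wf u x) := by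
  refine ⟨_, hd.hasFDerivAt.sub (innerSL ℝ (r + μ • e)).hasFDerivAt, ?_⟩
  have hk := kap_pos r
  have hW := Wf_pos u x
  have e1 : (fderiv ℝ u x - innerSL ℝ (r + μ • e)) (Zk r e u x) = (inner ℝ (gradient u x) (Zk r e u x) - inner ℝ r (Zk r e u x)) - μ * inner ℝ e (Zk r e u x) := by
    rw [ContinuousLinearMap.sub_apply, fderiv_eq_inner, innerSL_apply_apply, inner_add_left, inner_smul_left]; simp; ring
  rw [e1, pr_Z he hre, eZ he hre]
  have hρ := rho_pos (r := r) (e := e) (p := (x, u x)) (by rw [tL_apply]; exact ht)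
  have b1 := abs_t_le r e (x, u x)
  have b2 := abs_z_le r e (x, u x)
  rw [tL_apply] at b1; rw [zf_eq] at b2
  have b3 : |kg r e u x| ≤ rho r e (x, u x) * Wf u x := by
    rw [kg_eq ht, abs_mul, abs_of_pos hρ]
    exact mul_le_mul_of_nonneg_left (abs_Sg_le he hre (by rw [tL_apply]; exact ht) _) hρ.le
  have b4 : |1 + inner ℝ r (gradient u x)| ≤ kap r * Wf u x := abs_one_add_inner_le _ _
  have b5 : |inner ℝ e (gradient u x)| ≤ Wf u x := by
    refine (abs_real_inner_le_norm _ _).trans ?_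
    rw [he, one_mul]; exact norm_grad_le u x
  have c1 : |kap r * Wf u x * inner ℝ e x| ≤ kap r * (rho r e (x, u x) * Wf u x) := by
    rw [abs_mul, abs_mul, abs_of_pos hk, abs_of_pos hW, mul_assoc, mul_comm (Wf u x)]
    gcongr
  have c2 : |kg r e u x * (1 + inner ℝ r (gradient u x)) / Wf u x| ≤ kap r * (rho r e (x, u x) * Wf u x) := by
    rw [abs_div, abs_of_pos hW, div_le_iff₀ hW, abs_mul]
    calc _ ≤ rho r e (x, u x) * Wf u x * (kap r * Wf u x) := by gcongr
      _ = _ := by ring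
  have c3 : |kg r e u x * inner ℝ e (gradient u x) / Wf u x| ≤ rho r e (x, u x) * Wf u x := by
    rw [abs_div, abs_of_pos hW, div_le_iff₀ hW, abs_mul]
    gcongr
  have c4 : |Wf u x * zf r u x| ≤ rho r e (x, u x) * Wf u x := by
    rw [abs_mul, abs_of_pos hW, mul_comm]; gcongr
  have d1 := abs_sub (kap r * Wf u x * inner ℝ e x) (kg r e u x * (1 + inner ℝ r (gradient u x)) / Wf u x)
  have d2 := abs_sub (kg r e u x * inner ℝ e (gradient u x) / Wf u x) (Wf u x * zf r u x)
  refine (abs_sub _ _).trans ?_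
  rw [abs_mul]
  have d3 : |μ| * |kg r e u x * inner ℝ e (gradient u x) / Wf u x - Wf u x * zf r u x| ≤ |μ| * (2 * (rho r e (x, u x) * Wf u x)) := by
    gcongr; linarith
  nlinarith

theorem Th_rho {μ : ℝ} (ht : 0 < inner ℝ e x) (hre : inner ℝ r e = 0) :
    |Th r e μ u x| * rho r e (x, u x) ≤ (1 + |μ| + Real.pi) * |u x - inner ℝ (r + μ • e) x| := by
  set f := zf r u x / inner ℝ e x with hf
  set m := μ / kap r with hm
  have hk := kap_pos r
  have hk1 := one_le_kap r
  have ez : zf r u x = f * inner ℝ e x := by rw [hf]; field_simp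
  have ew : u x - inner ℝ (r + μ • e) x = kap r * inner ℝ e x * (f - m) := by
    rw [inner_add_left, inner_smul_left, hf, hm, zf]; simp; field_simp; ring
  have h1 : rho r e (x, u x) ≤ inner ℝ e x * (1 + |m| + |f - m|) := by
    have : rho r e (x, u x) ≤ inner ℝ e x * (1 + |f|) := by
      apply Real.sqrt_le_iff.2
      constructor
      · positivity
      · rw [tL_apply, zf_eq, ez]
        have := sq_abs f
        have h0 := abs_nonneg f
        nlinarith [mul_nonneg (sq_nonneg (inner ℝ e x)) h0]
    have h3 : |f| ≤ |m| + |f - m| := by have := abs_add_le m (f - m); simpa using this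
    nlinarith
  have h2 : |Th r e μ u x| ≤ |f - m| := arctan_lip _ _
  have h3 : |Th r e μ u x| ≤ Real.pi := by
    have a1 := Real.arctan_lt_pi_div_two f
    have a2 := Real.neg_pi_div_two_lt_arctan f
    have a3 := Real.arctan_lt_pi_div_two m
    have a4 := Real.neg_pi_div_two_lt_arctan m
    rw [show Th r e μ u x = Real.arctan f - Real.arctan m from rfl, abs_le]
    constructor <;> linarith
  have h4 : |m| ≤ |μ| := by
    rw [hm, abs_div, abs_of_pos hk]; exact div_le_self (abs_nonneg _) hk1
  rw [ew, abs_mul, abs_mul, abs_of_pos hk, abs_of_pos ht]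
  have hT := abs_nonneg (Th r e μ u x)
  have hfm := abs_nonneg (f - m)
  have hpi := Real.pi_pos
  calc |Th r e μ u x| * rho r e (x, u x) ≤ |Th r e μ u x| * (inner ℝ e x * (1 + |m| + |f - m|)) := by gcongr
    _ = inner ℝ e x * (|Th r e μ u x| * (1 + |m|) + |Th r e μ u x| * |f - m|) := by ring
    _ ≤ inner ℝ e x * (|f - m| * (1 + |μ|) + Real.pi * |f - m|) := by gcongr
    _ = 1 * (inner ℝ e x * ((1 + |μ| + Real.pi) * |f - m|)) := by ring
    _ ≤ kap r * (inner ℝ e x * ((1 + |μ| + Real.pi) * |f - m|)) := by gcongr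
    _ = _ := by ring
end
end Bern

namespace Bern
open MeasureTheory Filter Topology InnerProductSpace

variable {E : Type*} [NormedAddCommGroup E] [InnerProductSpace ℝ E] [FiniteDimensional ℝ E]
  [MeasurableSpace E] [BorelSpace E]


noncomputable def En (r e : E) (u : E → ℝ) (x : E) : ℝ := ph (x, u x) * (Wf u x - Sg r e (x, u x) (gradient u x) ^ 2 / Wf u x)
noncomputable def Rn (r e : E) (μ : ℝ) (u : E → ℝ) (x : E) : ℝ := Th r e μ u x * (2 * dph (x, u x) * kg r e u x * gf u x / Wf u x)

theorem one_sub_sq {r e : E} {μ : ℝ} {Ω : Set E} {u : E → ℝ} (hu : Sol r e μ Ω u) {x : E} (hx : x ∈ Ω) :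
    0 ≤ Wf u x - Sg r e (x, u x) (gradient u x) ^ 2 / Wf u x ∧ Wf u x - Sg r e (x, u x) (gradient u x) ^ 2 / Wf u x ≤ Wf u x := by
  have hW := Wf_pos u x
  have h := S_le hu hx
  constructor
  · rw [sub_nonneg, div_le_iff₀ hW, ← sq_abs, sq]
    exact mul_le_mul h h (abs_nonneg _) hW.le
  · have : 0 ≤ Sg r e (x, u x) (gradient u x) ^ 2 / Wf u x := by positivity
    linarith

theorem Rn_bound (r e : E) (μ : ℝ) : ∃ C : ℝ, 0 ≤ C ∧ ∀ (Ω : Set E) (u : E → ℝ), Sol r e μ Ω u → ∀ x ∈ Ω, |Rn r e μ u x| ≤ C * (2 * dph (x, u x) * |gf u x|) := by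
  refine ⟨(1 + |μ| + Real.pi) * (2 + ‖r + μ • e‖ * 2), by have := Real.pi_pos; positivity, fun Ω u hu x hx => ?_⟩
  have ht := hu.pos x hx
  have hpi := Real.pi_pos
  rcases lt_or_ge (‖x‖ ^ 2 + u x ^ 2) 2 with hσ | hσ
  · have hx2 : ‖x‖ ≤ 2 := by nlinarith [sq_nonneg (u x), norm_nonneg x]
    have hu2 : |u x| ≤ 2 := by apply abs_le_of_sq_le_sq <;> nlinarith [sq_nonneg ‖x‖]
    have hw : |u x - inner ℝ (r + μ • e) x| ≤ 2 + ‖r + μ • e‖ * 2 := by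
      refine (abs_sub _ _).trans (add_le_add hu2 ((abs_real_inner_le_norm _ _).trans ?_))
      gcongr
    have hTr := Th_rho (u := u) (μ := μ) ht hu.re
    have hW := Wf_pos u x
    have hS := S_le hu hx
    have hρ := rho_pos (r := r) (e := e) (p := (x, u x)) (by rw [tL_apply]; exact ht)
    have hd := dph_nonneg (x, u x)
    have e1 : |Rn r e μ u x| = (|Th r e μ u x| * rho r e (x, u x)) * (2 * dph (x, u x) * |gf u x|) * (|Sg r e (x, u x) (gradient u x)| / Wf u x) := by
      rw [Rn, kg_eq ht, abs_mul, abs_div, abs_mul, abs_mul, abs_mul, abs_mul, abs_of_pos hW, abs_of_pos hρ, abs_of_nonneg hd]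
      rw [abs_of_pos (show (0:ℝ) < 2 by norm_num)]; ring
    have h1 : |Sg r e (x, u x) (gradient u x)| / Wf u x ≤ 1 := by rw [div_le_one hW]; exact hS
    rw [e1]
    refine (mul_le_of_le_one_right (by positivity) h1).trans ?_
    refine mul_le_mul_of_nonneg_right ?_ (by positivity)
    refine hTr.trans ?_
    gcongr
  · rw [Rn, dph_zero hσ]; simp

theorem Zk_cont {r e : E} {μ : ℝ} {Ω : Set E} {u : E → ℝ} (hu : Sol r e μ Ω u) : ContinuousOn (Zk r e u) Ω := by
  have h1 := (kg_c1 hu).continuousOn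
  have h2 := (zf_c1 hu).continuousOn
  have h3 := cont_Wf hu.isOpen hu.c1
  have h4 := cont_Ff hu.isOpen hu.c1
  unfold Zk
  exact ((h1.smul h4).sub ((h3.mul h2).smul continuousOn_const)).sub ((h3.mul (ContinuousOn.div_const (by fun_prop) _)).smul continuousOn_const)

theorem Th_c1 {r e : E} {μ : ℝ} {Ω : Set E} {u : E → ℝ} (hu : Sol r e μ Ω u) : ContDiffOn ℝ 1 (Th r e μ u) Ω := by
  unfold Th
  exact (Real.contDiff_arctan.comp_contDiffOn ((zf_c1 hu).div (tf_c1 e Ω) (fun x hx => (hu.pos x hx).ne'))).sub contDiffOn_const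

theorem phu_c1 {r e : E} {μ : ℝ} {Ω : Set E} {u : E → ℝ} (hu : Sol r e μ Ω u) : ContDiffOn ℝ 1 (fun x => ph (x, u x)) Ω :=
  (ph_contDiff.of_le (by norm_num)).comp_contDiffOn (contDiffOn_id.prodMk hu.c1)

theorem energy_eq {r e : E} {μ : ℝ} {Ω : Set E} {u : E → ℝ} (hu : Sol r e μ Ω u) :
    ∫ x in Ω, (En r e u x + Rn r e μ u x) = 0 := by
  set w : E → ℝ := fun x => u x - inner ℝ (r + μ • e) x with hw
  set ψ : ℕ → E → ℝ := fun k x => chi (((k:ℝ) + 1) * w x) * (Th r e μ u x * ph (x, u x)) with hψ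
  set K : ℕ → Set E := fun k => {x | x ∈ closure Ω ∧ ((k:ℝ) + 1)⁻¹ ≤ |w x|} ∩ closedBall 0 2 with hK
  have hwc : ContinuousOn w (closure Ω) := hu.cont.sub (by fun_prop)
  have hKc := fun k : ℕ => compactK hu.isOpen hwc (fun x hx => by rw [hw]; simp only; rw [hu.bdry x hx, sub_self]) (δ := ((k:ℝ) + 1)⁻¹) (R := 2) (by positivity)
  have hw1 : ContDiffOn ℝ 1 w Ω := hu.c1.sub (innerSL ℝ (r + μ • e)).contDiff.contDiffOn
  have hψ1 : ∀ k, ContDiffOn ℝ 1 (ψ k) Ω := fun k =>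
    ((chi_contDiff.of_le (by norm_num)).comp_contDiffOn (contDiffOn_const.mul hw1)).mul ((Th_c1 hu).mul (phu_c1 hu))
  have hψ0 : ∀ k, ∀ x ∈ Ω, x ∉ K k → ψ k x = 0 := by
    intro k x hx hxK
    by_cases hx2 : ‖x‖ ≤ 2
    · have : |w x| < ((k:ℝ) + 1)⁻¹ := by
        by_contra hcon
        exact hxK ⟨⟨subset_closure hx, not_lt.1 hcon⟩, by simpa using hx2⟩
      have h1 : chi (((k:ℝ) + 1) * w x) = 0 := by
        apply chi_zero
        rw [abs_mul, abs_of_pos (by positivity : (0:ℝ) < (k:ℝ) + 1)]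
        rw [← one_div, lt_div_iff₀ (by positivity), mul_comm] at this
        exact this.le
      rw [hψ]; simp only; rw [h1, zero_mul]
    · rw [hψ]; simp only; rw [ph_R (by linarith)]; simp
  have hI := fun k => killing_int hu (hKc k).1 (hKc k).2 (hψ1 k) (hψ0 k)
  obtain ⟨Cχ, hCχ0, hCχ⟩ := chi_bound
  obtain ⟨Cd, hCd0, hCd⟩ := dph_bound (E := E)
  obtain ⟨C2, hC20, hC2⟩ := Rn_bound r e μ
  have hpi := Real.pi_pos
  have hk := kap_pos r
  set C1 := 2 * (kap r + |μ|) * (1 + |μ| + Real.pi) * Cχ with hC1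
  have hC10 : 0 ≤ C1 := by positivity
  -- the derivative
  have hD : ∀ k : ℕ, ∀ x ∈ Ω, ∃ A : ℝ, |A| ≤ 2 * (kap r + |μ|) * (rho r e (x, u x) * Wf u x) ∧
      fderiv ℝ (ψ k) x (Zk r e u x) = deriv chi (((k:ℝ) + 1) * w x) * (((k:ℝ) + 1) * A) * (Th r e μ u x * ph (x, u x))
        + chi (((k:ℝ) + 1) * w x) * (En r e u x + Rn r e μ u x) := by
    intro k x hx
    obtain ⟨L, hL, hL2⟩ := w_Z (r := r) (μ := μ) (hu.diff hx) hu.norm_e hu.re (hu.pos x hx)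
    obtain ⟨L', hL', hL2'⟩ := Th_deriv (μ := μ) hu.norm_e hu.re (hu.diff hx) (hu.pos x hx)
    obtain ⟨h1, h2⟩ := ph_Z (hu.diff hx) hu.norm_e hu.re
    refine ⟨_, hL2, ?_⟩
    have h3 := (hasFDerivAt_chi (hL.const_mul ((k:ℝ) + 1))).fun_mul (hL'.fun_mul h1)
    have h4 : fderiv ℝ (ψ k) x = _ := h3.fderiv
    rw [h4]
    simp only [ContinuousLinearMap.add_apply, ContinuousLinearMap.smul_apply, smul_eq_mul]
    rw [h2, hL2', En, Rn]
    ring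
  have key : Tendsto (fun k : ℕ => ∫ x in Ω, fderiv ℝ (ψ k) x (Zk r e u x)) atTop (𝓝 (∫ x in Ω, (En r e u x + Rn r e μ u x))) := by
    refine tendsto_integral_of_dominated_convergence ((Ω ∩ ball (0:E) 2).indicator (fun x => (C1 + 1 + C2 * (2 * Cd * 4)) * Wf u x)) (fun k => ?_) ?_ (fun k => ?_) ?_
    · exact (int_piece hu.isOpen (hKc k).1 (hKc k).2 (Zk_cont hu) (hψ1 k) (hψ0 k)).aestronglyMeasurable
    · exact ((integrable_indicator_iff (hu.isOpen.measurableSet.inter measurableSet_ball)).2 ((hu.int_W _).const_mul _)).integrableOn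
    · filter_upwards [ae_restrict_mem hu.isOpen.measurableSet] with x hx
      obtain ⟨A, hA, hA2⟩ := hD k x hx
      rw [hA2]
      by_cases hx2 : x ∈ ball (0:E) 2
      · rw [indicator_of_mem (show x ∈ Ω ∩ ball (0:E) 2 from ⟨hx, hx2⟩), Real.norm_eq_abs]
        have ht := hu.pos x hx
        have hW := Wf_pos u x
        have hρ := rho_pos (r := r) (e := e) (p := (x, u x)) (by rw [tL_apply]; exact ht)
        have b1 : |deriv chi (((k:ℝ) + 1) * w x) * (((k:ℝ) + 1) * A) * (Th r e μ u x * ph (x, u x))| ≤ C1 * Wf u x := by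
          have hTr := Th_rho (u := u) (μ := μ) ht hu.re
          have hc := hCχ (((k:ℝ) + 1) * w x)
          rw [abs_mul, abs_mul, abs_of_pos (by positivity : (0:ℝ) < (k:ℝ) + 1)] at hc
          rw [abs_mul, abs_mul, abs_mul, abs_mul, abs_of_pos (by positivity : (0:ℝ) < (k:ℝ) + 1), abs_of_nonneg (ph_nonneg _)]
          calc _ ≤ |deriv chi (((k:ℝ) + 1) * w x)| * (((k:ℝ) + 1) * (2 * (kap r + |μ|) * (rho r e (x, u x) * Wf u x))) * (|Th r e μ u x| * 1) := by
                have hp1 := ph_le_one (x, u x)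
                have hp0 := ph_nonneg (x, u x)
                gcongr
            _ = 2 * (kap r + |μ|) * Wf u x * (|deriv chi (((k:ℝ) + 1) * w x)| * ((k:ℝ) + 1)) * (|Th r e μ u x| * rho r e (x, u x)) := by ring
            _ ≤ 2 * (kap r + |μ|) * Wf u x * (|deriv chi (((k:ℝ) + 1) * w x)| * ((k:ℝ) + 1)) * ((1 + |μ| + Real.pi) * |w x|) := by gcongr
            _ = 2 * (kap r + |μ|) * Wf u x * (1 + |μ| + Real.pi) * (|deriv chi (((k:ℝ) + 1) * w x)| * (((k:ℝ) + 1) * |w x|)) := by ring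
            _ ≤ 2 * (kap r + |μ|) * Wf u x * (1 + |μ| + Real.pi) * Cχ := by gcongr
            _ = C1 * Wf u x := by rw [hC1]; ring
        have b2 : |En r e u x| ≤ Wf u x := by
          obtain ⟨q1, q2⟩ := one_sub_sq hu hx
          rw [En, abs_of_nonneg (mul_nonneg (ph_nonneg _) q1)]
          exact (mul_le_of_le_one_left q1 (ph_le_one _)).trans q2
        have b3 : |Rn r e μ u x| ≤ C2 * (2 * Cd * 4) * Wf u x := by
          refine (hC2 Ω u hu x hx).trans ?_
          rw [mul_assoc C2]
          refine mul_le_mul_of_nonneg_left ?_ hC20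
          rcases lt_or_ge (‖x‖ ^ 2 + u x ^ 2) 2 with hσ | hσ
          · have hxx : ‖x‖ ≤ 2 := by nlinarith [sq_nonneg (u x), norm_nonneg x]
            have hu2 : |u x| ≤ 2 := by apply abs_le_of_sq_le_sq <;> nlinarith [sq_nonneg ‖x‖]
            have := gf_le hu2 hxx
            have h0 := dph_nonneg (x, u x)
            calc 2 * dph (x, u x) * |gf u x| ≤ 2 * Cd * ((2 + 2) * Wf u x) := by gcongr; exact hCd _
              _ = _ := by ring
          · rw [dph_zero hσ]; simp only [mul_zero, zero_mul]; positivity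
        have hc1 := chi_le_one (((k:ℝ) + 1) * w x)
        have hc0 := chi_nonneg (((k:ℝ) + 1) * w x)
        refine (abs_add_le _ _).trans ?_
        have b4 : |chi (((k:ℝ) + 1) * w x) * (En r e u x + Rn r e μ u x)| ≤ Wf u x + C2 * (2 * Cd * 4) * Wf u x := by
          rw [abs_mul, abs_of_nonneg hc0]
          refine (mul_le_of_le_one_left (abs_nonneg _) hc1).trans ((abs_add_le _ _).trans (add_le_add b2 b3))
        linarith
      · have hx3 : 2 ≤ ‖x‖ := by simpa using hx2
        rw [indicator_of_notMem (show x ∉ Ω ∩ ball (0:E) 2 from fun h => hx2 h.2), En, Rn, ph_R hx3, dph_R hx3]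
        simp
    · filter_upwards [ae_restrict_mem hu.isOpen.measurableSet, hu.contact] with x hx hct
      have ht := hu.pos x hx
      have hk' := hk.ne'
      by_cases hwx : w x = 0
      · have hux : u x = inner ℝ (r + μ • e) x := by have := hwx; rw [hw] at this; simp only at this; linarith
        have hg := hct hwx
        have h1 : En r e u x + Rn r e μ u x = 0 := by
          have e1 : Th r e μ u x = 0 := by
            have : zf r u x / inner ℝ e x = μ / kap r := by
              rw [zf, hux, inner_add_left, inner_smul_left]; simp; field_simp
            rw [Th, this, sub_self]
          have e2 : Sg r e (x, u x) (gradient u x) = Wf u x := by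
            rw [hux, hg, Sg_plane hu.norm_e hu.re ht, W0f, Wf, hg]
          have hW := Wf_pos u x
          rw [En, Rn, e1, e2]; field_simp; simp
        rw [h1]
        refine tendsto_const_nhds.congr (fun k => ?_)
        obtain ⟨A, hA, hA2⟩ := hD k x hx
        rw [hA2, hwx, mul_zero, chi_deriv_zero' (by simp), h1]; simp
      · obtain ⟨k0, hk0⟩ := exists_nat_gt (2 / |w x|)
        refine tendsto_const_nhds.congr' ?_
        filter_upwards [eventually_ge_atTop k0] with k hkk
        obtain ⟨A, hA, hA2⟩ := hD k x hx
        have hτ : 2 < |((k:ℝ) + 1) * w x| := by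
          rw [div_lt_iff₀ (abs_pos.2 hwx)] at hk0
          rw [abs_mul, abs_of_pos (by positivity : (0:ℝ) < (k:ℝ) + 1)]
          have : (k0:ℝ) ≤ k := by exact_mod_cast hkk
          nlinarith [abs_pos.2 hwx]
        rw [hA2, chi_deriv_zero hτ, chi_one hτ.le]; ring
  exact tendsto_nhds_unique (tendsto_const_nhds.congr (fun k => (hI k).symm)) key |>.symm

theorem int_En {r e : E} {μ : ℝ} {Ω : Set E} {u : E → ℝ} (hu : Sol r e μ Ω u) : IntegrableOn (En r e u) Ω := by
  have cW := cont_Wf hu.isOpen hu.c1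
  refine int_of_bound hu.isOpen (R := 2) (g := Wf u) ?_ (hu.int_W 2) (fun x hx => ?_) (fun x hx h => by simp [En, ph_R h])
  · unfold En
    exact (phu_c1 hu).continuousOn.mul (cW.sub (((cont_S hu).pow 2).div cW (fun x _ => (Wf_pos u x).ne')))
  · obtain ⟨q1, q2⟩ := one_sub_sq hu hx
    rw [En, abs_of_nonneg (mul_nonneg (ph_nonneg _) q1)]
    exact (mul_le_of_le_one_left q1 (ph_le_one _)).trans q2

theorem cont_dphu {r e : E} {μ : ℝ} {Ω : Set E} {u : E → ℝ} (hu : Sol r e μ Ω u) : ContinuousOn (fun x => dph (x, u x)) Ω :=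
  cont_pair (cont_uΩ hu) dph_cont

theorem int_dphW {r e : E} {μ : ℝ} {Ω : Set E} {u : E → ℝ} (hu : Sol r e μ Ω u) : IntegrableOn (fun x => dph (x, u x) * Wf u x) Ω := by
  obtain ⟨Cd, hCd0, hCd⟩ := dph_bound (E := E)
  refine int_of_bound hu.isOpen (R := 2) (g := fun x => Cd * Wf u x) ((cont_dphu hu).mul (cont_Wf hu.isOpen hu.c1)) ((hu.int_W 2).const_mul _) (fun x hx => ?_) (fun x hx h => by rw [dph_R h, zero_mul])
  have := Wf_pos u x
  rw [abs_of_nonneg (mul_nonneg (dph_nonneg _) this.le)]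
  gcongr; exact hCd _

theorem int_dgf {r e : E} {μ : ℝ} {Ω : Set E} {u : E → ℝ} (hu : Sol r e μ Ω u) {A : ℝ} (hA : 0 < A) {x : E} :
    2 * dph (x, u x) * |gf u x| ≤ A * Qd u x + A⁻¹ * (dph (x, u x) * Wf u x) := by
  have hW := Wf_pos u x
  have hd := dph_nonneg (x, u x)
  have h1 : 2 * |gf u x| ≤ A * (2 * gf u x ^ 2 / Wf u x) + A⁻¹ * Wf u x := by
    have e1 : A * (2 * gf u x ^ 2 / Wf u x) + A⁻¹ * Wf u x = (2 * A ^ 2 * |gf u x| ^ 2 + Wf u x ^ 2) / (A * Wf u x) := by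
      rw [sq_abs]; field_simp
    rw [e1, le_div_iff₀ (by positivity)]
    nlinarith [sq_nonneg (A * |gf u x| - Wf u x), sq_nonneg (A * |gf u x|)]
  calc 2 * dph (x, u x) * |gf u x| = dph (x, u x) * (2 * |gf u x|) := by ring
    _ ≤ dph (x, u x) * (A * (2 * gf u x ^ 2 / Wf u x) + A⁻¹ * Wf u x) := by gcongr
    _ = _ := by rw [Qd]; ring

theorem energy_ineq (r e : E) (μ : ℝ) : ∃ C : ℝ, 0 ≤ C ∧ ∀ (Ω : Set E) (u : E → ℝ), Sol r e μ Ω u → ∀ A : ℝ, 0 < A →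
    ∫ x in Ω, En r e u x ≤ C * (A * QQ Ω u + A⁻¹) := by
  obtain ⟨Cd, hCd0, hCd⟩ := dph_bound (E := E)
  obtain ⟨C2, hC20, hC2⟩ := Rn_bound r e μ
  obtain ⟨Ca, hCa0, hCa⟩ := area_bound r e μ
  refine ⟨C2 * (1 + (Cd + 1) * Ca), by positivity, fun Ω u hu A hA => ?_⟩
  have hb : ∀ x ∈ Ω, En r e u x ≤ (En r e u x + Rn r e μ u x) + C2 * (A * Qd u x + A⁻¹ * (dph (x, u x) * Wf u x)) := by
    intro x hx
    have h1 := (abs_le.1 (hC2 Ω u hu x hx)).1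
    have h2 := mul_le_mul_of_nonneg_left (int_dgf hu hA (x := x)) hC20
    linarith
  have i2 : IntegrableOn (fun x => C2 * (A * Qd u x + A⁻¹ * (dph (x, u x) * Wf u x))) Ω :=
    (((int_Qd hu).const_mul A).add ((int_dphW hu).const_mul A⁻¹)).const_mul C2
  have i1 : IntegrableOn (fun x => En r e u x + Rn r e μ u x) Ω := by
    refine (int_En hu).add (Integrable.mono' i2 ?_ ?_)
    · refine ContinuousOn.aestronglyMeasurable ?_ hu.isOpen.measurableSet
      unfold Rn
      exact (Th_c1 hu).continuousOn.mul ((((continuousOn_const.mul (cont_dphu hu)).mul (kg_c1 hu).continuousOn).mul (cont_gf hu)).div (cont_Wf hu.isOpen hu.c1) (fun x _ => (Wf_pos u x).ne'))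
    · filter_upwards [ae_restrict_mem hu.isOpen.measurableSet] with x hx
      exact (hC2 Ω u hu x hx).trans (mul_le_mul_of_nonneg_left (int_dgf hu hA (x := x)) hC20)
  have h1 := setIntegral_mono_on (int_En hu) (i1.add i2) hu.isOpen.measurableSet hb
  have h2 := integral_add i1 i2
  simp only [Pi.add_apply] at h1
  rw [h2, energy_eq hu, integral_const_mul, zero_add] at h1
  rw [integral_add ((int_Qd hu).const_mul A) ((int_dphW hu).const_mul A⁻¹), integral_const_mul, integral_const_mul] at h1
  have h3 := hCa Ω u hu (fun x => dph (x, u x) / (Cd + 1)) (fun x _ => div_nonneg (dph_nonneg _) (by positivity))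
    (fun x _ => by rw [div_le_one (by positivity)]; linarith [hCd (x, u x)]) (fun x _ h => by rw [dph_zero (by show 2 ≤ ‖x‖ ^ 2 + u x ^ 2; linarith), zero_div])
  have h4 : ∫ x in Ω, dph (x, u x) / (Cd + 1) * Wf u x = (Cd + 1)⁻¹ * ∫ x in Ω, dph (x, u x) * Wf u x := by
    rw [← integral_const_mul]; congr 1; ext x; ring
  rw [h4, inv_mul_le_iff₀ (by positivity)] at h3
  refine h1.trans ?_
  rw [mul_assoc]
  refine mul_le_mul_of_nonneg_left ?_ hC20
  have hQ := QQ_nonneg hu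
  have hAi : 0 < A⁻¹ := by positivity
  rw [show ∫ x in Ω, Qd u x = QQ Ω u from rfl]
  have h5 : 0 ≤ (Cd + 1) * Ca := by positivity
  have h6 : 0 ≤ A * QQ Ω u := by positivity
  nlinarith [mul_nonneg h5 h6, mul_le_mul_of_nonneg_left h3 hAi.le]
end Bern

namespace Bern
open MeasureTheory Filter Topology InnerProductSpace

variable {E : Type*} [NormedAddCommGroup E] [InnerProductSpace ℝ E] [FiniteDimensional ℝ E]
  [MeasurableSpace E] [BorelSpace E]


/-! ### wedge estimate -/
noncomputable def sd (s : ℝ) : ℝ := deriv Real.smoothTransition s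
theorem sd_nonneg (s : ℝ) : 0 ≤ sd s := by
  unfold sd; exact Real.smoothTransition.monotone.deriv_nonneg
theorem sd_zero {s : ℝ} (h : s ≤ 0) : sd s = 0 := by
  unfold sd
  apply IsLocalMin.deriv_eq_zero
  refine Eventually.of_forall fun y => ?_
  rw [Real.smoothTransition.zero_of_nonpos h]
  exact Real.smoothTransition.nonneg _
noncomputable def wc (r e : E) (A : ℝ) (p : E × ℝ) : ℝ :=
  ph p * Real.smoothTransition (zL r p * (tL e p)⁻¹ - A)

theorem wc_deriv {r e : E} (A : ℝ) {p : E × ℝ} (h : 0 < tL e p) (v : E × ℝ) :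
    fderiv ℝ (wc r e A) p v = fderiv ℝ ph p v * Real.smoothTransition (zL r p * (tL e p)⁻¹ - A)
      + ph p * (sd (zL r p * (tL e p)⁻¹ - A) * ((tL e p * zL r v - zL r p * tL e v) / (tL e p) ^ 2)) := by
  have h1 : HasFDerivAt (fun p : E × ℝ => zL r p) (zL r) p := (zL r).hasFDerivAt
  have h2 : HasFDerivAt (fun p : E × ℝ => (tL e p)⁻¹) _ p :=
    (hasDerivAt_inv h.ne').comp_hasFDerivAt p (tL e).hasFDerivAt
  have h3 := (h1.fun_mul h2).sub_const A
  have h4 : HasDerivAt Real.smoothTransition (sd (zL r p * (tL e p)⁻¹ - A)) (zL r p * (tL e p)⁻¹ - A) :=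
    ((Real.smoothTransition.contDiff (n := 1)).differentiable (by norm_num) _).hasDerivAt
  have h5 := h4.comp_hasFDerivAt p h3
  have h6 : HasFDerivAt ph (fderiv ℝ ph p) p := (ph_contDiff.differentiable (by norm_num) p).hasFDerivAt
  have h7 : HasFDerivAt (wc r e A) _ p := h6.fun_mul h5
  rw [h7.fderiv]
  simp only [ContinuousLinearMap.add_apply, ContinuousLinearMap.smul_apply, smul_eq_mul, Function.comp]
  have := h.ne'
  field_simp
  ring

theorem wc_contDiff {r e : E} (A : ℝ) {Ω : Set E} (h : ∀ x ∈ Ω, 0 < inner ℝ e x) :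
    ContDiffOn ℝ 1 (wc r e A) (Ω ×ˢ univ) := by
  unfold wc
  refine ph_contDiff.contDiffOn.mul ((Real.smoothTransition.contDiff (n := 1)).comp_contDiffOn ?_)
  refine ((zL r).contDiff.contDiffOn.mul ((tL e).contDiff.contDiffOn.inv ?_)).sub contDiffOn_const
  rintro ⟨x, ζ⟩ hx
  rw [tL_apply]
  exact (h x hx.1).ne'

def DW (e : E) (B A : ℝ) : Set E := {x | ‖x‖ < 2 ∧ 0 < inner ℝ e x ∧ inner ℝ e x * A < B}

theorem DW_meas (e : E) (B A : ℝ) : MeasurableSet (DW e B A) := by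
  unfold DW
  have h1 : IsOpen {x : E | ‖x‖ < 2} := isOpen_lt (by fun_prop) (by fun_prop)
  have h2 : IsOpen {x : E | 0 < inner ℝ e x} := isOpen_lt (by fun_prop) (by fun_prop)
  have h3 : IsOpen {x : E | inner ℝ e x * A < B} := isOpen_lt (by fun_prop) (by fun_prop)
  exact (h1.inter (h2.inter h3)).measurableSet

theorem DW_fin (e : E) (B A : ℝ) : volume (DW e B A) ≠ ⊤ := by
  refine ((measure_mono ?_).trans_lt (measure_ball_lt_top (x := (0:E)) (r := 2))).ne
  intro x hx
  simpa using hx.1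

theorem DW_small (e : E) (B : ℝ) {ε : ℝ} (hε : 0 < ε) (A0 : ℝ) : ∃ A, A0 ≤ A ∧ 0 ≤ A ∧ volume.real (DW e B A) < ε := by
  have hanti : Antitone fun n : ℕ => DW e B n := by
    intro m n hmn x hx
    refine ⟨hx.1, hx.2.1, lt_of_le_of_lt ?_ hx.2.2⟩
    exact mul_le_mul_of_nonneg_left (by exact_mod_cast hmn) hx.2.1.le
  have hem : ⋂ n : ℕ, DW e B n = ∅ := by
    rw [eq_empty_iff_forall_notMem]
    intro x hx
    rw [mem_iInter] at hx
    have h0 := (hx 0).2.1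
    obtain ⟨n, hn⟩ := exists_nat_gt (B / inner ℝ e x)
    have := (hx n).2.2
    rw [div_lt_iff₀ h0] at hn
    linarith
  have ht := tendsto_measure_iInter_atTop (μ := (volume : Measure E)) (fun n : ℕ => (DW_meas e B n).nullMeasurableSet) hanti ⟨0, DW_fin e B _⟩
  rw [hem, measure_empty] at ht
  have ht2 : Tendsto (fun n : ℕ => volume.real (DW e B n)) atTop (𝓝 0) := by
    have := (ENNReal.tendsto_toReal ENNReal.zero_ne_top).comp ht
    rw [ENNReal.toReal_zero] at this; exact this
  obtain ⟨N, hN⟩ := (ht2.eventually (gt_mem_nhds hε)).exists_forall_of_atTop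
  obtain ⟨m, hm⟩ := exists_nat_ge A0
  refine ⟨((max N m : ℕ) : ℝ), hm.trans (by exact_mod_cast le_max_right _ _), by positivity, hN _ (le_max_left _ _)⟩

theorem wc_ineq {r e : E} (he : ‖e‖ = 1) (hre : inner ℝ r e = 0) {C : ℝ} (hC0 : 0 ≤ C)
    (hC : ∀ (p : E × ℝ) (a : E) (b : ℝ), ‖a‖ ≤ 1 → |b| ≤ 1 → |fderiv ℝ ph p (a, b)| ≤ C)
    {A : ℝ} (hA : 0 ≤ A) (u : E → ℝ) {x : E} (hx : 0 < inner ℝ e x) (ζ : ℝ) :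
    fderiv ℝ (wc r e A) (x, ζ) (-(Ff u x), (Wf u x)⁻¹) - fderiv ℝ (wc r e A) (x, ζ) (eth r e (x, ζ))
      ≤ (Icc (-2:ℝ) 2).indicator (fun _ => (DW e (2 + 2 * ‖r‖) A).indicator (fun _ => C) x) ζ := by
  have ht : 0 < tL e (x, ζ) := by rw [tL_apply]; exact hx
  have hρ := rho_pos (r := r) ht
  have hρ2 := rho_sq r e (x, ζ)
  have hk := kap_pos r
  have hk2 := kap_sq r
  have hW := Wf_pos u x
  rw [wc_deriv A ht, wc_deriv A ht, ph_eth ht, zero_mul, zero_add]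
  have hz1 : zL r (eth r e (x, ζ)) = tL e (x, ζ) / rho r e (x, ζ) := by
    rw [show eth r e (x, ζ) = ((eth r e (x, ζ)).1, (eth r e (x, ζ)).2) from rfl, zL_apply]
    simp only [eth, inner_sub_right, inner_smul_right, inner_neg_right, neg_smul, hre, real_inner_self_eq_norm_sq]
    have : ‖r‖ ^ 2 = kap r ^ 2 - 1 := by linarith
    rw [this]
    field_simp
    ring
  have ht1 : tL e (eth r e (x, ζ)) = - (zL r (x, ζ) / rho r e (x, ζ)) := by
    rw [show eth r e (x, ζ) = ((eth r e (x, ζ)).1, (eth r e (x, ζ)).2) from rfl, tL_apply]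
    have hre' : inner ℝ e r = 0 := by rw [real_inner_comm]; exact hre
    simp only [eth, inner_sub_right, inner_smul_right, inner_neg_right, neg_smul, hre', real_inner_self_eq_norm_sq, he]
    ring
  have hd1 : (tL e (x, ζ) * zL r (eth r e (x, ζ)) - zL r (x, ζ) * tL e (eth r e (x, ζ))) / (tL e (x, ζ)) ^ 2
      = rho r e (x, ζ) / (tL e (x, ζ)) ^ 2 := by
    rw [hz1, ht1]
    congr 1
    field_simp
    linarith
  have hd2 : (tL e (x, ζ) * zL r (-(Ff u x), (Wf u x)⁻¹) - zL r (x, ζ) * tL e (-(Ff u x), (Wf u x)⁻¹)) / (tL e (x, ζ)) ^ 2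
      = rho r e (x, ζ) * (Sg r e (x, ζ) (gradient u x) / Wf u x) / (tL e (x, ζ)) ^ 2 := by
    congr 1
    rw [zL_apply r (-(Ff u x)), tL_apply e (-(Ff u x))]
    simp only [Ff, inner_neg_right, inner_smul_right, Sg]
    generalize inner ℝ r (gradient u x) = a
    generalize inner ℝ e (gradient u x) = b
    field_simp
    ring
  have hS := abs_Sg_le he hre ht (gradient u x)
  have hS2 : Sg r e (x, ζ) (gradient u x) / Wf u x ≤ 1 := by
    rw [div_le_one hW]; exact (le_abs_self _).trans hS
  have hd3 : rho r e (x, ζ) * (Sg r e (x, ζ) (gradient u x) / Wf u x) / (tL e (x, ζ)) ^ 2 ≤ rho r e (x, ζ) / (tL e (x, ζ)) ^ 2 := by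
    gcongr
    nlinarith
  rw [hd1, hd2]
  set G := Real.smoothTransition (zL r (x, ζ) * (tL e (x, ζ))⁻¹ - A) with hG
  have hm := mul_le_mul_of_nonneg_left (mul_le_mul_of_nonneg_left hd3 (sd_nonneg (zL r (x, ζ) * (tL e (x, ζ))⁻¹ - A))) (ph_nonneg (x, ζ))
  suffices h : fderiv ℝ ph (x, ζ) (-(Ff u x), (Wf u x)⁻¹) * G ≤ (Icc (-2:ℝ) 2).indicator (fun _ => (DW e (2 + 2 * ‖r‖) A).indicator (fun _ => C) x) ζ by
    linarith
  have hG0 : 0 ≤ G := Real.smoothTransition.nonneg _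
  have hG1 : G ≤ 1 := Real.smoothTransition.le_one _
  have hR0 : 0 ≤ (Icc (-2:ℝ) 2).indicator (fun _ => (DW e (2 + 2 * ‖r‖) A).indicator (fun _ => C) x) ζ :=
    indicator_nonneg (fun _ _ => indicator_nonneg (fun _ _ => hC0) _) _
  by_cases hb : 2 ≤ ‖x‖ ^ 2 + ζ ^ 2
  · rw [ph_deriv, dph_zero (p := (x, ζ)) hb]; simpa using hR0
  by_cases hz : zL r (x, ζ) * (tL e (x, ζ))⁻¹ - A ≤ 0
  · rw [hG, Real.smoothTransition.zero_of_nonpos hz, mul_zero]; exact hR0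
  push Not at hb hz
  have hx2 : ‖x‖ < 2 := by nlinarith [sq_nonneg ζ, norm_nonneg x]
  have hζ : |ζ| ≤ 2 := abs_le_of_sq_le_sq (by nlinarith [sq_nonneg ‖x‖]) (by norm_num)
  have hD : x ∈ DW e (2 + 2 * ‖r‖) A := by
    refine ⟨hx2, hx, ?_⟩
    have h1 : inner ℝ e x * A < zL r (x, ζ) := by
      rw [← tL_apply e x ζ]
      have : A < zL r (x, ζ) / tL e (x, ζ) := by rw [div_eq_mul_inv]; linarith
      rw [lt_div_iff₀ ht] at this
      linarith
    refine h1.trans_le ?_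
    rw [zL_apply, div_le_iff₀ hk]
    have h2 := abs_le.1 (abs_real_inner_le_norm r x)
    have h3 := (abs_le.1 hζ).2
    have h4 := one_le_kap r
    have h5 : ‖r‖ * ‖x‖ ≤ ‖r‖ * 2 := by gcongr
    have h6 : (2 + 2 * ‖r‖) * 1 ≤ (2 + 2 * ‖r‖) * kap r := by gcongr
    linarith
  rw [indicator_of_mem (show ζ ∈ Icc (-2:ℝ) 2 from abs_le.1 hζ), indicator_of_mem hD]
  have h1 := hC (x, ζ) (-(Ff u x)) (Wf u x)⁻¹ (by rw [norm_neg]; exact norm_Ff_le u x)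
    (by rw [abs_of_pos (inv_pos.2 hW)]; exact inv_le_one_of_one_le₀ (one_le_Wf u x))
  calc _ ≤ C * G := mul_le_mul_of_nonneg_right ((le_abs_self _).trans h1) hG0
    _ ≤ C * 1 := by gcongr
    _ = C := mul_one C

end Bern

namespace Bern
open MeasureTheory Filter Topology InnerProductSpace

variable {E : Type*} [NormedAddCommGroup E] [InnerProductSpace ℝ E] [FiniteDimensional ℝ E]
  [MeasurableSpace E] [BorelSpace E]


theorem wc_zero {r e : E} {A : ℝ} {p : E × ℝ} (h : 0 < tL e p) (hz : zL r p ≤ A * tL e p) : zL r p * (tL e p)⁻¹ - A ≤ 0 := by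
  have : zL r p / tL e p ≤ A := by rw [div_le_iff₀ h]; exact hz
  rw [div_eq_mul_inv] at this; linarith

theorem z_below {r e : E} {μ A : ℝ} (hA : |μ| ≤ A) {x : E} (hx : 0 < inner ℝ e x) {ζ : ℝ}
    (hζ : ζ ≤ inner ℝ (r + μ • e) x) : zL r (x, ζ) ≤ A * tL e (x, ζ) := by
  rw [zL_apply, tL_apply, div_le_iff₀ (kap_pos r)]
  rw [inner_add_left, inner_smul_left] at hζ
  simp at hζ
  have h1 := one_le_kap r
  have h2 : μ * inner ℝ e x ≤ A * inner ℝ e x := by gcongr; exact (le_abs_self _).trans hA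
  have h3 : A * inner ℝ e x * 1 ≤ A * inner ℝ e x * kap r := by
    have : 0 ≤ A := (abs_nonneg _).trans hA
    gcongr
  linarith

theorem int_wcWS {r e : E} {μ : ℝ} {Ω : Set E} {u : E → ℝ} (hu : Sol r e μ Ω u) (A : ℝ) :
    IntegrableOn (fun x => wc r e A (x, u x) * (Wf u x - Sg r e (x, u x) (gradient u x))) Ω := by
  have hc : ContinuousOn (fun x => wc r e A (x, u x)) Ω :=
    (wc_contDiff A hu.pos).continuousOn.comp (f := fun x => (x, u x)) (continuousOn_id.prodMk (cont_uΩ hu)) (fun x hx => ⟨hx, mem_univ _⟩)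
  refine int_of_bound hu.isOpen (hc.mul ((cont_Wf hu.isOpen hu.c1).sub (cont_S hu))) ((hu.int_W 2).const_mul 2) (fun x hx => ?_) (fun x hx h => by unfold wc; rw [ph_R h, zero_mul, zero_mul])
  have h1 := abs_le.1 (S_le hu hx)
  have h2 : |wc r e A (x, u x)| ≤ 1 := by
    unfold wc
    rw [abs_of_nonneg (mul_nonneg (ph_nonneg _) (Real.smoothTransition.nonneg _))]
    exact mul_le_one₀ (ph_le_one _) (Real.smoothTransition.nonneg _) (Real.smoothTransition.le_one _)
  rw [abs_mul, abs_of_nonneg (by linarith : 0 ≤ Wf u x - Sg r e (x, u x) (gradient u x))]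
  have := mul_le_mul_of_nonneg_right h2 (by linarith : 0 ≤ Wf u x - Sg r e (x, u x) (gradient u x))
  linarith

theorem wedge_int {r e : E} {μ : ℝ} {Ω : Set E} {u : E → ℝ} (hu : Sol r e μ Ω u) {C : ℝ} (hC0 : 0 ≤ C)
    (hC : ∀ (p : E × ℝ) (a : E) (b : ℝ), ‖a‖ ≤ 1 → |b| ≤ 1 → |fderiv ℝ ph p (a, b)| ≤ C)
    {A : ℝ} (hA : |μ| ≤ A) :
    ∫ x in Ω, wc r e A (x, u x) * (Wf u x - Sg r e (x, u x) (gradient u x)) ≤ 4 * C * volume.real (DW e (2 + 2 * ‖r‖) A) := by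
  have hA0 : 0 ≤ A := (abs_nonneg _).trans hA
  have hcd := wc_contDiff (r := r) A hu.pos
  have hM : ∀ x ∈ Ω, ∀ ζ : ℝ, |wc r e A (x, ζ)| ≤ 1 := by
    intro x hx ζ
    unfold wc
    rw [abs_of_nonneg (mul_nonneg (ph_nonneg _) (Real.smoothTransition.nonneg _))]
    exact mul_le_one₀ (ph_le_one _) (Real.smoothTransition.nonneg _) (Real.smoothTransition.le_one _)
  have hR : ∀ x ∈ Ω, ∀ ζ : ℝ, 2 ≤ ‖x‖ → wc r e A (x, ζ) = 0 := by
    intro x hx ζ h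
    unfold wc
    rw [ph_R h, zero_mul]
  have hF := (flux_N hu hu Subset.rfl hcd hM hR).sub (flux_theta hu hcd hM hR)
  set b : E → ℝ := _
  change Flux Ω _ b at hF
  have hl0 : ∀ x ∈ Ω, ∀ ζ ≤ inner ℝ (r + μ • e) x, zL r (x, ζ) * (tL e (x, ζ))⁻¹ - A ≤ 0 := fun x hx ζ hζ =>
    wc_zero (by rw [tL_apply]; exact hu.pos x hx) (z_below hA (hu.pos x hx) hζ)
  have key : ∀ x ∈ Ω, wc r e A (x, u x) * (Wf u x - Sg r e (x, u x) (gradient u x))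
      ≤ b x + (DW e (2 + 2 * ‖r‖) A).indicator (fun _ => 4 * C) x := by
    intro x hx
    have hW := Wf_pos u x
    have hpos := hu.pos x hx
    have hcs := cont_slice hu.isOpen hcd hx
    have hc1 : Continuous fun ζ : ℝ => fderiv ℝ (wc r e A) (x, ζ) (-(Ff u x), (Wf u x)⁻¹) := by fun_prop
    have htt : ∀ ζ : ℝ, 0 < tL e (x, ζ) := fun ζ => by rw [tL_apply]; exact hpos
    have hc2 : Continuous fun ζ : ℝ => fderiv ℝ (wc r e A) (x, ζ) (eth r e (x, ζ)) := by
      refine hcs.clm_apply ?_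
      have hr : Continuous fun ζ : ℝ => rho r e (x, ζ) := by unfold rho; fun_prop
      have hr0 : ∀ ζ : ℝ, rho r e (x, ζ) ≠ 0 := fun ζ => (rho_pos (htt ζ)).ne'
      have hk := (kap_pos r).ne'
      unfold eth
      refine Continuous.prodMk (Continuous.sub (Continuous.smul ?_ continuous_const) (Continuous.smul ?_ continuous_const)) ?_
      · exact (Continuous.div (by fun_prop) hr hr0).neg
      · exact Continuous.div (by fun_prop) (by fun_prop) (fun ζ => mul_ne_zero (hr0 ζ) hk)
      · exact Continuous.div (by fun_prop) (by fun_prop) (fun ζ => mul_ne_zero (hr0 ζ) hk)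
    have hcl : wc r e A (x, inner ℝ (r + μ • e) x) = 0 := by
      unfold wc
      rw [Real.smoothTransition.zero_of_nonpos (hl0 x hx _ le_rfl), mul_zero]
    have hbx : b x = wc r e A (x, u x) * (Wf u x - Sg r e (x, u x) (gradient u x))
        - ∫ ζ in inner ℝ (r + μ • e) x..u x, (fderiv ℝ (wc r e A) (x, ζ) (-(Ff u x), (Wf u x)⁻¹) - fderiv ℝ (wc r e A) (x, ζ) (eth r e (x, ζ))) := by
      rw [intervalIntegral.integral_sub (hc1.intervalIntegrable _ _) (hc2.intervalIntegrable _ _)]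
      have h1 : (1 + inner ℝ (gradient u x) (gradient u x)) / Wf u x = Wf u x := by
        rw [real_inner_self_eq_norm_sq, ← Wf_sq]; field_simp
      simp only [b]
      rw [h1, hcl]
      ring
    rw [hbx]
    suffices h : ∫ ζ in inner ℝ (r + μ • e) x..u x, (fderiv ℝ (wc r e A) (x, ζ) (-(Ff u x), (Wf u x)⁻¹) - fderiv ℝ (wc r e A) (x, ζ) (eth r e (x, ζ)))
      ≤ (DW e (2 + 2 * ‖r‖) A).indicator (fun _ => 4 * C) x by linarith
    have hR0 : 0 ≤ (DW e (2 + 2 * ‖r‖) A).indicator (fun _ => 4 * C) x := indicator_nonneg (fun _ _ => by positivity) _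
    rcases le_total (u x) (inner ℝ (r + μ • e) x) with hle | hle
    · rw [intervalIntegral.integral_symm]
      have : ∀ ζ ∈ uIcc (u x) (inner ℝ (r + μ • e) x), (fderiv ℝ (wc r e A) (x, ζ) (-(Ff u x), (Wf u x)⁻¹) - fderiv ℝ (wc r e A) (x, ζ) (eth r e (x, ζ))) = (fun _ => (0:ℝ)) ζ := by
        intro ζ hζ
        rw [uIcc_of_le hle] at hζ
        have h0 := hl0 x hx ζ hζ.2
        rw [wc_deriv A (htt ζ), wc_deriv A (htt ζ), sd_zero h0, Real.smoothTransition.zero_of_nonpos h0]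
        ring
      rw [intervalIntegral.integral_congr this]
      simpa using hR0
    · have hgi : Integrable (fun ζ : ℝ => (Icc (-2:ℝ) 2).indicator (fun _ => (DW e (2 + 2 * ‖r‖) A).indicator (fun _ => C) x) ζ) := by
        rw [integrable_indicator_iff measurableSet_Icc]
        exact integrableOn_const (by simp) enorm_ne_top
      refine (intervalIntegral.integral_mono_on hle ((hc1.sub hc2).intervalIntegrable _ _) hgi.intervalIntegrable
        (fun ζ _ => wc_ineq hu.norm_e hu.re hC0 hC hA0 u hpos ζ)).trans ?_
      rw [intervalIntegral.integral_of_le hle]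
      refine (setIntegral_le_integral hgi (Eventually.of_forall fun ζ => indicator_nonneg (fun _ _ => indicator_nonneg (fun _ _ => hC0) _) _)).trans ?_
      rw [integral_indicator measurableSet_Icc, setIntegral_const]
      by_cases hD : x ∈ DW e (2 + 2 * ‖r‖) A
      · rw [indicator_of_mem hD, indicator_of_mem hD]
        simp
        norm_num
      · rw [indicator_of_notMem hD, indicator_of_notMem hD]
        simp
  have hΩm := hu.isOpen.measurableSet
  have hwc : ContinuousOn (fun x => u x - inner ℝ (r + μ • e) x) Ω := (cont_uΩ hu).sub (by fun_prop)
  have hIg := int_wcWS hu A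
  have hlim := chi_dct hΩm hwc hIg ((ae_restrict_iff' hΩm).2 (Eventually.of_forall fun x hx h0 => by
    have h1 := hl0 x hx (u x) (by linarith)
    unfold wc
    rw [Real.smoothTransition.zero_of_nonpos h1, mul_zero, zero_mul]))
  have hind : Integrable (fun x => (DW e (2 + 2 * ‖r‖) A).indicator (fun _ => 4 * C) x) (volume.restrict Ω) := by
    apply Integrable.restrict
    rw [integrable_indicator_iff (DW_meas _ _ _)]
    exact integrableOn_const (DW_fin _ _ _) enorm_ne_top
  have hlim2 := hF.lim.add_const (4 * C * volume.real (DW e (2 + 2 * ‖r‖) A))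
  rw [zero_add] at hlim2
  refine le_of_tendsto_of_tendsto' hlim hlim2 fun k => ?_
  have hind2 : ∫ x in Ω, (DW e (2 + 2 * ‖r‖) A).indicator (fun _ => 4 * C) x ≤ 4 * C * volume.real (DW e (2 + 2 * ‖r‖) A) := by
    refine (setIntegral_le_integral ?_ (Eventually.of_forall fun x => indicator_nonneg (fun _ _ => by positivity) _)).trans ?_
    · rw [integrable_indicator_iff (DW_meas _ _ _)]
      exact integrableOn_const (DW_fin _ _ _) enorm_ne_top
    · rw [integral_indicator (DW_meas _ _ _), setIntegral_const, smul_eq_mul, mul_comm]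
  refine le_trans ?_ (add_le_add_right hind2 _)
  rw [← integral_add (hF.int k) hind]
  refine setIntegral_mono_on ?_ ((hF.int k).add hind) hΩm fun x hx => ?_
  · refine Integrable.mono' hIg.norm (((chi_cont_on hwc k).aestronglyMeasurable hΩm).mul hIg.aestronglyMeasurable) (Eventually.of_forall fun x => ?_)
    rw [norm_mul, Real.norm_eq_abs, abs_of_nonneg (chi_nonneg _)]
    exact mul_le_of_le_one_left (norm_nonneg _) (chi_le_one _)
  · have h1 := mul_le_mul_of_nonneg_left (key x hx) (chi_nonneg ((↑k + 1) * (u x - inner ℝ (r + μ • e) x)))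
    have hR0 : 0 ≤ (DW e (2 + 2 * ‖r‖) A).indicator (fun _ => 4 * C) x := indicator_nonneg (fun _ _ => by positivity) _
    have h2 := mul_le_of_le_one_left hR0 (chi_le_one ((↑k + 1) * (u x - inner ℝ (r + μ • e) x)))
    linarith

theorem wedge_up (r e : E) (μ : ℝ) {ε : ℝ} (hε : 0 < ε) : ∃ A, 0 ≤ A ∧ ∀ (Ω : Set E) (u : E → ℝ), Sol r e μ Ω u →
    ∫ x in Ω, wc r e A (x, u x) * (Wf u x - Sg r e (x, u x) (gradient u x)) ≤ ε := by
  obtain ⟨C, hC0, hC⟩ := ph_bound (E := E)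
  obtain ⟨A, hA1, hA0, hA⟩ := DW_small e (2 + 2 * ‖r‖) (ε := ε / (4 * C + 1)) (by positivity) |μ|
  refine ⟨A, hA0, fun Ω u hu => (wedge_int hu hC0 hC hA1).trans ?_⟩
  rw [lt_div_iff₀ (by positivity)] at hA
  have : 0 ≤ volume.real (DW e (2 + 2 * ‖r‖) A) := measureReal_nonneg
  linarith

theorem grad_neg (u : E → ℝ) (x : E) : gradient (fun y => - u y) x = - gradient u x := by
  apply ext_inner_right ℝ
  intro v
  rw [← fderiv_eq_inner, inner_neg_left, ← fderiv_eq_inner, fderiv_fun_neg]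
  rfl
theorem Wf_neg (u : E → ℝ) (x : E) : Wf (fun y => - u y) x = Wf u x := by
  unfold Wf; rw [grad_neg, norm_neg]
theorem Ff_neg (u : E → ℝ) (x : E) : Ff (fun y => - u y) x = - Ff u x := by
  unfold Ff; rw [grad_neg, Wf_neg, smul_neg]

theorem Sol.neg {r e : E} {μ : ℝ} {Ω : Set E} {u : E → ℝ} (hu : Sol r e μ Ω u) :
    Sol (-r) e (-μ) Ω (fun x => - u x) where
  isOpen := hu.isOpen
  convex := hu.convex
  zero_mem := hu.zero_mem
  norm_e := hu.norm_e
  re := by rw [inner_neg_left, hu.re, neg_zero]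
  pos := hu.pos
  c2 := hu.c2.neg
  cont := hu.cont.neg
  bdry := fun x hx => by
    rw [hu.bdry x hx, ← inner_neg_left]; congr 1; rw [neg_add, neg_smul]
  weak := by
    intro ψ h1 h2 h3
    have := hu.weak ψ h1 h2 h3
    simp only [Ff_neg, map_neg, integral_neg, this, neg_zero]

theorem kap_neg (r : E) : kap (-r) = kap r := by unfold kap; rw [norm_neg]
theorem zL_neg (r : E) (x : E) (ζ : ℝ) : zL (-r) (x, -ζ) = - zL r (x, ζ) := by
  rw [zL_apply, zL_apply, kap_neg, inner_neg_left]; ring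
theorem Sg_neg (r e : E) (x : E) (ζ : ℝ) (P : E) : Sg (-r) e (x, -ζ) (-P) = Sg r e (x, ζ) P := by
  unfold Sg rho
  rw [zL_neg, kap_neg, tL_apply, tL_apply, inner_neg_neg, inner_neg_right, neg_mul_neg, neg_sq]
theorem ph_neg (x : E) (ζ : ℝ) : ph (x, -ζ) = ph (x, ζ) := by
  unfold ph; simp

theorem mid_alg {W S β : ℝ} (hW : 0 < W) (hS : |S| ≤ W) (hβ : β ^ 2 ≤ 1 - S ^ 2 / W ^ 2) (hβ0 : 0 < β) :
    W - S ≤ 2 * (β ^ 2)⁻¹ * (W - S ^ 2 / W) := by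
  have h1 := abs_le.1 hS
  have hb : β ^ 2 * W ^ 2 ≤ W ^ 2 - S ^ 2 := by
    have := mul_le_mul_of_nonneg_right hβ (sq_nonneg W)
    have h2 : (1 - S ^ 2 / W ^ 2) * W ^ 2 = W ^ 2 - S ^ 2 := by field_simp
    linarith
  have h3 : W - S ^ 2 / W = (W ^ 2 - S ^ 2) / W := by field_simp
  rw [h3]
  have h4 : 2 * (β ^ 2)⁻¹ * ((W ^ 2 - S ^ 2) / W) = 2 * (W ^ 2 - S ^ 2) / (β ^ 2 * W) := by field_simp
  rw [h4, le_div_iff₀ (by positivity)]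
  have h5 : (W - S) * (β ^ 2 * W) ≤ (2 * W) * (β ^ 2 * W) := by
    gcongr; linarith
  nlinarith

theorem mid_pt {r e : E} {μ : ℝ} {Ω : Set E} {u : E → ℝ} (hu : Sol r e μ Ω u) {x : E} (hx : x ∈ Ω) {M : ℝ}
    (hM : |zL r (x, u x)| ≤ M * tL e (x, u x)) :
    Wf u x - Sg r e (x, u x) (gradient u x) ≤ 2 * (kap r ^ 2 * (1 + M ^ 2)) * (Wf u x - Sg r e (x, u x) (gradient u x) ^ 2 / Wf u x) := by
  have ht : 0 < tL e (x, u x) := by rw [tL_apply]; exact hu.pos x hx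
  have hρ := rho_pos (r := r) ht
  have hk := kap_pos r
  have hW := Wf_pos u x
  have hun := eth_unit hu.norm_e hu.re ht (p := (x, u x))
  have hSe := Sg_eq (r := r) ht (gradient u x)
  have hβe : (eth r e (x, u x)).2 = tL e (x, u x) / (rho r e (x, u x) * kap r) := rfl
  have hβ0 : 0 < (eth r e (x, u x)).2 := by rw [hβe]; positivity
  have hW2 := Wf_sq u x
  have hS := S_le hu hx
  generalize hSS : Sg r e (x, u x) (gradient u x) = S at *
  have hnn : 0 ≤ Wf u x - S ^ 2 / Wf u x := by rw [← hSS]; exact (one_sub_sq hu hx).1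
  rcases le_total 0 S with hS0 | hS0
  · have h1 : S ^ 2 / Wf u x ≤ S := by rw [div_le_iff₀ hW]; nlinarith [(abs_le.1 hS).2]
    have h2 : 1 ≤ 2 * (kap r ^ 2 * (1 + M ^ 2)) := by
      have := one_le_kap r
      nlinarith [mul_nonneg (sq_nonneg (kap r)) (sq_nonneg M)]
    nlinarith
  have hβ : (eth r e (x, u x)).2 ^ 2 ≤ 1 - S ^ 2 / Wf u x ^ 2 := by
    have h0 := sq_nonneg ‖(eth r e (x, u x)).1 + (S / Wf u x ^ 2) • gradient u x‖
    rw [norm_add_sq_real, inner_smul_right, norm_smul, mul_pow, Real.norm_eq_abs, sq_abs] at h0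
    generalize inner ℝ (eth r e (x, u x)).1 (gradient u x) = a at *
    generalize (eth r e (x, u x)).2 = β at *
    generalize ‖(eth r e (x, u x)).1‖ = m at *
    generalize ‖gradient u x‖ ^ 2 = g at *
    have h1 : g = Wf u x ^ 2 - 1 := by linarith
    have h2 : a = β - S := by linarith
    have h3 : m ^ 2 = 1 - β ^ 2 := by linarith
    have h4 : (S / Wf u x ^ 2) * S = S ^ 2 / Wf u x ^ 2 := by ring
    have h5 : (S / Wf u x ^ 2) ^ 2 * Wf u x ^ 2 = S ^ 2 / Wf u x ^ 2 := by field_simp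
    have h6 : S / Wf u x ^ 2 ≤ 0 := div_nonpos_of_nonpos_of_nonneg hS0 (sq_nonneg _)
    rw [h1, h2, h3] at h0
    generalize S / Wf u x ^ 2 = s at *
    nlinarith [mul_nonneg hβ0.le (neg_nonneg.2 h6), sq_nonneg s]
  refine (mid_alg hW hS hβ hβ0).trans ?_
  refine mul_le_mul_of_nonneg_right ?_ (by rw [← hSS]; exact (one_sub_sq hu hx).1)
  refine mul_le_mul_of_nonneg_left ?_ (by norm_num)
  rw [hβe, div_pow, inv_div, mul_pow, rho_sq, div_le_iff₀ (by positivity)]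
  have h1 : zL r (x, u x) ^ 2 ≤ (M * tL e (x, u x)) ^ 2 := sq_le_sq' (by linarith [(abs_le.1 hM).1]) (abs_le.1 hM).2
  have h2 := mul_le_mul_of_nonneg_left h1 (sq_nonneg (kap r))
  nlinarith

theorem wedge (r e : E) (μ : ℝ) {ε : ℝ} (hε : 0 < ε) : ∃ C, 0 ≤ C ∧ ∀ (Ω : Set E) (u : E → ℝ), Sol r e μ Ω u →
    GG r e Ω u ≤ ε + C * ∫ x in Ω, En r e u x := by
  obtain ⟨A, hA0, hA⟩ := wedge_up r e μ (half_pos hε)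
  obtain ⟨B, hB0, hB⟩ := wedge_up (-r) e (-μ) (half_pos hε)
  set M := A + B + 1
  refine ⟨2 * (kap r ^ 2 * (1 + M ^ 2)), by positivity, fun Ω u hu => ?_⟩
  have h1 := hA Ω u hu
  have h2 := hB Ω _ hu.neg
  have i1 := int_wcWS hu A
  have i2 := int_wcWS hu.neg B
  have i3 := (int_En hu).const_mul (2 * (kap r ^ 2 * (1 + M ^ 2)))
  have hΩm := hu.isOpen.measurableSet
  have h3 : GG r e Ω u ≤ ∫ x in Ω, (wc r e A (x, u x) * (Wf u x - Sg r e (x, u x) (gradient u x))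
     + wc (-r) e B (x, - u x) * (Wf (fun y => - u y) x - Sg (-r) e (x, - u x) (gradient (fun y => - u y) x)))
     + 2 * (kap r ^ 2 * (1 + M ^ 2)) * En r e u x := by
    unfold GG
    refine setIntegral_mono_on ?_ ((i1.add i2).add i3) hΩm fun x hx => ?_
    · have := (int_phW hu).sub (int_phS hu)
      refine this.congr (Eventually.of_forall fun x => ?_)
      simp only [Pi.sub_apply]; ring
    · have ht : 0 < tL e (x, u x) := by rw [tL_apply]; exact hu.pos x hx
      have ht' : 0 < tL e (x, -u x) := by rw [tL_apply]; exact hu.pos x hx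
      rw [Wf_neg, grad_neg, Sg_neg]
      have hWS : 0 ≤ Wf u x - Sg r e (x, u x) (gradient u x) := by linarith [(abs_le.1 (S_le hu hx)).2]
      have hEn : 0 ≤ En r e u x := mul_nonneg (ph_nonneg _) (one_sub_sq hu hx).1
      have hw1 : 0 ≤ wc r e A (x, u x) := mul_nonneg (ph_nonneg _) (Real.smoothTransition.nonneg _)
      have hw2 : 0 ≤ wc (-r) e B (x, -u x) := mul_nonneg (ph_nonneg _) (Real.smoothTransition.nonneg _)
      have hw1' := mul_nonneg hw1 hWS
      have hw2' := mul_nonneg hw2 hWS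
      have hE' : 0 ≤ 2 * (kap r ^ 2 * (1 + M ^ 2)) * En r e u x := by positivity
      by_cases hm : |zL r (x, u x)| ≤ M * tL e (x, u x)
      · have := mul_le_mul_of_nonneg_left (mid_pt hu hx hm) (ph_nonneg (x, u x))
        have h5 : ph (x, u x) * (2 * (kap r ^ 2 * (1 + M ^ 2)) * (Wf u x - Sg r e (x, u x) (gradient u x) ^ 2 / Wf u x)) = 2 * (kap r ^ 2 * (1 + M ^ 2)) * En r e u x := by unfold En; ring
        linarith
      · push Not at hm
        rcases lt_abs.1 hm with h | h
        · have : wc r e A (x, u x) = ph (x, u x) := by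
            unfold wc
            have h6 : M < zL r (x, u x) / tL e (x, u x) := by rw [lt_div_iff₀ ht]; exact h
            rw [div_eq_mul_inv] at h6
            rw [Real.smoothTransition.one_of_one_le (by simp only [M] at h6; linarith), mul_one]
          rw [this] at hw1' ⊢
          linarith
        · have : wc (-r) e B (x, -u x) = ph (x, u x) := by
            unfold wc
            rw [zL_neg]
            have h6 : M < - zL r (x, u x) / tL e (x, -u x) := by
              rw [lt_div_iff₀ ht', tL_apply]; rw [tL_apply] at h; exact h
            rw [div_eq_mul_inv] at h6
            rw [Real.smoothTransition.one_of_one_le (by simp only [M] at h6; linarith), mul_one, ph_neg]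
          rw [this] at hw2' ⊢
          linarith
  have e1 := integral_add (i1.add i2) i3
  have e2 := integral_add i1 i2
  simp only [Pi.add_apply] at e1
  rw [integral_const_mul] at e1
  rw [e1, e2] at h3
  linarith

end Bern

namespace Bern
open MeasureTheory Filter Topology InnerProductSpace

variable {E : Type*} [NormedAddCommGroup E] [InnerProductSpace ℝ E] [FiniteDimensional ℝ E]
  [MeasurableSpace E] [BorelSpace E]


theorem GG_zero {r e : E} {μ : ℝ} {Ω : Set E} {u : E → ℝ} (hu : Sol r e μ Ω u) {T : ℝ} (hT : 0 < T) :
    GG r e (sO T Ω) (sc T u) = 0 := by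
  refine le_antisymm ?_ (GG_nonneg (hu.scale hT))
  refine le_of_forall_pos_le_add fun ε hε => ?_
  rw [zero_add]
  obtain ⟨C, hC0, hC⟩ := wedge r e μ (half_pos hε)
  obtain ⟨D, hD0, hD⟩ := energy_ineq r e μ
  set A := 4 * (C * D + 1) / ε with hA
  have hCD : 0 ≤ C * D := mul_nonneg hC0 hD0
  have hA0 : 0 < A := by positivity
  obtain ⟨T1, hT1, hQ⟩ := QQ_small hu hT (ε := A⁻¹ / A) (by positivity)
  have hT1' : 0 < T1 := hT.trans_le hT1
  refine (GG_mono hu hT hT1).trans ((hC _ _ (hu.scale hT1')).trans ?_)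
  have h1 := hD _ _ (hu.scale hT1') A hA0
  have h2 : A * QQ (sO T1 Ω) (sc T1 u) ≤ A⁻¹ := by
    rw [lt_div_iff₀ hA0] at hQ; linarith
  have h3 : C * (∫ x in sO T1 Ω, En r e (sc T1 u) x) ≤ C * (D * (2 * A⁻¹)) := by
    refine mul_le_mul_of_nonneg_left (h1.trans ?_) hC0
    refine mul_le_mul_of_nonneg_left ?_ hD0
    linarith
  have h4 : C * (D * (2 * A⁻¹)) ≤ ε / 2 := by
    rw [hA, inv_div]
    have : C * (D * (2 * (ε / (4 * (C * D + 1))))) = (ε / 2) * ((C * D) / (C * D + 1)) := by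
      field_simp
      try ring
    rw [this]
    refine mul_le_of_le_one_right (by positivity) ?_
    rw [div_le_one (by positivity)]; linarith
  linarith

theorem S_eq_W {r e : E} {μ : ℝ} {Ω : Set E} {u : E → ℝ} (hu : Sol r e μ Ω u) {x : E} (hx : x ∈ Ω) :
    Sg r e (x, u x) (gradient u x) = Wf u x := by
  set T := 1 + ‖x‖ + |u x| with hT
  have hT0 : 0 < T := by positivity
  have hv := hu.scale hT0
  have hz := GG_zero hu hT0
  have hci : ContinuousOn (fun x => ph (x, sc T u x) * (Wf (sc T u) x - Sg r e (x, sc T u x) (gradient (sc T u) x))) (sO T Ω) :=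
    (cont_pair (cont_uΩ hv) ph_contDiff.continuous).mul ((cont_Wf hv.isOpen hv.c1).sub (cont_S hv))
  have hIg : IntegrableOn (fun x => ph (x, sc T u x) * (Wf (sc T u) x - Sg r e (x, sc T u x) (gradient (sc T u) x))) (sO T Ω) := by
    have := (int_phW hv).sub (int_phS hv)
    refine this.congr (Eventually.of_forall fun x => ?_)
    simp only [Pi.sub_apply]; ring
  have hae := (setIntegral_eq_zero_iff_of_nonneg_ae ((ae_restrict_iff' hv.isOpen.measurableSet).2 (Eventually.of_forall fun x hx =>
    mul_nonneg (ph_nonneg _) (sub_nonneg.2 ((le_abs_self _).trans (S_le hv hx))))) hIg).1 hz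
  have heq := Measure.eqOn_open_of_ae_eq hae hv.isOpen hci continuousOn_const
  have hy : T⁻¹ • x ∈ sO T Ω := by
    show T • T⁻¹ • x ∈ Ω
    rw [smul_inv_smul₀ hT0.ne']; exact hx
  have h1 := heq hy
  simp only [Pi.zero_apply] at h1
  have hd : DifferentiableAt ℝ u (T • T⁻¹ • x) := by rw [smul_inv_smul₀ hT0.ne']; exact hu.diff hx
  rw [Wf_sc hT0.ne' u _ hd, grad_sc hT0.ne' u _ hd] at h1
  have hsc : sc T u (T⁻¹ • x) = T⁻¹ * u x := by unfold sc; rw [smul_inv_smul₀ hT0.ne']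
  have hpair : ((T⁻¹ • x, T⁻¹ * u x) : E × ℝ) = T⁻¹ • (x, u x) := rfl
  rw [hsc, smul_inv_smul₀ hT0.ne', hpair, Sg_smul (inv_pos.2 hT0)] at h1
  have hp : 0 < ph (T⁻¹ • (x, u x)) := by
    apply ph_pos
    show ‖T⁻¹ • x‖ ^ 2 + (T⁻¹ * u x) ^ 2 < 2
    rw [norm_smul, norm_inv, Real.norm_eq_abs, abs_of_pos hT0, mul_pow, mul_pow, ← mul_add, inv_pow, inv_mul_lt_iff₀ (by positivity)]
    have := sq_abs (u x)
    nlinarith [norm_nonneg x, abs_nonneg (u x), mul_nonneg (norm_nonneg x) (abs_nonneg (u x))]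
  rcases mul_eq_zero.1 h1 with h | h
  · exact absurd h hp.ne'
  · linarith

theorem grad_formula {r e : E} {μ : ℝ} {Ω : Set E} {u : E → ℝ} (hu : Sol r e μ Ω u) {x : E} (hx : x ∈ Ω) :
    gradient u x = r + ((u x - inner ℝ r x) / inner ℝ e x) • e := by
  have ht : 0 < tL e (x, u x) := by rw [tL_apply]; exact hu.pos x hx
  have hρ := rho_pos (r := r) ht
  have hk := kap_pos r
  have hW := Wf_pos u x
  have hun := eth_unit hu.norm_e hu.re ht (p := (x, u x))
  have hSe := Sg_eq (r := r) ht (gradient u x)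
  rw [S_eq_W hu hx] at hSe
  have hW2 := Wf_sq u x
  have hs : ‖(Wf u x) • (eth r e (x, u x)).1 + gradient u x‖ ^ 2 + (Wf u x * (eth r e (x, u x)).2 - 1) ^ 2 = 0 := by
    rw [norm_add_sq_real, inner_smul_left, norm_smul, mul_pow, Real.norm_eq_abs, sq_abs]
    simp only [conj_trivial]
    generalize inner ℝ (eth r e (x, u x)).1 (gradient u x) = a at *
    have h1 : a = (eth r e (x, u x)).2 - Wf u x := by linarith
    have h2 : ‖(eth r e (x, u x)).1‖ ^ 2 = 1 - (eth r e (x, u x)).2 ^ 2 := by linarith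
    have h3 : ‖gradient u x‖ ^ 2 = Wf u x ^ 2 - 1 := by linarith
    rw [h1, h2, h3]; ring
  have h1 : ‖(Wf u x) • (eth r e (x, u x)).1 + gradient u x‖ ^ 2 = 0 := by
    nlinarith [sq_nonneg ‖(Wf u x) • (eth r e (x, u x)).1 + gradient u x‖, sq_nonneg (Wf u x * (eth r e (x, u x)).2 - 1)]
  have h2 : (Wf u x * (eth r e (x, u x)).2 - 1) ^ 2 = 0 := by linarith
  have h1' : gradient u x = - (Wf u x) • (eth r e (x, u x)).1 := by
    have := norm_eq_zero.1 (pow_eq_zero_iff (two_ne_zero) |>.1 h1)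
    rw [neg_smul]
    exact eq_neg_of_add_eq_zero_right this
  have h2' : Wf u x * (eth r e (x, u x)).2 = 1 := by
    have := pow_eq_zero_iff (two_ne_zero) |>.1 h2
    linarith
  have hβe : (eth r e (x, u x)).2 = tL e (x, u x) / (rho r e (x, u x) * kap r) := rfl
  have hα : (eth r e (x, u x)).1 = -(zL r (x, u x) / rho r e (x, u x)) • e - (eth r e (x, u x)).2 • r := rfl
  have hWe : Wf u x = rho r e (x, u x) * kap r / tL e (x, u x) := by
    rw [hβe] at h2'
    field_simp at h2' ⊢
    linarith
  rw [h1', hα, smul_sub, smul_smul, smul_smul, neg_mul, neg_mul, h2']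
  have : -(Wf u x * -(zL r (x, u x) / rho r e (x, u x))) = (u x - inner ℝ r x) / inner ℝ e x := by
    rw [hWe, zL_apply, ← tL_apply e x (u x)]
    field_simp
  rw [this, neg_smul, one_smul]
  abel

theorem Sol.affine {r e : E} {μ : ℝ} {Ω : Set E} {u : E → ℝ} (hu : Sol r e μ Ω u) (hne : Ω.Nonempty) :
    ∃ a : E, ∀ x ∈ closure Ω, u x = inner ℝ a x := by
  set h : E → ℝ := fun x => (u x - inner ℝ r x) * (inner ℝ e x)⁻¹ with hh
  have hder : ∀ x ∈ Ω, HasFDerivAt h (0 : E →L[ℝ] ℝ) x := by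
    intro x hx
    have ht := hu.pos x hx
    have h1 : HasFDerivAt u (fderiv ℝ u x) x := (hu.diff hx).hasFDerivAt
    have h2 : HasFDerivAt (fun x => inner ℝ r x) (innerSL ℝ r) x := (innerSL ℝ r).hasFDerivAt
    have h3 : HasFDerivAt (fun x => (inner ℝ e x)⁻¹) _ x := (hasDerivAt_inv ht.ne').comp_hasFDerivAt x (innerSL ℝ e).hasFDerivAt
    have h4 := (h1.sub h2).fun_mul h3
    refine h4.congr_fderiv ?_
    ext v
    simp only [ContinuousLinearMap.add_apply, ContinuousLinearMap.smul_apply, ContinuousLinearMap.sub_apply, smul_eq_mul, innerSL_apply_apply, ContinuousLinearMap.zero_apply, Pi.sub_apply]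
    rw [fderiv_eq_inner, grad_formula hu hx, inner_add_left, inner_smul_left]
    simp only [conj_trivial]
    field_simp
    ring
  obtain ⟨x0, hx0⟩ := hne
  have hconst : ∀ x ∈ Ω, h x = h x0 := fun x hx =>
    hu.isOpen.is_const_of_fderiv_eq_zero hu.convex.isPreconnected (fun y hy => (hder y hy).differentiableAt.differentiableWithinAt)
      (fun y hy => (hder y hy).fderiv) hx hx0
  refine ⟨r + (h x0) • e, ?_⟩
  have heq : EqOn u (fun x => inner ℝ (r + (h x0) • e) x) Ω := by
    intro x hx
    have ht := hu.pos x hx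
    show u x = inner ℝ (r + (h x0) • e) x
    rw [← hconst x hx, inner_add_left, inner_smul_left, hh]
    simp only [conj_trivial]
    field_simp
    ring
  exact heq.of_subset_closure hu.cont (by fun_prop) subset_closure Subset.rfl

end Bern

namespace Bern
open MeasureTheory Filter Topology InnerProductSpace

variable {E : Type*} [NormedAddCommGroup E] [InnerProductSpace ℝ E] [FiniteDimensional ℝ E]
  [MeasurableSpace E] [BorelSpace E]


abbrev EE (n : ℕ) := EuclideanSpace ℝ (Fin n)

theorem inner_single_grad {n : ℕ} (u : EE n → ℝ) (i : Fin n) (x : EE n) : gradient u x i = pderiv' u i x := by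
  unfold pderiv'
  rw [fderiv_eq_inner]
  simp only [EuclideanSpace.inner_single_right, one_mul, conj_trivial]

theorem Wf_eq {n : ℕ} (u : EE n → ℝ) (x : EE n) : Wf u x = Real.sqrt (1 + gradSq u x) := by
  unfold Wf gradSq
  rw [EuclideanSpace.norm_sq_eq]
  simp only [inner_single_grad, Real.norm_eq_abs, sq_abs]

theorem weak_of_mse {n : ℕ} {Ω : Set (EE n)} {u : EE n → ℝ} (hΩ : IsOpen Ω) (hu : ContDiffOn ℝ 2 u Ω)
    (hm : MinimalSurfaceEq u Ω) : WeakDF Ω (Ff u) := by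
  intro ψ h1 h2 h3
  set F : Fin n → EE n → ℝ := fun i y => pderiv' u i y / Real.sqrt (1 + gradSq u y) with hF
  have hd1 : ContDiffOn ℝ 1 (fun x => fderiv ℝ u x) Ω := hu.fderiv_of_isOpen hΩ (by norm_num)
  have hp1 : ∀ i, ContDiffOn ℝ 1 (pderiv' u i) Ω := fun i => hd1.clm_apply contDiffOn_const
  have hg1 : ContDiffOn ℝ 1 (fun x => Real.sqrt (1 + gradSq u x)) Ω := by
    refine ContDiffOn.sqrt (contDiffOn_const.add (ContDiffOn.sum fun i _ => (hp1 i).pow 2)) (fun x _ => ?_)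
    have : 0 ≤ gradSq u x := Finset.sum_nonneg fun i _ => sq_nonneg _
    positivity
  have hF1 : ∀ i, ContDiffOn ℝ 1 (F i) Ω := fun i => (hp1 i).div hg1 (fun x _ => by
    rw [← Wf_eq]; exact (Wf_pos u x).ne')
  have h0 : ∀ i, ∀ x ∈ Ω, x ∉ tsupport ψ → ψ x * F i x = 0 := fun i x _ hx => by
    rw [image_eq_zero_of_notMem_tsupport hx, zero_mul]
  have hK : IsCompact (tsupport ψ) := h2
  have hg : ∀ i, ContDiffOn ℝ 1 (fun x => ψ x * F i x) Ω := fun i => h1.contDiffOn.mul (hF1 i)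
  set g : Fin n → EE n → ℝ := fun i => Ω.indicator (fun x => ψ x * F i x) with hgdef
  have hgc : ∀ i, ContDiff ℝ 1 (g i) := fun i => contDiff_indicator hΩ hK h3 (hg i) (h0 i)
  have hgt : ∀ i, tsupport (g i) ⊆ tsupport ψ := fun i => tsupport_indicator hK (h0 i)
  have hgs : ∀ i, HasCompactSupport (g i) := fun i =>
    HasCompactSupport.of_support_subset_isCompact hK ((subset_tsupport _).trans (hgt i))
  have hz : ∀ i, ∫ x, fderiv ℝ (g i) x (EuclideanSpace.single i 1) = 0 := fun i =>
    weakDF_const Ω (EuclideanSpace.single i (1:ℝ)) (g i) (hgc i) (hgs i) ((hgt i).trans h3)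
  have hIg : ∀ i, Integrable (fun x => fderiv ℝ (g i) x (EuclideanSpace.single i 1)) := fun i =>
    (((hgc i).continuous_fderiv (by norm_num)).clm_apply continuous_const).integrable_of_hasCompactSupport ((hgs i).fderiv_apply ℝ _)
  have hsum : ∫ x, ∑ i, fderiv ℝ (g i) x (EuclideanSpace.single i 1) = 0 := by
    rw [integral_finsetSum _ (fun i _ => hIg i)]
    simp [hz]
  rw [← hsum]
  congr 1
  ext x
  by_cases hx : x ∈ Ω
  · have hgi : ∀ i, fderiv ℝ (g i) x (EuclideanSpace.single i 1) = ψ x * pderiv' (F i) i x + F i x * pderiv' ψ i x := by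
      intro i
      have he : g i =ᶠ[𝓝 x] fun x => ψ x * F i x := by
        filter_upwards [hΩ.mem_nhds hx] with y hy
        exact indicator_of_mem hy _
      rw [he.fderiv_eq, fderiv_fun_mul (h1.differentiable (by norm_num) x) (((hF1 i).differentiableOn (by norm_num)).differentiableAt (hΩ.mem_nhds hx))]
      simp [pderiv']
    simp only [hgi, Finset.sum_add_distrib, ← Finset.mul_sum]
    rw [hm x hx, mul_zero, zero_add]
    have hFf : Ff u x = ∑ i, F i x • EuclideanSpace.single i (1:ℝ) := by
      ext j
      simp [Ff, hF, inner_single_grad, Wf_eq, Finset.sum_apply, div_eq_inv_mul, Pi.single_apply]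
    rw [hFf, map_sum]
    simp only [map_smul, smul_eq_mul, pderiv']
  · have hxψ : x ∉ tsupport ψ := fun h => hx (h3 h)
    have e1 : fderiv ℝ ψ x = 0 := by
      by_contra hne
      exact hxψ (support_fderiv_subset ℝ hne)
    have e2 : ∀ i, fderiv ℝ (g i) x = 0 := by
      intro i
      by_contra hne
      exact hxψ (hgt i (support_fderiv_subset ℝ hne))
    simp [e1, e2]

theorem pderiv_shift {n : ℕ} (u : EE n → ℝ) (p : EE n) (c : ℝ) (i : Fin n) (x : EE n) :
    pderiv' (fun y => u (y + p) - c) i x = pderiv' u i (x + p) := by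
  unfold pderiv'
  rw [fderiv_sub_const, fderiv_comp_add_right]

theorem mse_shift {n : ℕ} {Ω : Set (EE n)} {u : EE n → ℝ} (hm : MinimalSurfaceEq u Ω) (p : EE n) (c : ℝ) :
    MinimalSurfaceEq (fun y => u (y + p) - c) ((fun y => y + p) ⁻¹' Ω) := by
  intro x hx
  have h := hm (x + p) hx
  rw [← h]
  refine Finset.sum_congr rfl fun i _ => ?_
  have : (fun y => pderiv' (fun y => u (y + p) - c) i y / Real.sqrt (1 + gradSq (fun y => u (y + p) - c) y))
      = fun y => (fun z => pderiv' u i z / Real.sqrt (1 + gradSq u z)) (y + p) := by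
    ext y
    simp only [gradSq, pderiv_shift]
  rw [this]
  unfold pderiv'
  rw [fderiv_comp_add_right (f := fun z => fderiv ℝ u z (EuclideanSpace.single i 1) / Real.sqrt (1 + gradSq u z))]

theorem inner_eq_sum {n : ℕ} (a x : EE n) : inner ℝ a x = ∑ i, a i * x i := by
  rw [PiLp.inner_apply]
  refine Finset.sum_congr rfl fun i _ => ?_
  simp [mul_comm]

end Bern
theorem bernstein_convex_affine
    (n : ℕ) (hn : 1 ≤ n)
    (Ω : Set (EuclideanSpace ℝ (Fin n)))
    (hne : Ω.Nonempty) (hopen : IsOpen Ω) (hconv : Convex ℝ Ω) (hproper : Ω ≠ univ)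
    (u : EuclideanSpace ℝ (Fin n) → ℝ)
    (hu2 : ContDiffOn ℝ 2 u Ω) (hu0 : ContinuousOn u (closure Ω))
    (hmse : MinimalSurfaceEq u Ω)
    (a : EuclideanSpace ℝ (Fin n)) (b : ℝ)
    (hbdry : ∀ x ∈ frontier Ω, u x = ∑ i, a i * x i + b) :
    ∃ (a' : EuclideanSpace ℝ (Fin n)) (b' : ℝ),
      ∀ x ∈ closure Ω, u x = ∑ i, a' i * x i + b' := by
  obtain ⟨p, hp⟩ : (frontier Ω).Nonempty := by
    rw [nonempty_frontier_iff]
    exact ⟨hne, hproper⟩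
  have hpn : p ∉ Ω := by
    rw [hopen.frontier_eq] at hp; exact hp.2
  obtain ⟨f, hf⟩ := geometric_hahn_banach_point_open hconv hopen hpn
  set v : EuclideanSpace ℝ (Fin n) := (InnerProductSpace.toDual ℝ _).symm f with hv
  have hfv : ∀ x, f x = inner ℝ v x := fun x => by rw [hv, InnerProductSpace.toDual_symm_apply]
  have hv0 : v ≠ 0 := by
    intro h0
    obtain ⟨y, hy⟩ := hne
    have := hf y hy
    rw [hfv, hfv, h0, inner_zero_left, inner_zero_left] at this
    exact lt_irrefl _ this
  have hvn : 0 < ‖v‖ := norm_pos_iff.2 hv0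
  set e := (‖v‖)⁻¹ • v with he
  have hen : ‖e‖ = 1 := by rw [he, norm_smul, norm_inv, norm_norm, inv_mul_cancel₀ hvn.ne']
  set μ : ℝ := inner ℝ a e with hμ
  set r := a - μ • e with hr
  have hre : inner ℝ r e = 0 := by
    rw [hr, inner_sub_left, inner_smul_left, real_inner_self_eq_norm_sq, hen]
    simp [hμ]
  have hq : r + μ • e = a := by rw [hr]; abel
  let H : EuclideanSpace ℝ (Fin n) ≃ₜ EuclideanSpace ℝ (Fin n) := Homeomorph.addRight p
  have hcl : closure ((fun y => y + p) ⁻¹' Ω) = (fun y => y + p) ⁻¹' (closure Ω) := (H.preimage_closure Ω).symm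
  have hfr : frontier ((fun y => y + p) ⁻¹' Ω) = (fun y => y + p) ⁻¹' (frontier Ω) := (H.preimage_frontier Ω).symm
  have hop : IsOpen ((fun y => y + p) ⁻¹' Ω) := hopen.preimage (by fun_prop)
  have hc2 : ContDiffOn ℝ 2 (fun y => u (y + p) - u p) ((fun y => y + p) ⁻¹' Ω) :=
    (hu2.comp (contDiff_id.add contDiff_const).contDiffOn (fun x hx => hx)).sub contDiffOn_const
  have hsol : Bern.Sol r e μ ((fun y => y + p) ⁻¹' Ω) (fun y => u (y + p) - u p) :=
    { isOpen := hop
      convex := hconv.translate_preimage_left p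
      zero_mem := by
        rw [hcl]; show 0 + p ∈ closure Ω
        rw [zero_add]; exact frontier_subset_closure hp
      norm_e := hen
      re := hre
      pos := fun x hx => by
        have := hf (x + p) hx
        rw [hfv, hfv, inner_add_right] at this
        rw [he, inner_smul_left]
        simp only [conj_trivial]
        exact mul_pos (inv_pos.2 hvn) (by linarith)
      c2 := hc2
      cont := by
        rw [hcl]
        exact (hu0.comp (f := fun y => y + p) (by fun_prop) (fun x hx => hx)).sub continuousOn_const
      bdry := fun x hx => by
        rw [hfr] at hx
        show u (x + p) - u p = _
        rw [hbdry _ hx, hbdry _ hp, hq, ← Bern.inner_eq_sum, ← Bern.inner_eq_sum, inner_add_right]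
        ring
      weak := Bern.weak_of_mse hop hc2 (Bern.mse_shift hmse p _) }
  obtain ⟨a', ha'⟩ := hsol.affine (by
    obtain ⟨y, hy⟩ := hne
    exact ⟨y - p, by simpa using hy⟩)
  refine ⟨a', u p - inner ℝ a' p, fun x hx => ?_⟩
  have := ha' (x - p) (by rw [hcl]; show x - p + p ∈ closure Ω; rwa [sub_add_cancel])
  simp only [sub_add_cancel] at this
  rw [← Bern.inner_eq_sum]
  rw [inner_sub_right] at this
  linarith
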